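/- (Three-circle theorem for the Willmore energy, Theorem 3.1.) For every positive integer m and every q ∈ (0,2) there exist L₀ > 0 and ε₀ > 0 (depending on m, q) such that: if L > L₀ and f : Q → ℝⁿ is a conformal Willmore immersion on Q := Q₁ ∪ Q₂ ∪ Q₃ = [0,3L]×S¹ whose conformal factor is e^{2u} with u(t,θ) = −mt + v(t,θ), if τ₁(f,c)(t) = 0 and τ₂(f,S)(t) = 0 for all t, all c ∈ ℝⁿ and all n×n real skew-symmetric matrices S, and if ∫_{Q_i} |A|² dV_g + sup_{Q_i} |∇v| < ε₀ for i = 1,2,3, then ∫_{Q₂} |H|² dV_g ≤ e^{−qL} ( ∫_{Q₁} |H|² dV_g + ∫_{Q₃} |H|² dV_g ). -/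

import Mathlib

noncomputable section

open Real MeasureTheory Set Filter
open scoped InnerProductSpace

/-- Partial derivative in the first variable. -/
def pt {F : Type*} [NormedAddCommGroup F] [NormedSpace ℝ F] (f : ℝ → ℝ → F) (t θ : ℝ) : F :=
  deriv (fun s => f s θ) t

/-- Partial derivative in the second variable. -/
def pth {F : Type*} [NormedAddCommGroup F] [NormedSpace ℝ F] (f : ℝ → ℝ → F) (t θ : ℝ) : F :=
  deriv (fun s => f t s) θ

variable {n : ℕ}

/-- Mean curvature vector `H = e^{-2u}(∂_t² f + ∂_θ² f)`. -/
def Hmc (f : ℝ → ℝ → EuclideanSpace ℝ (Fin n)) (u : ℝ → ℝ → ℝ) :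
    ℝ → ℝ → EuclideanSpace ℝ (Fin n) :=
  fun t θ => Real.exp (-(2 * u t θ)) • (pt (pt f) t θ + pth (pth f) t θ)

/-- Component `A_tt` of the second fundamental form. -/
def Att (f : ℝ → ℝ → EuclideanSpace ℝ (Fin n)) (u : ℝ → ℝ → ℝ) :
    ℝ → ℝ → EuclideanSpace ℝ (Fin n) :=
  fun t θ => pt (pt f) t θ - pt u t θ • pt f t θ + pth u t θ • pth f t θ

/-- Component `A_tθ` of the second fundamental form. -/
def Atth (f : ℝ → ℝ → EuclideanSpace ℝ (Fin n)) (u : ℝ → ℝ → ℝ) :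
    ℝ → ℝ → EuclideanSpace ℝ (Fin n) :=
  fun t θ => pt (pth f) t θ - pth u t θ • pt f t θ - pt u t θ • pth f t θ

/-- Component `A_θθ` of the second fundamental form. -/
def Athth (f : ℝ → ℝ → EuclideanSpace ℝ (Fin n)) (u : ℝ → ℝ → ℝ) :
    ℝ → ℝ → EuclideanSpace ℝ (Fin n) :=
  fun t θ => pth (pth f) t θ + pt u t θ • pt f t θ - pth u t θ • pth f t θ

/-- `|A|²`, the squared norm of the second fundamental form. -/
def Asq (f : ℝ → ℝ → EuclideanSpace ℝ (Fin n)) (u : ℝ → ℝ → ℝ) : ℝ → ℝ → ℝ :=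
  fun t θ => Real.exp (-(4 * u t θ)) *
    (‖Att f u t θ‖ ^ 2 + 2 * ‖Atth f u t θ‖ ^ 2 + ‖Athth f u t θ‖ ^ 2)

/-- The left-hand side of the Willmore equation in conformal coordinates. -/
def willmoreOp (f : ℝ → ℝ → EuclideanSpace ℝ (Fin n)) (u : ℝ → ℝ → ℝ) :
    ℝ → ℝ → EuclideanSpace ℝ (Fin n) :=
  fun t θ =>
    (2 : ℝ) • (pt (pt (Hmc f u)) t θ + pth (pth (Hmc f u)) t θ)
    + (4 : ℝ) • pt (fun a b => Real.exp (-(2 * u a b)) •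
        (⟪Hmc f u a b, Att f u a b⟫_ℝ • pt f a b + ⟪Hmc f u a b, Atth f u a b⟫_ℝ • pth f a b)) t θ
    + (4 : ℝ) • pth (fun a b => Real.exp (-(2 * u a b)) •
        (⟪Hmc f u a b, Atth f u a b⟫_ℝ • pt f a b + ⟪Hmc f u a b, Athth f u a b⟫_ℝ • pth f a b)) t θ
    - pt (fun a b => ‖Hmc f u a b‖ ^ 2 • pt f a b) t θ
    - pth (fun a b => ‖Hmc f u a b‖ ^ 2 • pth f a b) t θ

/-- A conformal immersion of a cylinder `s × S¹` (in the `t` variable),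
with conformal factor `e^{2u}`; maps are `2π`-periodic in the second variable. -/
structure ConfImm (f : ℝ → ℝ → EuclideanSpace ℝ (Fin n)) (u : ℝ → ℝ → ℝ) (s : Set ℝ) :
    Prop where
  smooth_f : ContDiff ℝ (⊤ : ℕ∞) (fun p : ℝ × ℝ => f p.1 p.2)
  smooth_u : ContDiff ℝ (⊤ : ℕ∞) (fun p : ℝ × ℝ => u p.1 p.2)
  periodic_f : ∀ t θ, f t (θ + 2 * π) = f t θ
  periodic_u : ∀ t θ, u t (θ + 2 * π) = u t θ
  conf_t : ∀ t ∈ s, ∀ θ : ℝ, ‖pt f t θ‖ ^ 2 = Real.exp (2 * u t θ)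
  conf_th : ∀ t ∈ s, ∀ θ : ℝ, ‖pth f t θ‖ ^ 2 = Real.exp (2 * u t θ)
  conf_orth : ∀ t ∈ s, ∀ θ : ℝ, ⟪pt f t θ, pth f t θ⟫_ℝ = 0

/-- A conformal Willmore immersion of a cylinder. -/
structure ConfWillmore (f : ℝ → ℝ → EuclideanSpace ℝ (Fin n)) (u : ℝ → ℝ → ℝ) (s : Set ℝ)
    extends ConfImm f u s : Prop where
  willmore : ∀ t ∈ s, ∀ θ : ℝ, willmoreOp f u t θ = 0

/-- The first residue `τ₁(f,c)(t)`. -/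
def tau1 (f : ℝ → ℝ → EuclideanSpace ℝ (Fin n)) (u : ℝ → ℝ → ℝ)
    (c : EuclideanSpace ℝ (Fin n)) (t : ℝ) : ℝ :=
  ⟪(-2 : ℝ) • (∫ θ in (0 : ℝ)..(2 * π), pt (Hmc f u) t θ)
    - (4 : ℝ) • (∫ θ in (0 : ℝ)..(2 * π), Real.exp (-(2 * u t θ)) •
        (⟪Hmc f u t θ, Att f u t θ⟫_ℝ • pt f t θ + ⟪Hmc f u t θ, Atth f u t θ⟫_ℝ • pth f t θ))
    + ∫ θ in (0 : ℝ)..(2 * π), ‖Hmc f u t θ‖ ^ 2 • pt f t θ, c⟫_ℝ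

/-- The second residue `τ₂(f,S)(t)`, for a matrix `S`. -/
def tau2 (f : ℝ → ℝ → EuclideanSpace ℝ (Fin n)) (u : ℝ → ℝ → ℝ)
    (S : Matrix (Fin n) (Fin n) ℝ) (t : ℝ) : ℝ :=
  2 * (∫ θ in (0 : ℝ)..(2 * π),
        (⟪Hmc f u t θ, pt (fun a b => (Matrix.toEuclideanLin S) (f a b)) t θ⟫_ℝ
          - ⟪pt (Hmc f u) t θ, (Matrix.toEuclideanLin S) (f t θ)⟫_ℝ))
  - 4 * (∫ θ in (0 : ℝ)..(2 * π), Real.exp (-(2 * u t θ)) *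
        (⟪Hmc f u t θ, Att f u t θ⟫_ℝ * ⟪pt f t θ, (Matrix.toEuclideanLin S) (f t θ)⟫_ℝ
          + ⟪Hmc f u t θ, Atth f u t θ⟫_ℝ * ⟪pth f t θ, (Matrix.toEuclideanLin S) (f t θ)⟫_ℝ))
  + ∫ θ in (0 : ℝ)..(2 * π), ‖Hmc f u t θ‖ ^ 2 * ⟪pt f t θ, (Matrix.toEuclideanLin S) (f t θ)⟫_ℝ

/-- Pointwise norm of the gradient of a scalar function on the cylinder. -/
def gradNorm (u : ℝ → ℝ → ℝ) (t θ : ℝ) : ℝ :=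
  Real.sqrt ((pt u t θ) ^ 2 + (pth u t θ) ^ 2)

/-- Integral of a density over the piece `[a,b] × S¹` of the cylinder. -/
def cylInt (F : ℝ → ℝ → ℝ) (a b : ℝ) : ℝ :=
  ∫ p in Set.Icc a b ×ˢ Set.Icc (0 : ℝ) (2 * π), F p.1 p.2

/-- The density `|A|² dV_g` (with respect to `dt dθ`). -/
def Adens (f : ℝ → ℝ → EuclideanSpace ℝ (Fin n)) (u : ℝ → ℝ → ℝ) : ℝ → ℝ → ℝ :=
  fun t θ => Asq f u t θ * Real.exp (2 * u t θ)

/-- The density `|H|² dV_g` (with respect to `dt dθ`). -/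
def Hdens (f : ℝ → ℝ → EuclideanSpace ℝ (Fin n)) (u : ℝ → ℝ → ℝ) : ℝ → ℝ → ℝ :=
  fun t θ => ‖Hmc f u t θ‖ ^ 2 * Real.exp (2 * u t θ)

section TwoVariableCalculus

variable {F : Type*} [NormedAddCommGroup F] [NormedSpace ℝ F]

/-- Smoothness of a curried function of two real variables. -/
def Smooth₂ (f : ℝ → ℝ → F) : Prop :=
  ContDiff ℝ (⊤ : ℕ∞) (fun p : ℝ × ℝ => f p.1 p.2)

/-- `2π`-periodicity in the second variable. -/
def Periodic₂ (f : ℝ → ℝ → F) : Prop := ∀ t θ, f t (θ + 2 * π) = f t θ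

lemma Smooth₂.continuous {f : ℝ → ℝ → F} (hf : Smooth₂ f) :
    Continuous (fun p : ℝ × ℝ => f p.1 p.2) := ContDiff.continuous hf

lemma Smooth₂.continuous_left {f : ℝ → ℝ → F} (hf : Smooth₂ f) (θ : ℝ) :
    Continuous (fun t => f t θ) :=
  hf.continuous.comp (by fun_prop : Continuous fun t : ℝ => (t, θ))

lemma Smooth₂.continuous_right {f : ℝ → ℝ → F} (hf : Smooth₂ f) (t : ℝ) :
    Continuous (f t) :=
  hf.continuous.comp (by fun_prop : Continuous fun θ : ℝ => (t, θ))

lemma Smooth₂.differentiable {f : ℝ → ℝ → F} (hf : Smooth₂ f) :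
    Differentiable ℝ (fun p : ℝ × ℝ => f p.1 p.2) :=
  ContDiff.differentiable hf (by simp)

lemma Smooth₂.hasDerivAt_fderiv_fst {f : ℝ → ℝ → F} (hf : Smooth₂ f) (t θ : ℝ) :
    HasDerivAt (fun s => f s θ) (fderiv ℝ (fun p : ℝ × ℝ => f p.1 p.2) (t, θ) (1, 0)) t := by
  have h := (hf.differentiable (t, θ)).hasFDerivAt
  exact h.comp_hasDerivAt t ((hasDerivAt_id t).prodMk (hasDerivAt_const t θ))

lemma Smooth₂.hasDerivAt_fderiv_snd {f : ℝ → ℝ → F} (hf : Smooth₂ f) (t θ : ℝ) :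
    HasDerivAt (fun s => f t s) (fderiv ℝ (fun p : ℝ × ℝ => f p.1 p.2) (t, θ) (0, 1)) θ := by
  have h := (hf.differentiable (t, θ)).hasFDerivAt
  exact h.comp_hasDerivAt θ ((hasDerivAt_const θ t).prodMk (hasDerivAt_id θ))

lemma Smooth₂.hasDerivAt_pt {f : ℝ → ℝ → F} (hf : Smooth₂ f) (t θ : ℝ) :
    HasDerivAt (fun s => f s θ) (pt f t θ) t :=
  (hf.hasDerivAt_fderiv_fst t θ).differentiableAt.hasDerivAt

lemma Smooth₂.hasDerivAt_pth {f : ℝ → ℝ → F} (hf : Smooth₂ f) (t θ : ℝ) :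
    HasDerivAt (fun s => f t s) (pth f t θ) θ :=
  (hf.hasDerivAt_fderiv_snd t θ).differentiableAt.hasDerivAt

lemma Smooth₂.pt_eq {f : ℝ → ℝ → F} (hf : Smooth₂ f) (t θ : ℝ) :
    pt f t θ = fderiv ℝ (fun p : ℝ × ℝ => f p.1 p.2) (t, θ) (1, 0) :=
  (hf.hasDerivAt_fderiv_fst t θ).deriv

lemma Smooth₂.pth_eq {f : ℝ → ℝ → F} (hf : Smooth₂ f) (t θ : ℝ) :
    pth f t θ = fderiv ℝ (fun p : ℝ × ℝ => f p.1 p.2) (t, θ) (0, 1) :=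
  (hf.hasDerivAt_fderiv_snd t θ).deriv

lemma Smooth₂.contDiff_fderiv {f : ℝ → ℝ → F} (hf : Smooth₂ f) :
    ContDiff ℝ (⊤ : ℕ∞) (fderiv ℝ (fun p : ℝ × ℝ => f p.1 p.2)) :=
  ContDiff.fderiv_right hf (by simp)

lemma Smooth₂.dt {f : ℝ → ℝ → F} (hf : Smooth₂ f) : Smooth₂ (pt f) := by
  have h : (fun p : ℝ × ℝ => pt f p.1 p.2) =
      fun p => fderiv ℝ (fun p : ℝ × ℝ => f p.1 p.2) p (1, 0) := by
    funext p; exact hf.pt_eq p.1 p.2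
  unfold Smooth₂
  rw [h]
  exact hf.contDiff_fderiv.clm_apply contDiff_const

lemma Smooth₂.dth {f : ℝ → ℝ → F} (hf : Smooth₂ f) : Smooth₂ (pth f) := by
  have h : (fun p : ℝ × ℝ => pth f p.1 p.2) =
      fun p => fderiv ℝ (fun p : ℝ × ℝ => f p.1 p.2) p (0, 1) := by
    funext p; exact hf.pth_eq p.1 p.2
  unfold Smooth₂
  rw [h]
  exact hf.contDiff_fderiv.clm_apply contDiff_const

lemma Smooth₂.pt_pth {f : ℝ → ℝ → F} (hf : Smooth₂ f) (t θ : ℝ) :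
    pt (pth f) t θ = pth (pt f) t θ := by
  have hsym : IsSymmSndFDerivAt ℝ (fun p : ℝ × ℝ => f p.1 p.2) (t, θ) :=
    (ContDiff.contDiffAt hf).isSymmSndFDerivAt
      (by rw [minSmoothness_of_isRCLikeNormedField]; exact WithTop.coe_le_coe.2 le_top)
  have hd : DifferentiableAt ℝ (fderiv ℝ (fun p : ℝ × ℝ => f p.1 p.2)) (t, θ) :=
    (hf.contDiff_fderiv.differentiable (by simp)) _
  have key : ∀ v : ℝ × ℝ, HasFDerivAt
      (fun p => fderiv ℝ (fun p : ℝ × ℝ => f p.1 p.2) p v)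
      ((fderiv ℝ (fderiv ℝ (fun p : ℝ × ℝ => f p.1 p.2)) (t, θ)).flip v) (t, θ) := by
    intro v
    have := hd.hasFDerivAt.clm_apply (hasFDerivAt_const v (t, θ))
    simpa using this
  rw [hf.dth.pt_eq, hf.dt.pth_eq]
  have h1 : (fun p : ℝ × ℝ => pt f p.1 p.2) =
      fun p => fderiv ℝ (fun p : ℝ × ℝ => f p.1 p.2) p (1, 0) := by
    funext p; exact hf.pt_eq p.1 p.2
  have h2 : (fun p : ℝ × ℝ => pth f p.1 p.2) =
      fun p => fderiv ℝ (fun p : ℝ × ℝ => f p.1 p.2) p (0, 1) := by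
    funext p; exact hf.pth_eq p.1 p.2
  rw [h1, h2, (key _).fderiv, (key _).fderiv]
  exact hsym.eq _ _

lemma Smooth₂.add {f g : ℝ → ℝ → F} (hf : Smooth₂ f) (hg : Smooth₂ g) :
    Smooth₂ (fun t θ => f t θ + g t θ) := ContDiff.add hf hg

lemma Smooth₂.sub {f g : ℝ → ℝ → F} (hf : Smooth₂ f) (hg : Smooth₂ g) :
    Smooth₂ (fun t θ => f t θ - g t θ) := ContDiff.sub hf hg

lemma Smooth₂.smul {c : ℝ → ℝ → ℝ} {f : ℝ → ℝ → F} (hc : Smooth₂ c) (hf : Smooth₂ f) :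
    Smooth₂ (fun t θ => c t θ • f t θ) := ContDiff.smul hc hf

lemma Smooth₂.mul {c d : ℝ → ℝ → ℝ} (hc : Smooth₂ c) (hd : Smooth₂ d) :
    Smooth₂ (fun t θ => c t θ * d t θ) := ContDiff.mul hc hd

lemma Smooth₂.pow {c : ℝ → ℝ → ℝ} (hc : Smooth₂ c) (k : ℕ) :
    Smooth₂ (fun t θ => c t θ ^ k) := ContDiff.pow hc k

lemma Smooth₂.exp {c : ℝ → ℝ → ℝ} (hc : Smooth₂ c) :
    Smooth₂ (fun t θ => Real.exp (c t θ)) := ContDiff.exp hc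

lemma smooth₂_const (c : F) : Smooth₂ (fun _ _ => c) := contDiff_const

lemma smooth₂_fst {φ : ℝ → F} (hφ : ContDiff ℝ (⊤ : ℕ∞) φ) : Smooth₂ (fun t _ => φ t) :=
  hφ.comp contDiff_fst

lemma smooth₂_snd {φ : ℝ → F} (hφ : ContDiff ℝ (⊤ : ℕ∞) φ) : Smooth₂ (fun _ θ => φ θ) :=
  hφ.comp contDiff_snd

lemma Smooth₂.const_smul {f : ℝ → ℝ → F} (c : ℝ) (hf : Smooth₂ f) :
    Smooth₂ (fun t θ => c • f t θ) := (smooth₂_const c).smul hf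

lemma Smooth₂.const_mul {f : ℝ → ℝ → ℝ} (c : ℝ) (hf : Smooth₂ f) :
    Smooth₂ (fun t θ => c * f t θ) := (smooth₂_const c).mul hf

lemma Smooth₂.clm {G : Type*} [NormedAddCommGroup G] [NormedSpace ℝ G] (A : F →L[ℝ] G)
    {f : ℝ → ℝ → F} (hf : Smooth₂ f) : Smooth₂ (fun t θ => A (f t θ)) :=
  A.contDiff.comp hf

lemma Periodic₂.dt {f : ℝ → ℝ → F} (hf : Periodic₂ f) : Periodic₂ (pt f) := by
  intro t θ
  simp only [pt, hf _ θ]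

lemma Periodic₂.dth {f : ℝ → ℝ → F} (hf : Periodic₂ f) : Periodic₂ (pth f) := by
  intro t θ
  simp only [pth]
  rw [← deriv_comp_add_const]
  simp only [hf t]

end TwoVariableCalculus

section InnerSmooth
variable {E : Type*} [NormedAddCommGroup E] [InnerProductSpace ℝ E]

lemma Smooth₂.inner {f g : ℝ → ℝ → E} (hf : Smooth₂ f) (hg : Smooth₂ g) :
    Smooth₂ (fun t θ => ⟪f t θ, g t θ⟫_ℝ) := ContDiff.inner ℝ hf hg

lemma Smooth₂.norm_sq {f : ℝ → ℝ → E} (hf : Smooth₂ f) :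
    Smooth₂ (fun t θ => ‖f t θ‖ ^ 2) := ContDiff.norm_sq ℝ hf
end InnerSmooth

section DoubleIntegral

/-- The iterated integral over `[a,b] × [0,2π]`. -/
def dblInt (a b : ℝ) (F : ℝ → ℝ → ℝ) : ℝ := ∫ t in a..b, ∫ θ in (0 : ℝ)..(2 * π), F t θ

/-- Joint continuity of a curried function. -/
def Cont₂ {V : Type*} [TopologicalSpace V] (F : ℝ → ℝ → V) : Prop :=
  Continuous (fun p : ℝ × ℝ => F p.1 p.2)

variable {V : Type*} [NormedAddCommGroup V]

lemma Cont₂.right {F : ℝ → ℝ → V} (hF : Cont₂ F) (t : ℝ) : Continuous (F t) :=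
  Continuous.comp (g := fun p : ℝ × ℝ => F p.1 p.2) hF
    (by fun_prop : Continuous fun θ : ℝ => (t, θ))

lemma Cont₂.add {F G : ℝ → ℝ → V} (hF : Cont₂ F) (hG : Cont₂ G) :
    Cont₂ (fun t θ => F t θ + G t θ) := Continuous.add hF hG

lemma Cont₂.mul {F G : ℝ → ℝ → ℝ} (hF : Cont₂ F) (hG : Cont₂ G) :
    Cont₂ (fun t θ => F t θ * G t θ) := Continuous.mul hF hG

lemma Cont₂.const_mul (c : ℝ) {F : ℝ → ℝ → ℝ} (hF : Cont₂ F) :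
    Cont₂ (fun t θ => c * F t θ) := continuous_const.mul hF

lemma Cont₂.pow {F : ℝ → ℝ → ℝ} (hF : Cont₂ F) (k : ℕ) :
    Cont₂ (fun t θ => F t θ ^ k) := Continuous.pow hF k

lemma Cont₂.norm_sq {F : ℝ → ℝ → V} (hF : Cont₂ F) :
    Cont₂ (fun t θ => ‖F t θ‖ ^ 2) := (Continuous.norm hF).pow 2

variable [NormedSpace ℝ V]

lemma Smooth₂.cont₂ {f : ℝ → ℝ → V} (hf : Smooth₂ f) : Cont₂ f := hf.continuous

lemma Cont₂.continuous_integral {F : ℝ → ℝ → V} (hF : Cont₂ F) (c d : ℝ) :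
    Continuous (fun t => ∫ θ in c..d, F t θ) :=
  intervalIntegral.continuous_parametric_intervalIntegral_of_continuous' (μ := volume) hF c d

lemma Cont₂.intervalIntegrable_integral {F : ℝ → ℝ → V} (hF : Cont₂ F) (c d a b : ℝ) :
    IntervalIntegrable (fun t => ∫ θ in c..d, F t θ) volume a b :=
  (hF.continuous_integral c d).intervalIntegrable a b

lemma two_pi_nonneg : (0 : ℝ) ≤ 2 * π := by positivity

lemma dblInt_mono {a b : ℝ} (hab : a ≤ b) {F G : ℝ → ℝ → ℝ} (hF : Cont₂ F) (hG : Cont₂ G)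
    (h : ∀ t ∈ Icc a b, ∀ θ, F t θ ≤ G t θ) : dblInt a b F ≤ dblInt a b G := by
  refine intervalIntegral.integral_mono_on hab (hF.intervalIntegrable_integral _ _ _ _)
    (hG.intervalIntegrable_integral _ _ _ _) fun t ht => ?_
  exact intervalIntegral.integral_mono_on two_pi_nonneg
    ((hF.right t).intervalIntegrable _ _) ((hG.right t).intervalIntegrable _ _)
    fun θ _ => h t ht θ

lemma dblInt_nonneg {a b : ℝ} (hab : a ≤ b) {F : ℝ → ℝ → ℝ}
    (h : ∀ t ∈ Icc a b, ∀ θ, 0 ≤ F t θ) : 0 ≤ dblInt a b F :=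
  intervalIntegral.integral_nonneg hab fun t ht =>
    intervalIntegral.integral_nonneg two_pi_nonneg fun θ _ => h t ht θ

lemma dblInt_add {a b : ℝ} {F G : ℝ → ℝ → ℝ} (hF : Cont₂ F) (hG : Cont₂ G) :
    dblInt a b (fun t θ => F t θ + G t θ) = dblInt a b F + dblInt a b G := by
  unfold dblInt
  rw [← intervalIntegral.integral_add (hF.intervalIntegrable_integral _ _ _ _)
    (hG.intervalIntegrable_integral _ _ _ _)]
  congr 1
  funext t
  exact intervalIntegral.integral_add ((hF.right t).intervalIntegrable _ _)
    ((hG.right t).intervalIntegrable _ _)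

lemma dblInt_const_mul {a b c : ℝ} {F : ℝ → ℝ → ℝ} :
    dblInt a b (fun t θ => c * F t θ) = c * dblInt a b F := by
  simp only [dblInt, intervalIntegral.integral_const_mul]

lemma integral_integral_swap_of_cont₂ {F : ℝ → ℝ → V} (hF : Cont₂ F) {a b c d : ℝ} (hab : a ≤ b)
    (hcd : c ≤ d) :
    ∫ t in a..b, ∫ θ in c..d, F t θ = ∫ θ in c..d, ∫ t in a..b, F t θ := by
  simp only [intervalIntegral.integral_of_le hab, intervalIntegral.integral_of_le hcd]
  refine MeasureTheory.integral_integral_swap ?_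
  rw [Measure.prod_restrict]
  have : IntegrableOn (Function.uncurry F) (Icc a b ×ˢ Icc c d) (volume.prod volume) :=
    (ContinuousOn.integrableOn_compact (isCompact_Icc.prod isCompact_Icc)
      (Continuous.continuousOn hF))
  exact this.mono_set (prod_mono Ioc_subset_Icc_self Ioc_subset_Icc_self)

variable [CompleteSpace V]

lemma Smooth₂.integral_pt {p : ℝ → ℝ → V} (hp : Smooth₂ p) (a b θ : ℝ) :
    ∫ t in a..b, pt p t θ = p b θ - p a θ :=
  intervalIntegral.integral_eq_sub_of_hasDerivAt (fun t _ => hp.hasDerivAt_pt t θ)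
    ((hp.dt.continuous_left θ).intervalIntegrable _ _)

lemma Smooth₂.integral_pth {p : ℝ → ℝ → V} (hp : Smooth₂ p) (t a b : ℝ) :
    ∫ θ in a..b, pth p t θ = p t b - p t a :=
  intervalIntegral.integral_eq_sub_of_hasDerivAt (fun θ _ => hp.hasDerivAt_pth t θ)
    ((hp.dth.continuous_right t).intervalIntegrable _ _)

lemma Smooth₂.integral_pth_periodic {p : ℝ → ℝ → V} (hp : Smooth₂ p) (hp' : Periodic₂ p) (t : ℝ) :
    ∫ θ in (0 : ℝ)..(2 * π), pth p t θ = 0 := by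
  rw [hp.integral_pth, ← hp' t 0, zero_add, sub_self]

lemma Smooth₂.hasDerivAt_integral {p : ℝ → ℝ → V} (hp : Smooth₂ p) {c d : ℝ} (hcd : c ≤ d) (t : ℝ) :
    HasDerivAt (fun t => ∫ θ in c..d, p t θ) (∫ θ in c..d, pt p t θ) t := by
  have h0 : ∀ᶠ s in nhds t, ∫ θ in c..d, p s θ =
      (∫ θ in c..d, p (t - 1) θ) + ∫ τ in (t - 1)..s, ∫ θ in c..d, pt p τ θ := by
    filter_upwards [Ioi_mem_nhds (sub_one_lt t)] with s hs
    rw [integral_integral_swap_of_cont₂ hp.dt.continuous (le_of_lt hs) hcd]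
    simp only [hp.integral_pt]
    rw [intervalIntegral.integral_sub ((hp.continuous_right s).intervalIntegrable _ _)
      ((hp.continuous_right _).intervalIntegrable _ _)]
    abel
  refine HasDerivAt.congr_of_eventuallyEq ?_ h0
  have hc := Cont₂.continuous_integral (F := pt p) hp.dt.continuous c d
  exact (intervalIntegral.integral_hasDerivAt_right (hc.intervalIntegrable _ _)
    (hc.stronglyMeasurableAtFilter _ _) hc.continuousAt).const_add _

lemma Smooth₂.dblInt_pt {p : ℝ → ℝ → ℝ} (hp : Smooth₂ p) (a b : ℝ) :
    dblInt a b (pt p) =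
      (∫ θ in (0 : ℝ)..(2 * π), p b θ) - ∫ θ in (0 : ℝ)..(2 * π), p a θ :=
  intervalIntegral.integral_eq_sub_of_hasDerivAt
    (fun t _ => hp.hasDerivAt_integral two_pi_nonneg t)
    (Cont₂.intervalIntegrable_integral hp.dt.continuous _ _ _ _)

lemma Smooth₂.dblInt_pth {p : ℝ → ℝ → ℝ} (hp : Smooth₂ p) (hp' : Periodic₂ p) (a b : ℝ) :
    dblInt a b (pth p) = 0 := by
  simp [dblInt, hp.integral_pth_periodic hp']

/-- An inequality up to a divergence with vanishing boundary values integrates. -/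
lemma dblInt_le_of_le_add_div {a b : ℝ} (hab : a ≤ b) {A B p q : ℝ → ℝ → ℝ} (hA : Cont₂ A)
    (hB : Cont₂ B) (hp : Smooth₂ p) (hpa : ∀ θ, p a θ = 0) (hpb : ∀ θ, p b θ = 0)
    (hq : Smooth₂ q) (hq' : Periodic₂ q)
    (h : ∀ t ∈ Icc a b, ∀ θ, A t θ ≤ B t θ + pt p t θ + pth q t θ) :
    dblInt a b A ≤ dblInt a b B := by
  have h1 := dblInt_mono hab hA
    ((hB.add hp.dt.cont₂).add hq.dth.cont₂) h
  have h2 : dblInt a b (fun t θ => B t θ + pt p t θ + pth q t θ) =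
      dblInt a b B + dblInt a b (pt p) + dblInt a b (pth q) := by
    rw [dblInt_add (hB.add hp.dt.cont₂) hq.dth.cont₂,
      dblInt_add hB hp.dt.cont₂]
  rw [h2, hp.dblInt_pt, hq.dblInt_pth hq'] at h1
  simpa [hpa, hpb] using h1

end DoubleIntegral

section EnergyEstimates
variable {E : Type*} [NormedAddCommGroup E] [InnerProductSpace ℝ E]

lemma two_mul_abs_le_add {x p q : ℝ} (hp : 0 ≤ p) (hq : 0 ≤ q) (h : x ^ 2 ≤ p * q) :
    2 * |x| ≤ p + q := by
  have h1 : (2 * |x|) ^ 2 ≤ (p + q) ^ 2 := by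
    rw [mul_pow, sq_abs]
    nlinarith [sq_nonneg (p - q)]
  exact le_of_sq_le_sq h1 (by positivity)

lemma two_mul_abs_mul_inner_le {x c ρ σ : ℝ} {v w : E} (hρ : 0 ≤ ρ) (hσ : 0 ≤ σ) (hc : 0 ≤ c)
    (hx : x ^ 2 ≤ c * ρ * σ) :
    2 * |x * ⟪v, w⟫_ℝ| ≤ 2 * c * σ * ‖v‖ ^ 2 + ρ * ‖w‖ ^ 2 / 2 := by
  refine two_mul_abs_le_add (by positivity) (by positivity) ?_
  have h1 : ⟪v, w⟫_ℝ ^ 2 ≤ (‖v‖ * ‖w‖) ^ 2 := sq_le_sq' (by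
    linarith [neg_le_of_abs_le (abs_real_inner_le_norm v w)]) (real_inner_le_norm v w)
  calc (x * ⟪v, w⟫_ℝ) ^ 2 = x ^ 2 * ⟪v, w⟫_ℝ ^ 2 := by ring
    _ ≤ (c * ρ * σ) * (‖v‖ * ‖w‖) ^ 2 := by gcongr
    _ = _ := by ring

lemma two_mul_abs_inner_le (v w : E) : 2 * |⟪v, w⟫_ℝ| ≤ ‖v‖ ^ 2 + ‖w‖ ^ 2 := by
  have := abs_real_inner_le_norm v w
  nlinarith [sq_nonneg (‖v‖ - ‖w‖)]

lemma pt_mul_inner {ρ : ℝ → ℝ → ℝ} {p q : ℝ → ℝ → E} (hρ : Smooth₂ ρ) (hp : Smooth₂ p)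
    (hq : Smooth₂ q) (t θ : ℝ) :
    pt (fun t θ => ρ t θ * ⟪p t θ, q t θ⟫_ℝ) t θ =
      pt ρ t θ * ⟪p t θ, q t θ⟫_ℝ + ρ t θ * (⟪p t θ, pt q t θ⟫_ℝ + ⟪pt p t θ, q t θ⟫_ℝ) :=
  ((hρ.hasDerivAt_pt t θ).mul ((hp.hasDerivAt_pt t θ).inner ℝ (hq.hasDerivAt_pt t θ))).deriv

lemma pth_mul_inner {ρ : ℝ → ℝ → ℝ} {p q : ℝ → ℝ → E} (hρ : Smooth₂ ρ) (hp : Smooth₂ p)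
    (hq : Smooth₂ q) (t θ : ℝ) :
    pth (fun t θ => ρ t θ * ⟪p t θ, q t θ⟫_ℝ) t θ =
      pth ρ t θ * ⟪p t θ, q t θ⟫_ℝ + ρ t θ * (⟪p t θ, pth q t θ⟫_ℝ + ⟪pth p t θ, q t θ⟫_ℝ) :=
  ((hρ.hasDerivAt_pth t θ).mul ((hp.hasDerivAt_pth t θ).inner ℝ (hq.hasDerivAt_pth t θ))).deriv

lemma pt_const_mul {F : ℝ → ℝ → ℝ} (c : ℝ) (t θ : ℝ) :
    pt (fun t θ => c * F t θ) t θ = c * pt F t θ := deriv_const_mul_field c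

lemma pth_const_mul {F : ℝ → ℝ → ℝ} (c : ℝ) (t θ : ℝ) :
    pth (fun t θ => c * F t θ) t θ = c * pth F t θ := deriv_const_mul_field c

lemma Smooth₂.pt_add {V : Type*} [NormedAddCommGroup V] [NormedSpace ℝ V] {F G : ℝ → ℝ → V}
    (hF : Smooth₂ F) (hG : Smooth₂ G) (t θ : ℝ) :
    pt (fun t θ => F t θ + G t θ) t θ = pt F t θ + pt G t θ :=
  ((hF.hasDerivAt_pt t θ).add (hG.hasDerivAt_pt t θ)).deriv

lemma Smooth₂.pth_add {V : Type*} [NormedAddCommGroup V] [NormedSpace ℝ V] {F G : ℝ → ℝ → V}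
    (hF : Smooth₂ F) (hG : Smooth₂ G) (t θ : ℝ) :
    pth (fun t θ => F t θ + G t θ) t θ = pth F t θ + pth G t θ :=
  ((hF.hasDerivAt_pth t θ).add (hG.hasDerivAt_pth t θ)).deriv

/-- A weight `ρ` on `[a,b] × S¹` that vanishes on the boundary and whose gradient is controlled by
`ρ` and a second weight `σ`. -/
structure IsCutoffWeight (a b c : ℝ) (ρ σ : ℝ → ℝ → ℝ) : Prop where
  smooth : Smooth₂ ρ
  periodic : Periodic₂ ρ
  cont : Cont₂ σ
  left : ∀ θ, ρ a θ = 0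
  right : ∀ θ, ρ b θ = 0
  nonneg : ∀ t θ, 0 ≤ ρ t θ
  nonneg' : ∀ t θ, 0 ≤ σ t θ
  const_nonneg : 0 ≤ c
  pt_le : ∀ t ∈ Icc a b, ∀ θ, pt ρ t θ ^ 2 ≤ c * ρ t θ * σ t θ
  pth_le : ∀ t ∈ Icc a b, ∀ θ, pth ρ t θ ^ 2 ≤ c * ρ t θ * σ t θ

/-- Weighted div-curl estimate. -/
lemma IsCutoffWeight.divCurl {a b c : ℝ} {ρ σ : ℝ → ℝ → ℝ} (h : IsCutoffWeight a b c ρ σ)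
    (hab : a ≤ b) {p q : ℝ → ℝ → E} (hp : Smooth₂ p) (hp' : Periodic₂ p) (hq : Smooth₂ q)
    (hq' : Periodic₂ q) :
    dblInt a b (fun t θ => ρ t θ * (‖pt p t θ‖ ^ 2 + ‖pth p t θ‖ ^ 2 + ‖pt q t θ‖ ^ 2 +
        ‖pth q t θ‖ ^ 2)) ≤
      dblInt a b (fun t θ => 2 * (ρ t θ * (‖pt p t θ + pth q t θ‖ ^ 2 +
        ‖pth p t θ - pt q t θ‖ ^ 2)) + 8 * c * (σ t θ * ‖p t θ‖ ^ 2)) := by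
  have hρ := h.smooth
  refine dblInt_le_of_le_add_div hab
    (p := fun t θ => (-4) * (ρ t θ * ⟪p t θ, pth q t θ⟫_ℝ))
    (q := fun t θ => 4 * (ρ t θ * ⟪p t θ, pt q t θ⟫_ℝ))
    (hρ.cont₂.mul (((hp.dt.cont₂.norm_sq.add hp.dth.cont₂.norm_sq).add hq.dt.cont₂.norm_sq).add
      hq.dth.cont₂.norm_sq))
    ((Cont₂.const_mul 2 (hρ.cont₂.mul ((hp.dt.add hq.dth).cont₂.norm_sq.add
      (hp.dth.sub hq.dt).cont₂.norm_sq))).add (Cont₂.const_mul (8 * c)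
      (h.cont.mul hp.cont₂.norm_sq)))
    ((hρ.mul (hp.inner hq.dth)).const_mul (-4)) (by simp [h.left]) (by simp [h.right])
    ((hρ.mul (hp.inner hq.dt)).const_mul 4) ?_ ?_
  · intro t θ
    simp only [h.periodic t θ, hp' t θ, hq'.dt t θ]
  · intro t ht θ
    rw [pt_const_mul, pth_const_mul, pt_mul_inner hρ hp hq.dth, pth_mul_inner hρ hp hq.dt,
      hq.pt_pth, norm_add_sq_real, norm_sub_sq_real]
    have h1 := two_mul_abs_mul_inner_le (v := p t θ) (w := pth q t θ) (h.nonneg t θ)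
      (h.nonneg' t θ) h.const_nonneg (h.pt_le t ht θ)
    have h2 := two_mul_abs_mul_inner_le (v := p t θ) (w := pt q t θ) (h.nonneg t θ)
      (h.nonneg' t θ) h.const_nonneg (h.pth_le t ht θ)
    have h3 := le_abs_self (pt ρ t θ * ⟪p t θ, pth q t θ⟫_ℝ)
    have h4 := neg_abs_le (pth ρ t θ * ⟪p t θ, pt q t θ⟫_ℝ)
    have h3' := neg_abs_le (pt ρ t θ * ⟪p t θ, pth q t θ⟫_ℝ)
    have h4' := le_abs_self (pth ρ t θ * ⟪p t θ, pt q t θ⟫_ℝ)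
    have h5 := mul_nonneg (h.nonneg t θ) (sq_nonneg ‖pt p t θ‖)
    have h6 := mul_nonneg (h.nonneg t θ) (sq_nonneg ‖pth p t θ‖)
    linarith

/-- Weighted Caccioppoli inequality for `2ΔH + ∂_t P + ∂_θ R = 0`. -/
lemma IsCutoffWeight.caccioppoli {a b c : ℝ} {ρ σ : ℝ → ℝ → ℝ} (h : IsCutoffWeight a b c ρ σ)
    (hab : a ≤ b) {H P R : ℝ → ℝ → E} (hH : Smooth₂ H) (hH' : Periodic₂ H)
    (hP : Smooth₂ P) (hR : Smooth₂ R) (hR' : Periodic₂ R)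
    (heq : ∀ t ∈ Icc a b, ∀ θ,
      (2 : ℝ) • (pt (pt H) t θ + pth (pth H) t θ) + pt P t θ + pth R t θ = 0) :
    dblInt a b (fun t θ => ρ t θ * (‖pt H t θ‖ ^ 2 + ‖pth H t θ‖ ^ 2)) ≤
      dblInt a b (fun t θ => 6 * c * (σ t θ * ‖H t θ‖ ^ 2) +
        ρ t θ * (‖P t θ‖ ^ 2 + ‖R t θ‖ ^ 2)) := by
  have hρ := h.smooth
  refine dblInt_le_of_le_add_div hab
    (p := fun t θ => 2 * (ρ t θ * ⟪H t θ, pt H t θ⟫_ℝ) + ρ t θ * ⟪H t θ, P t θ⟫_ℝ)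
    (q := fun t θ => 2 * (ρ t θ * ⟪H t θ, pth H t θ⟫_ℝ) + ρ t θ * ⟪H t θ, R t θ⟫_ℝ)
    (hρ.cont₂.mul (hH.dt.cont₂.norm_sq.add hH.dth.cont₂.norm_sq))
    ((Cont₂.const_mul (6 * c) (h.cont.mul hH.cont₂.norm_sq)).add
      (hρ.cont₂.mul (hP.cont₂.norm_sq.add hR.cont₂.norm_sq)))
    (((hρ.mul (hH.inner hH.dt)).const_mul 2).add (hρ.mul (hH.inner hP)))
    (by simp [h.left]) (by simp [h.right])
    (((hρ.mul (hH.inner hH.dth)).const_mul 2).add (hρ.mul (hH.inner hR))) ?_ ?_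
  · intro t θ
    simp only [h.periodic t θ, hH' t θ, hH'.dth t θ, hR' t θ]
  · intro t ht θ
    rw [((hρ.mul (hH.inner hH.dt)).const_mul 2).pt_add (hρ.mul (hH.inner hP)),
      ((hρ.mul (hH.inner hH.dth)).const_mul 2).pth_add (hρ.mul (hH.inner hR)),
      pt_const_mul, pth_const_mul, pt_mul_inner hρ hH hH.dt, pth_mul_inner hρ hH hH.dth,
      pt_mul_inner hρ hH hP, pth_mul_inner hρ hH hR]
    have h0 := congrArg (fun w => ρ t θ * ⟪H t θ, w⟫_ℝ) (heq t ht θ)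
    simp only [inner_add_right, inner_smul_right, inner_zero_right, mul_zero] at h0
    have n0 := h.nonneg t θ
    have n1 := h.nonneg' t θ
    have nc := h.const_nonneg
    have a1 := two_mul_abs_mul_inner_le (v := H t θ) (w := pt H t θ) n0 n1 nc (h.pt_le t ht θ)
    have a2 := two_mul_abs_mul_inner_le (v := H t θ) (w := pth H t θ) n0 n1 nc (h.pth_le t ht θ)
    have a3 := two_mul_abs_mul_inner_le (v := H t θ) (w := P t θ) n0 n1 nc (h.pt_le t ht θ)
    have a4 := two_mul_abs_mul_inner_le (v := H t θ) (w := R t θ) n0 n1 nc (h.pth_le t ht θ)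
    have a5 := mul_le_mul_of_nonneg_left (two_mul_abs_inner_le (pt H t θ) (P t θ)) n0
    have a6 := mul_le_mul_of_nonneg_left (two_mul_abs_inner_le (pth H t θ) (R t θ)) n0
    have b1 := neg_abs_le (pt ρ t θ * ⟪H t θ, pt H t θ⟫_ℝ)
    have b2 := neg_abs_le (pth ρ t θ * ⟪H t θ, pth H t θ⟫_ℝ)
    have b3 := neg_abs_le (pt ρ t θ * ⟪H t θ, P t θ⟫_ℝ)
    have b4 := neg_abs_le (pth ρ t θ * ⟪H t θ, R t θ⟫_ℝ)
    have b5 := mul_le_mul_of_nonneg_left (neg_abs_le ⟪pt H t θ, P t θ⟫_ℝ) n0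
    have b6 := mul_le_mul_of_nonneg_left (neg_abs_le ⟪pth H t θ, R t θ⟫_ℝ) n0
    have c1 := mul_nonneg n0 (sq_nonneg ‖P t θ‖)
    have c2 := mul_nonneg n0 (sq_nonneg ‖R t θ‖)
    rw [real_inner_self_eq_norm_sq, real_inner_self_eq_norm_sq]
    linarith

/-- The one-dimensional Sobolev inequality on the circle, for nonnegative functions. -/
lemma le_integral_add_abs_deriv {k k' : ℝ → ℝ} (hk : ∀ x, HasDerivAt k (k' x) x)
    (hk' : Continuous k') (hk0 : ∀ x, 0 ≤ k x) {θ : ℝ} (hθ : θ ∈ Icc 0 (2 * π)) :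
    k θ ≤ ∫ x in (0 : ℝ)..(2 * π), (k x + |k' x|) := by
  have hkc : Continuous k := continuous_iff_continuousAt.2 fun x => (hk x).continuousAt
  set V := ∫ x in (0 : ℝ)..(2 * π), |k' x| with hV
  have hint : ∀ a b, IntervalIntegrable (fun x => |k' x|) volume a b :=
    fun a b => hk'.abs.intervalIntegrable a b
  have hV0 : 0 ≤ V := intervalIntegral.integral_nonneg two_pi_nonneg fun _ _ => abs_nonneg _
  have h1 : ∀ x ∈ Icc 0 (2 * π), k θ ≤ k x + V := by
    intro x hx
    have e : ∫ y in x..θ, k' y = k θ - k x :=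
      intervalIntegral.integral_eq_sub_of_hasDerivAt (fun y _ => hk y) (hk'.intervalIntegrable _ _)
    have h2 : |∫ y in x..θ, k' y| ≤ V := by
      calc |∫ y in x..θ, k' y| ≤ abs (∫ y in x..θ, |k' y|) :=
            by simpa only [Real.norm_eq_abs] using
              intervalIntegral.norm_integral_le_abs_integral_norm (f := k') (μ := volume)
        _ ≤ abs (∫ y in (0 : ℝ)..(2 * π), |k' y|) := by
            refine intervalIntegral.abs_integral_mono_interval ?_ ?_ (hint _ _)
            · rw [uIoc_of_le two_pi_nonneg, uIoc]
              exact Ioc_subset_Ioc (le_min hx.1 hθ.1) (max_le hx.2 hθ.2)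
            · exact Eventually.of_forall fun _ => abs_nonneg _
        _ = V := abs_of_nonneg hV0
    linarith [le_of_abs_le h2]
  have h2 : ∫ x in (0 : ℝ)..(2 * π), k θ ≤ ∫ x in (0 : ℝ)..(2 * π), (k x + V) :=
    intervalIntegral.integral_mono_on two_pi_nonneg (by simp)
      ((hkc.add continuous_const).intervalIntegrable _ _) h1
  rw [intervalIntegral.integral_add (hkc.intervalIntegrable _ _) (by simp)] at h2
  simp only [intervalIntegral.integral_const, sub_zero, smul_eq_mul] at h2
  rw [intervalIntegral.integral_add (hkc.intervalIntegrable _ _) (hint _ _)]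
  have h3 : 0 ≤ ∫ x in (0 : ℝ)..(2 * π), k x :=
    intervalIntegral.integral_nonneg two_pi_nonneg fun _ _ => hk0 _
  have h4 : 1 ≤ 2 * π := by linarith [pi_gt_three]
  by_contra! hcon
  nlinarith [mul_lt_mul_of_pos_left hcon (by positivity : 0 < 2 * π)]

/-- A function `g` on `[a,b] × S¹` with gradient controlled by `g` and a Dirichlet density `d`,
together with a cutoff `φ` vanishing at the left end. -/
structure IsInterpolated (a b Λ : ℝ) (φ : ℝ → ℝ) (g d : ℝ → ℝ → ℝ) : Prop where
  le : a ≤ b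
  smooth : Smooth₂ g
  cont : Cont₂ d
  smooth_cutoff : ContDiff ℝ (⊤ : ℕ∞) φ
  nonneg : ∀ t θ, 0 ≤ g t θ
  nonneg' : ∀ t θ, 0 ≤ d t θ
  const_nonneg : 0 ≤ Λ
  cutoff_left : φ a = 0
  cutoff_mem : ∀ t ∈ Icc a b, φ t ∈ Icc (0 : ℝ) 1
  cutoff_deriv : ∀ t ∈ Icc a b, |deriv φ t| ≤ 2
  pt_le : ∀ t ∈ Icc a b, ∀ θ, ∀ s > 0, |pt g t θ| ≤ (Λ + s) * g t θ + d t θ / s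
  pth_le : ∀ t ∈ Icc a b, ∀ θ, ∀ s > 0, |pth g t θ| ≤ (Λ + s) * g t θ + d t θ / s

lemma sq_mul_le_of_forall_pos {x Λ g d φ s : ℝ} (hg : 0 ≤ g) (hΛ : 0 ≤ Λ)
    (hφ : φ ∈ Icc (0 : ℝ) 1) (hs : 0 < s) (h : ∀ s > 0, x ≤ (Λ + s) * g + d / s) :
    φ ^ 2 * x ≤ (Λ + s) * g + φ ^ 4 * d / s := by
  rcases hφ.1.eq_or_lt with h0 | h0
  · rw [← h0]; simp; positivity
  · have h1 := mul_le_mul_of_nonneg_left (h (s / φ ^ 2) (by positivity)) (sq_nonneg φ)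
    have h2 : φ ^ 2 * ((Λ + s / φ ^ 2) * g + d / (s / φ ^ 2)) =
        (φ ^ 2 * Λ + s) * g + φ ^ 4 * d / s := by
      field_simp
    rw [h2] at h1
    have h3 : φ ^ 2 * Λ ≤ 1 * Λ := by
      gcongr
      nlinarith [hφ.1, hφ.2]
    nlinarith [mul_le_mul_of_nonneg_right h3 hg]

lemma IsInterpolated.sq_mul_integral_le {a b Λ : ℝ} {φ : ℝ → ℝ} {g d : ℝ → ℝ → ℝ}
    (h : IsInterpolated a b Λ φ g d) {s : ℝ} (hs : 0 < s) {t : ℝ} (ht : t ∈ Icc a b) :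
    φ t ^ 2 * ∫ θ in (0 : ℝ)..(2 * π), g t θ ≤
      (Λ + 4 + s) * dblInt a b g + dblInt a b (fun t θ => φ t ^ 4 * d t θ) / s := by
  have hφ₂ : Smooth₂ (fun t (_ : ℝ) => φ t) := smooth₂_fst h.smooth_cutoff
  have hsm : Smooth₂ (fun t θ => φ t ^ 2 * g t θ) := (hφ₂.pow 2).mul h.smooth
  have hφd : Cont₂ (fun t θ => φ t ^ 4 * d t θ) := (hφ₂.pow 4).cont₂.mul h.cont
  have e1 := hsm.dblInt_pt a t
  simp only [h.cutoff_left, intervalIntegral.integral_const_mul] at e1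
  norm_num at e1
  rw [← e1]
  have hc : Cont₂ (fun t θ => (Λ + 4 + s) * g t θ + s⁻¹ * (φ t ^ 4 * d t θ)) :=
    (h.smooth.cont₂.const_mul _).add (hφd.const_mul _)
  have e2 : dblInt a b (fun t θ => (Λ + 4 + s) * g t θ + s⁻¹ * (φ t ^ 4 * d t θ)) =
      (Λ + 4 + s) * dblInt a b g + dblInt a b (fun t θ => φ t ^ 4 * d t θ) / s := by
    rw [dblInt_add (h.smooth.cont₂.const_mul _) (hφd.const_mul _), dblInt_const_mul,
      dblInt_const_mul]
    ring
  rw [← e2]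
  have hΛ := h.const_nonneg
  have step1 : dblInt a t (pt fun t θ => φ t ^ 2 * g t θ) ≤
      dblInt a t (fun t θ => (Λ + 4 + s) * g t θ + s⁻¹ * (φ t ^ 4 * d t θ)) := by
    refine dblInt_mono ht.1 hsm.dt.cont₂ hc fun τ hτ θ => ?_
    have hτ' : τ ∈ Icc a b := ⟨hτ.1, hτ.2.trans ht.2⟩
    have hder : HasDerivAt (fun τ => φ τ ^ 2 * g τ θ)
        ((2 * φ τ * deriv φ τ) * g τ θ + φ τ ^ 2 * pt g τ θ) τ := by
      refine ((((h.smooth_cutoff.differentiable (by simp) τ).hasDerivAt).pow 2).mul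
        (h.smooth.hasDerivAt_pt τ θ)).congr_deriv ?_
      simp
    have e3 : pt (fun t θ => φ t ^ 2 * g t θ) τ θ = _ := hder.deriv
    rw [e3]
    have g0 := h.nonneg τ θ
    have d0 := h.nonneg' τ θ
    have hb := sq_mul_le_of_forall_pos g0 hΛ (h.cutoff_mem τ hτ') hs (h.pt_le τ hτ' θ)
    have hb2 : φ τ ^ 2 * pt g τ θ ≤ φ τ ^ 2 * |pt g τ θ| := by
      gcongr; exact le_abs_self _
    have hb3 : 2 * φ τ * deriv φ τ ≤ 4 := by
      have h1 := h.cutoff_mem τ hτ'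
      have h2 := (le_abs_self _).trans (h.cutoff_deriv τ hτ')
      nlinarith [h1.1, h1.2]
    have hb4 := mul_le_mul_of_nonneg_right hb3 g0
    have e4 : φ τ ^ 4 * d τ θ / s = s⁻¹ * (φ τ ^ 4 * d τ θ) := by ring
    linarith
  refine step1.trans ?_
  refine intervalIntegral.integral_mono_interval le_rfl ht.1 ht.2 ?_
    (hc.intervalIntegrable_integral _ _ _ _)
  refine (ae_restrict_mem measurableSet_Ioc).mono fun τ _ => ?_
  refine intervalIntegral.integral_nonneg two_pi_nonneg fun θ _ => ?_
  have g0 := h.nonneg τ θ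
  have d0 := h.nonneg' τ θ
  positivity

lemma IsInterpolated.dblInt_sq_le {a b Λ : ℝ} {φ : ℝ → ℝ} {g d : ℝ → ℝ → ℝ}
    (h : IsInterpolated a b Λ φ g d) {s : ℝ} (hs : 0 < s) :
    dblInt a b (fun t θ => φ t ^ 4 * g t θ ^ 2) ≤
      ((Λ + 4 + s) * dblInt a b g + dblInt a b (fun t θ => φ t ^ 4 * d t θ) / s) ^ 2 := by
  have hφ₂ : Smooth₂ (fun t (_ : ℝ) => φ t) := smooth₂_fst h.smooth_cutoff
  have hφg : Cont₂ (fun t θ => φ t ^ 2 * g t θ) := ((hφ₂.pow 2).mul h.smooth).cont₂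
  have hφd : Cont₂ (fun t θ => φ t ^ 4 * d t θ) := (hφ₂.pow 4).cont₂.mul h.cont
  have hΛ := h.const_nonneg
  have hc : Cont₂ (fun t θ => (Λ + 4 + s) * g t θ + s⁻¹ * (φ t ^ 4 * d t θ)) :=
    (h.smooth.cont₂.const_mul _).add (hφd.const_mul _)
  have e2 : dblInt a b (fun t θ => (Λ + 4 + s) * g t θ + s⁻¹ * (φ t ^ 4 * d t θ)) =
      (Λ + 4 + s) * dblInt a b g + dblInt a b (fun t θ => φ t ^ 4 * d t θ) / s := by
    rw [dblInt_add (h.smooth.cont₂.const_mul _) (hφd.const_mul _), dblInt_const_mul,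
      dblInt_const_mul]
    ring
  set M := (Λ + 4 + s) * dblInt a b g + dblInt a b (fun t θ => φ t ^ 4 * d t θ) / s with hM
  set J : ℝ → ℝ := fun t => ∫ θ in (0 : ℝ)..(2 * π),
    ((Λ + 4 + s) * g t θ + s⁻¹ * (φ t ^ 4 * d t θ)) with hJ
  have hJ0 : ∀ t, 0 ≤ J t := fun t => intervalIntegral.integral_nonneg two_pi_nonneg fun θ _ => by
    have g0 := h.nonneg t θ
    have d0 := h.nonneg' t θ
    positivity
  have hsup : ∀ t ∈ Icc a b, ∀ θ ∈ Icc 0 (2 * π), φ t ^ 2 * g t θ ≤ J t := by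
    intro t ht θ hθ
    have h1 := le_integral_add_abs_deriv (k := fun θ => φ t ^ 2 * g t θ)
      (k' := fun θ => φ t ^ 2 * pth g t θ)
      (fun x => (h.smooth.hasDerivAt_pth t x).const_mul _)
      (continuous_const.mul (h.smooth.dth.continuous_right t))
      (fun x => mul_nonneg (sq_nonneg _) (h.nonneg t x)) hθ
    refine h1.trans ?_
    refine intervalIntegral.integral_mono_on two_pi_nonneg ?_ ((hc.right t).intervalIntegrable _ _)
      fun x _ => ?_
    · exact ((continuous_const.mul (h.smooth.continuous_right t)).add
        (continuous_const.mul (h.smooth.dth.continuous_right t)).abs).intervalIntegrable _ _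
    · have g0 := h.nonneg t x
      have d0 := h.nonneg' t x
      have hb := sq_mul_le_of_forall_pos g0 hΛ (h.cutoff_mem t ht) hs (h.pth_le t ht x)
      have h1 := h.cutoff_mem t ht
      have hb3 : φ t ^ 2 ≤ 1 := by nlinarith [h1.1, h1.2]
      have hb4 := mul_le_mul_of_nonneg_right hb3 g0
      rw [abs_mul, abs_of_nonneg (sq_nonneg (φ t))]
      have e4 : φ t ^ 4 * d t x / s = s⁻¹ * (φ t ^ 4 * d t x) := by ring
      linarith
  have hM1 : ∀ t ∈ Icc a b, φ t ^ 2 * ∫ θ in (0 : ℝ)..(2 * π), g t θ ≤ M :=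
    fun t ht => h.sq_mul_integral_le hs ht
  have hJi : ∫ t in a..b, J t = M := e2
  calc dblInt a b (fun t θ => φ t ^ 4 * g t θ ^ 2) ≤ ∫ t in a..b, J t * M := by
        refine intervalIntegral.integral_mono_on h.le ?_ ?_ fun t ht => ?_
        · exact Cont₂.intervalIntegrable_integral
            ((hφ₂.pow 4).mul (h.smooth.pow 2)).cont₂ _ _ _ _
        · exact (hc.intervalIntegrable_integral _ _ _ _).mul_const M
        · calc ∫ θ in (0 : ℝ)..(2 * π), φ t ^ 4 * g t θ ^ 2
              ≤ ∫ θ in (0 : ℝ)..(2 * π), J t * (φ t ^ 2 * g t θ) := by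
                refine intervalIntegral.integral_mono_on two_pi_nonneg ?_ ?_ fun θ hθ => ?_
                · exact (((hφ₂.pow 4).mul (h.smooth.pow 2)).continuous_right t).intervalIntegrable
                    _ _
                · exact (continuous_const.mul (hφg.right t)).intervalIntegrable _ _
                · have := mul_le_mul_of_nonneg_right (hsup t ht θ hθ)
                    (mul_nonneg (sq_nonneg (φ t)) (h.nonneg t θ))
                  linarith
            _ = J t * (φ t ^ 2 * ∫ θ in (0 : ℝ)..(2 * π), g t θ) := by
                rw [intervalIntegral.integral_const_mul, intervalIntegral.integral_const_mul]
            _ ≤ J t * M := mul_le_mul_of_nonneg_left (hM1 t ht) (hJ0 t)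
    _ = M ^ 2 := by
        rw [intervalIntegral.integral_mul_const, hJi, sq]

end EnergyEstimates

section EpsilonRegularity
variable {E : Type*} [NormedAddCommGroup E] [InnerProductSpace ℝ E]

/-- The density `e^{-2u} (|β₁|² + |β₂|² + |β₃|²)`. -/
def betaDens (u : ℝ → ℝ → ℝ) (β₁ β₂ β₃ : ℝ → ℝ → E) (t θ : ℝ) : ℝ :=
  Real.exp (-(2 * u t θ)) * (‖β₁ t θ‖ ^ 2 + ‖β₂ t θ‖ ^ 2 + ‖β₃ t θ‖ ^ 2)

/-- The system satisfied by the mean curvature `H` of a conformal Willmore cylinder and by the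
deviation `β` of its Hessian from that of the `m`-fold model end. -/
structure IsWillmoreSystem (m M C₀ : ℝ) (a b : ℝ) (u : ℝ → ℝ → ℝ)
    (H P R β₁ β₂ β₃ : ℝ → ℝ → E) : Prop where
  smooth_u : Smooth₂ u
  smooth_H : Smooth₂ H
  smooth_P : Smooth₂ P
  smooth_R : Smooth₂ R
  smooth_β₁ : Smooth₂ β₁
  smooth_β₂ : Smooth₂ β₂
  smooth_β₃ : Smooth₂ β₃
  periodic_u : Periodic₂ u
  periodic_H : Periodic₂ H
  periodic_R : Periodic₂ R
  periodic_β₁ : Periodic₂ β₁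
  periodic_β₂ : Periodic₂ β₂
  periodic_β₃ : Periodic₂ β₃
  m_nonneg : 0 ≤ m
  m_le : m ≤ M
  curl : ∀ t θ, pth β₁ t θ = pt β₂ t θ
  div : ∀ t θ, pth β₂ t θ - pt β₃ t θ = m • (β₁ t θ + β₃ t θ)
  trace : ∀ t θ, β₁ t θ + β₃ t θ = Real.exp (2 * u t θ) • H t θ
  C₀_nonneg : 0 ≤ C₀
  pt_u : ∀ t ∈ Icc a b, ∀ θ, |pt u t θ| ≤ M
  pth_u : ∀ t ∈ Icc a b, ∀ θ, |pth u t θ| ≤ M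
  eqn : ∀ t ∈ Icc a b, ∀ θ,
    (2 : ℝ) • (pt (pt H) t θ + pth (pth H) t θ) + pt P t θ + pth R t θ = 0
  bound : ∀ t ∈ Icc a b, ∀ θ,
    ‖P t θ‖ ^ 2 + ‖R t θ‖ ^ 2 ≤ C₀ * (‖H t θ‖ ^ 2 * (betaDens u β₁ β₂ β₃ t θ + 1))

variable {m M C₀ a b : ℝ} {u : ℝ → ℝ → ℝ} {H P R β₁ β₂ β₃ : ℝ → ℝ → E}

lemma IsWillmoreSystem.mono (h : IsWillmoreSystem m M C₀ a b u H P R β₁ β₂ β₃) {a' b' : ℝ}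
    (hs : Icc a' b' ⊆ Icc a b) : IsWillmoreSystem m M C₀ a' b' u H P R β₁ β₂ β₃ :=
  { h with
    pt_u := fun t ht => h.pt_u t (hs ht)
    pth_u := fun t ht => h.pth_u t (hs ht)
    eqn := fun t ht => h.eqn t (hs ht)
    bound := fun t ht => h.bound t (hs ht) }

lemma norm_add_sq_le (x y : E) : ‖x + y‖ ^ 2 ≤ 2 * ‖x‖ ^ 2 + 2 * ‖y‖ ^ 2 := by
  have := parallelogram_law_with_norm ℝ x y
  nlinarith [mul_self_nonneg ‖x - y‖]

lemma IsWillmoreSystem.smooth_betaDens (h : IsWillmoreSystem m M C₀ a b u H P R β₁ β₂ β₃) :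
    Smooth₂ (betaDens u β₁ β₂ β₃) := by
  have h1 : Smooth₂ (fun t θ => -(2 * u t θ)) := by simpa using h.smooth_u.const_mul (-2)
  exact h1.exp.mul ((h.smooth_β₁.norm_sq.add h.smooth_β₂.norm_sq).add h.smooth_β₃.norm_sq)

omit [InnerProductSpace ℝ E] in
lemma betaDens_nonneg (t θ : ℝ) : 0 ≤ betaDens u β₁ β₂ β₃ t θ := by
  unfold betaDens; positivity

lemma IsWillmoreSystem.exp_mul_norm_sq_le (h : IsWillmoreSystem m M C₀ a b u H P R β₁ β₂ β₃)
    (t θ : ℝ) : Real.exp (2 * u t θ) * ‖H t θ‖ ^ 2 ≤ 2 * betaDens u β₁ β₂ β₃ t θ := by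
  have h1 := norm_add_sq_le (β₁ t θ) (β₃ t θ)
  rw [h.trace, norm_smul, Real.norm_eq_abs, abs_of_pos (Real.exp_pos _), mul_pow] at h1
  have h2 : Real.exp (2 * u t θ) * ‖H t θ‖ ^ 2 =
      Real.exp (-(2 * u t θ)) * (Real.exp (2 * u t θ) ^ 2 * ‖H t θ‖ ^ 2) := by
    rw [Real.exp_neg]; field_simp
  rw [h2, betaDens]
  have h3 := mul_le_mul_of_nonneg_left h1 (Real.exp_pos (-(2 * u t θ))).le
  have h4 := mul_nonneg (Real.exp_pos (-(2 * u t θ))).le (sq_nonneg ‖β₂ t θ‖)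
  linarith

/-- The cutoff `1 - (t - t₁)²` on `[t₁ - 1, t₁ + 1]`. -/
def parabola (t₁ t : ℝ) : ℝ := 1 - (t - t₁) ^ 2

lemma contDiff_parabola (t₁ : ℝ) : ContDiff ℝ (⊤ : ℕ∞) (parabola t₁) := by
  unfold parabola; fun_prop

lemma hasDerivAt_parabola (t₁ t : ℝ) : HasDerivAt (parabola t₁) (-(2 * (t - t₁))) t := by
  refine ((((hasDerivAt_id t).sub_const t₁).pow 2).const_sub 1).congr_deriv ?_
  simp

lemma parabola_mem {t₁ t : ℝ} (ht : t ∈ Icc (t₁ - 1) (t₁ + 1)) : parabola t₁ t ∈ Icc (0 : ℝ) 1 := by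
  constructor <;> unfold parabola <;> nlinarith [ht.1, ht.2]

lemma abs_deriv_parabola_le {t₁ t : ℝ} (ht : t ∈ Icc (t₁ - 1) (t₁ + 1)) :
    |deriv (parabola t₁) t| ≤ 2 := by
  rw [(hasDerivAt_parabola t₁ t).deriv, abs_le]
  constructor <;> linarith [ht.1, ht.2]

lemma isCutoffWeight_parabola {t₁ k : ℝ} (hu : Smooth₂ u) (hu' : Periodic₂ u)
    (hM : 0 ≤ M) (hk : |k| ≤ 2)
    (h1 : ∀ t ∈ Icc (t₁ - 1) (t₁ + 1), ∀ θ, |pt u t θ| ≤ M)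
    (h2 : ∀ t ∈ Icc (t₁ - 1) (t₁ + 1), ∀ θ, |pth u t θ| ≤ M) :
    IsCutoffWeight (t₁ - 1) (t₁ + 1) ((8 + 2 * M) ^ 2)
      (fun t θ => parabola t₁ t ^ 4 * Real.exp (k * u t θ)) (fun t θ => Real.exp (k * u t θ)) := by
  have hφ₂ : Smooth₂ (fun t (_ : ℝ) => parabola t₁ t) := smooth₂_fst (contDiff_parabola t₁)
  have he := (hu.const_mul k).exp
  refine ⟨(hφ₂.pow 4).mul he, fun t θ => by simp only [hu' t θ], he.cont₂, ?_, ?_,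
    fun t θ => by positivity, fun t θ => by positivity, by positivity, ?_, ?_⟩
  · intro θ; simp [parabola]
  · intro θ; simp [parabola]
  · intro t ht θ
    set e := Real.exp (k * u t θ) with hedef
    set φ := parabola t₁ t with hφ
    have hd : pt (fun t θ => parabola t₁ t ^ 4 * Real.exp (k * u t θ)) t θ =
        (4 * φ ^ 3 * deriv (parabola t₁) t + φ ^ 4 * (k * pt u t θ)) * e := by
      have := ((hasDerivAt_parabola t₁ t).pow 4).mul ((hu.hasDerivAt_pt t θ).const_mul k).exp
      refine this.deriv.trans ?_
      rw [(hasDerivAt_parabola t₁ t).deriv]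
      simp only [Pi.pow_apply]
      push_cast
      ring
    rw [hd]
    have hm := parabola_mem ht
    rw [← hφ] at hm
    have hb1 : |4 * deriv (parabola t₁) t + φ * (k * pt u t θ)| ≤ 8 + 2 * M := by
      refine (abs_add_le _ _).trans ?_
      rw [abs_mul, abs_mul, abs_mul, abs_of_nonneg hm.1]
      have a1 := abs_deriv_parabola_le ht
      have a2 : φ * (|k| * |pt u t θ|) ≤ 1 * (2 * M) := by
        have := h1 t ht θ
        have := hm.2
        gcongr
      norm_num
      linarith
    have hb2 : (4 * deriv (parabola t₁) t + φ * (k * pt u t θ)) ^ 2 ≤ (8 + 2 * M) ^ 2 :=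
      sq_le_sq' (neg_le_of_abs_le hb1) (le_of_abs_le hb1)
    calc ((4 * φ ^ 3 * deriv (parabola t₁) t + φ ^ 4 * (k * pt u t θ)) * e) ^ 2
        = (4 * deriv (parabola t₁) t + φ * (k * pt u t θ)) ^ 2 * φ ^ 2 * (φ ^ 4 * e * e) := by ring
      _ ≤ (8 + 2 * M) ^ 2 * 1 * (φ ^ 4 * e * e) := by
          gcongr
          exact pow_le_one₀ hm.1 hm.2
      _ = _ := by ring
  · intro t ht θ
    set e := Real.exp (k * u t θ) with hedef
    set φ := parabola t₁ t with hφ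
    have hd : pth (fun t θ => parabola t₁ t ^ 4 * Real.exp (k * u t θ)) t θ =
        φ ^ 4 * (k * pth u t θ) * e := by
      have := ((hu.hasDerivAt_pth t θ).const_mul k).exp.const_mul (φ ^ 4)
      exact this.deriv.trans (by ring)
    rw [hd]
    have hm := parabola_mem ht
    rw [← hφ] at hm
    have hb1 : |k * pth u t θ| ≤ 8 + 2 * M := by
      rw [abs_mul]
      have a2 : |k| * |pth u t θ| ≤ 2 * M := by
        have := h2 t ht θ
        gcongr
      linarith
    have hb2 : (k * pth u t θ) ^ 2 ≤ (8 + 2 * M) ^ 2 :=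
      sq_le_sq' (neg_le_of_abs_le hb1) (le_of_abs_le hb1)
    calc (φ ^ 4 * (k * pth u t θ) * e) ^ 2
        = (k * pth u t θ) ^ 2 * φ ^ 4 * (φ ^ 4 * e * e) := by ring
      _ ≤ (8 + 2 * M) ^ 2 * 1 * (φ ^ 4 * e * e) := by
          gcongr
          exact pow_le_one₀ hm.1 hm.2
      _ = _ := by ring

/-- The Dirichlet density of `β`. -/
def betaDirichlet (u : ℝ → ℝ → ℝ) (β₁ β₂ β₃ : ℝ → ℝ → E) (t θ : ℝ) : ℝ :=
  Real.exp (-(2 * u t θ)) * (‖pt β₁ t θ‖ ^ 2 + ‖pth β₁ t θ‖ ^ 2 + ‖pt β₂ t θ‖ ^ 2 +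
    ‖pth β₂ t θ‖ ^ 2 + ‖pt β₃ t θ‖ ^ 2 + ‖pth β₃ t θ‖ ^ 2)

lemma betaDirichlet_nonneg (t θ : ℝ) : 0 ≤ betaDirichlet u β₁ β₂ β₃ t θ := by
  unfold betaDirichlet; positivity

lemma IsWillmoreSystem.cont_betaDirichlet (h : IsWillmoreSystem m M C₀ a b u H P R β₁ β₂ β₃) :
    Cont₂ (betaDirichlet u β₁ β₂ β₃) := by
  have h1 : Smooth₂ (fun t θ => -(2 * u t θ)) := by simpa using h.smooth_u.const_mul (-2)
  exact (h1.exp.mul (((((h.smooth_β₁.dt.norm_sq.add h.smooth_β₁.dth.norm_sq).add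
    h.smooth_β₂.dt.norm_sq).add h.smooth_β₂.dth.norm_sq).add h.smooth_β₃.dt.norm_sq).add
    h.smooth_β₃.dth.norm_sq)).cont₂

lemma two_mul_inner_le_add_div (x y : E) {s : ℝ} (hs : 0 < s) :
    |2 * ⟪x, y⟫_ℝ| ≤ s * ‖x‖ ^ 2 + ‖y‖ ^ 2 / s := by
  have h1 := abs_real_inner_le_norm x y
  rw [abs_mul, abs_two]
  have h2 : 0 ≤ (s * ‖x‖ - ‖y‖) ^ 2 / s := by positivity
  have h3 : (s * ‖x‖ - ‖y‖) ^ 2 / s = s * ‖x‖ ^ 2 + ‖y‖ ^ 2 / s - 2 * (‖x‖ * ‖y‖) := by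
    field_simp; ring
  linarith

lemma abs_deriv_weighted_le {e u' s g d : ℝ} {x₁ x₂ x₃ y₁ y₂ y₃ : E} (he : 0 < e) (hs : 0 < s)
    (hu : |u'| ≤ M) (hg : g = e * (‖x₁‖ ^ 2 + ‖x₂‖ ^ 2 + ‖x₃‖ ^ 2))
    (hd : e * (‖y₁‖ ^ 2 + ‖y₂‖ ^ 2 + ‖y₃‖ ^ 2) ≤ d) :
    |e * (-(2 * u')) * (‖x₁‖ ^ 2 + ‖x₂‖ ^ 2 + ‖x₃‖ ^ 2) +
      e * (2 * ⟪x₁, y₁⟫_ℝ + 2 * ⟪x₂, y₂⟫_ℝ + 2 * ⟪x₃, y₃⟫_ℝ)| ≤ (2 * M + s) * g + d / s := by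
  have g0 : 0 ≤ g := by rw [hg]; positivity
  have h0 : e * (-(2 * u')) * (‖x₁‖ ^ 2 + ‖x₂‖ ^ 2 + ‖x₃‖ ^ 2) = -(2 * u') * g := by rw [hg]; ring
  rw [h0]
  refine (abs_add_le _ _).trans ?_
  have h1 : |-(2 * u') * g| ≤ 2 * M * g := by
    rw [abs_mul, abs_of_nonneg g0, abs_neg, abs_mul, abs_two]
    gcongr
  have h2 : |2 * ⟪x₁, y₁⟫_ℝ + 2 * ⟪x₂, y₂⟫_ℝ + 2 * ⟪x₃, y₃⟫_ℝ| ≤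
      s * (‖x₁‖ ^ 2 + ‖x₂‖ ^ 2 + ‖x₃‖ ^ 2) + (‖y₁‖ ^ 2 + ‖y₂‖ ^ 2 + ‖y₃‖ ^ 2) / s := by
    have a1 := two_mul_inner_le_add_div x₁ y₁ hs
    have a2 := two_mul_inner_le_add_div x₂ y₂ hs
    have a3 := two_mul_inner_le_add_div x₃ y₃ hs
    refine (abs_add_three _ _ _).trans ?_
    rw [add_div, add_div]
    linarith
  rw [abs_mul e, abs_of_pos he]
  have h3 := mul_le_mul_of_nonneg_left h2 he.le
  have h4 : e * (‖y₁‖ ^ 2 + ‖y₂‖ ^ 2 + ‖y₃‖ ^ 2) / s ≤ d / s := by gcongr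
  have h5 : e * (s * (‖x₁‖ ^ 2 + ‖x₂‖ ^ 2 + ‖x₃‖ ^ 2) + (‖y₁‖ ^ 2 + ‖y₂‖ ^ 2 + ‖y₃‖ ^ 2) / s) =
    s * g + e * (‖y₁‖ ^ 2 + ‖y₂‖ ^ 2 + ‖y₃‖ ^ 2) / s := by rw [hg]; ring
  linarith

lemma IsWillmoreSystem.isInterpolated {t₁ : ℝ}
    (h : IsWillmoreSystem m M C₀ (t₁ - 1) (t₁ + 1) u H P R β₁ β₂ β₃) :
    IsInterpolated (t₁ - 1) (t₁ + 1) (2 * M) (parabola t₁) (betaDens u β₁ β₂ β₃)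
      (betaDirichlet u β₁ β₂ β₃) := by
  refine ⟨by linarith, h.smooth_betaDens, h.cont_betaDirichlet, contDiff_parabola t₁,
    betaDens_nonneg, betaDirichlet_nonneg, by linarith [h.m_nonneg, h.m_le], by simp [parabola],
    fun t ht => parabola_mem ht, fun t ht => abs_deriv_parabola_le ht, ?_, ?_⟩
  · intro t ht θ s hs
    have hd := (((h.smooth_u.hasDerivAt_pt t θ).const_mul 2).neg.exp).mul
      (((h.smooth_β₁.hasDerivAt_pt t θ).norm_sq.add
      (h.smooth_β₂.hasDerivAt_pt t θ).norm_sq).add (h.smooth_β₃.hasDerivAt_pt t θ).norm_sq)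
    have hd' : pt (betaDens u β₁ β₂ β₃) t θ = _ := hd.deriv
    rw [hd']
    refine abs_deriv_weighted_le (Real.exp_pos (-(2 * u t θ))) hs (h.pt_u t ht θ) rfl ?_
    unfold betaDirichlet
    refine mul_le_mul_of_nonneg_left ?_ (Real.exp_pos (-(2 * u t θ))).le
    nlinarith [sq_nonneg ‖pth β₁ t θ‖, sq_nonneg ‖pth β₂ t θ‖, sq_nonneg ‖pth β₃ t θ‖]
  · intro t ht θ s hs
    have hd := (((h.smooth_u.hasDerivAt_pth t θ).const_mul 2).neg.exp).mul
      (((h.smooth_β₁.hasDerivAt_pth t θ).norm_sq.add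
      (h.smooth_β₂.hasDerivAt_pth t θ).norm_sq).add (h.smooth_β₃.hasDerivAt_pth t θ).norm_sq)
    have hd' : pth (betaDens u β₁ β₂ β₃) t θ = _ := hd.deriv
    rw [hd']
    refine abs_deriv_weighted_le (Real.exp_pos (-(2 * u t θ))) hs (h.pth_u t ht θ) rfl ?_
    unfold betaDirichlet
    refine mul_le_mul_of_nonneg_left ?_ (Real.exp_pos (-(2 * u t θ))).le
    nlinarith [sq_nonneg ‖pt β₁ t θ‖, sq_nonneg ‖pt β₂ t θ‖, sq_nonneg ‖pt β₃ t θ‖]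

lemma IsWillmoreSystem.dblInt_grad_H_le {t₁ : ℝ}
    (h : IsWillmoreSystem m M C₀ (t₁ - 1) (t₁ + 1) u H P R β₁ β₂ β₃) :
    dblInt (t₁ - 1) (t₁ + 1) (fun t θ => parabola t₁ t ^ 4 * Real.exp (2 * u t θ) *
        (‖pt H t θ‖ ^ 2 + ‖pth H t θ‖ ^ 2)) ≤
      (12 * (8 + 2 * M) ^ 2 + 2 * C₀) *
        dblInt (t₁ - 1) (t₁ + 1) (betaDens u β₁ β₂ β₃) +
      2 * C₀ * dblInt (t₁ - 1) (t₁ + 1)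
        (fun t θ => parabola t₁ t ^ 4 * betaDens u β₁ β₂ β₃ t θ ^ 2) := by
  have hM : 0 ≤ M := h.m_nonneg.trans h.m_le
  have hφ₂ : Smooth₂ (fun t (_ : ℝ) => parabola t₁ t) := smooth₂_fst (contDiff_parabola t₁)
  have hw := isCutoffWeight_parabola (t₁ := t₁) (k := 2) h.smooth_u h.periodic_u hM (by simp)
    h.pt_u h.pth_u
  refine (hw.caccioppoli (by linarith) h.smooth_H h.periodic_H h.smooth_P h.smooth_R h.periodic_R
    h.eqn).trans ?_
  have hg := h.smooth_betaDens
  rw [← dblInt_const_mul, ← dblInt_const_mul, ← dblInt_add (hg.const_mul _).cont₂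
    (((hφ₂.pow 4).mul (hg.pow 2)).const_mul _).cont₂]
  refine dblInt_mono (by linarith) ?_ ?_ ?_
  · exact ((hw.cont.mul h.smooth_H.cont₂.norm_sq).const_mul _).add
      (hw.smooth.cont₂.mul (h.smooth_P.cont₂.norm_sq.add h.smooth_R.cont₂.norm_sq))
  · exact ((hg.const_mul _).add (((hφ₂.pow 4).mul (hg.pow 2)).const_mul _)).cont₂
  intro t ht θ
  have g0 : 0 ≤ betaDens u β₁ β₂ β₃ t θ := betaDens_nonneg t θ
  have hm := parabola_mem ht
  have hφ1 : parabola t₁ t ^ 4 ≤ 1 := pow_le_one₀ hm.1 hm.2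
  have hφ0 : 0 ≤ parabola t₁ t ^ 4 := by positivity
  have h1 := h.exp_mul_norm_sq_le t θ
  have h2 := mul_le_mul_of_nonneg_left (h.bound t ht θ)
    (mul_nonneg hφ0 (Real.exp_pos (2 * u t θ)).le)
  have h3 : parabola t₁ t ^ 4 * Real.exp (2 * u t θ) *
      (C₀ * (‖H t θ‖ ^ 2 * (betaDens u β₁ β₂ β₃ t θ + 1))) ≤
      parabola t₁ t ^ 4 * C₀ * (2 * betaDens u β₁ β₂ β₃ t θ * (betaDens u β₁ β₂ β₃ t θ + 1)) := by
    have := h.C₀_nonneg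
    calc _ = parabola t₁ t ^ 4 * C₀ * ((Real.exp (2 * u t θ) * ‖H t θ‖ ^ 2) *
          (betaDens u β₁ β₂ β₃ t θ + 1)) := by ring
      _ ≤ _ := by gcongr
  have h4 : parabola t₁ t ^ 4 * (2 * C₀ * betaDens u β₁ β₂ β₃ t θ) ≤
      1 * (2 * C₀ * betaDens u β₁ β₂ β₃ t θ) := by
    have := h.C₀_nonneg
    gcongr
  have h5 := mul_le_mul_of_nonneg_left h1 (by positivity : 0 ≤ 6 * (8 + 2 * M) ^ 2)
  linarith

lemma weighted_divCurl_le {φ ω e M m p q : ℝ} (hφ0 : 0 ≤ φ) (ω0 : 0 ≤ ω) (ωe : ω * e = 1)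
    (hm0 : 0 ≤ m) (hm : m ≤ M) (hp : |p| ≤ M) (hq : |q| ≤ M) (x y h : E) :
    φ * ω * (‖e • (x + (2 * p) • h) + m • e • h‖ ^ 2 + ‖e • (y + (2 * q) • h)‖ ^ 2 +
      ‖m • e • h‖ ^ 2) ≤ φ * (e * (4 * ‖x‖ ^ 2 + 2 * ‖y‖ ^ 2 + 27 * M ^ 2 * ‖h‖ ^ 2)) := by
  have hu1 : (2 * p) ^ 2 ≤ 4 * M ^ 2 := by
    have := sq_le_sq' (neg_le_of_abs_le hp) (le_of_abs_le hp)
    linarith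
  have hu2 : (2 * q) ^ 2 ≤ 4 * M ^ 2 := by
    have := sq_le_sq' (neg_le_of_abs_le hq) (le_of_abs_le hq)
    linarith
  have hm2 : m ^ 2 ≤ M ^ 2 := pow_le_pow_left₀ hm0 hm 2
  have nsm : ∀ (c : ℝ) (x : E), ‖c • x‖ ^ 2 = c ^ 2 * ‖x‖ ^ 2 := fun c x => by
    rw [norm_smul, mul_pow, Real.norm_eq_abs, sq_abs]
  have bd1 : ‖e • (x + (2 * p) • h) + m • e • h‖ ^ 2 ≤
      e ^ 2 * (4 * ‖x‖ ^ 2 + 18 * M ^ 2 * ‖h‖ ^ 2) := by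
    have q1 := norm_add_sq_le (e • (x + (2 * p) • h)) (m • e • h)
    have q2 := norm_add_sq_le x ((2 * p) • h)
    rw [nsm, nsm, nsm] at q1
    rw [nsm] at q2
    have q3 := mul_le_mul_of_nonneg_right hu1 (sq_nonneg ‖h‖)
    have q4 := mul_le_mul_of_nonneg_right hm2 (sq_nonneg ‖h‖)
    have q5 : ‖x + (2 * p) • h‖ ^ 2 ≤
      2 * ‖x‖ ^ 2 + 8 * M ^ 2 * ‖h‖ ^ 2 := by linarith
    have q6 := mul_le_mul_of_nonneg_left q5 (sq_nonneg e)
    have q7 := mul_le_mul_of_nonneg_left q4 (sq_nonneg e)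
    linarith
  have bd2 : ‖e • (y + (2 * q) • h)‖ ^ 2 ≤
      e ^ 2 * (2 * ‖y‖ ^ 2 + 8 * M ^ 2 * ‖h‖ ^ 2) := by
    have q2 := norm_add_sq_le y ((2 * q) • h)
    rw [nsm] at q2 ⊢
    have q3 := mul_le_mul_of_nonneg_right hu2 (sq_nonneg ‖h‖)
    gcongr
    linarith
  have bd3 : ‖m • e • h‖ ^ 2 ≤ e ^ 2 * (M ^ 2 * ‖h‖ ^ 2) := by
    rw [nsm, nsm]
    have q4 := mul_le_mul_of_nonneg_right hm2 (sq_nonneg ‖h‖)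
    have := mul_le_mul_of_nonneg_left q4 (sq_nonneg e)
    linarith
  have φω : 0 ≤ φ * ω := mul_nonneg hφ0 ω0
  have c1 := mul_le_mul_of_nonneg_left bd1 φω
  have c2 := mul_le_mul_of_nonneg_left bd2 φω
  have c3 := mul_le_mul_of_nonneg_left bd3 φω
  have ew : ∀ x : ℝ, φ * ω * (e ^ 2 * x) = φ * (e * x) := fun x => by
    linear_combination (φ * e * x) * ωe
  rw [ew] at c1 c2 c3
  linarith

lemma IsWillmoreSystem.dblInt_grad_beta_le {t₁ : ℝ}
    (h : IsWillmoreSystem m M C₀ (t₁ - 1) (t₁ + 1) u H P R β₁ β₂ β₃) :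
    dblInt (t₁ - 1) (t₁ + 1) (fun t θ => parabola t₁ t ^ 4 * betaDirichlet u β₁ β₂ β₃ t θ) ≤
      8 * dblInt (t₁ - 1) (t₁ + 1) (fun t θ => parabola t₁ t ^ 4 * Real.exp (2 * u t θ) *
        (‖pt H t θ‖ ^ 2 + ‖pth H t θ‖ ^ 2)) +
      (200 * M ^ 2 + 16 * (8 + 2 * M) ^ 2) *
        dblInt (t₁ - 1) (t₁ + 1) (betaDens u β₁ β₂ β₃) := by
  have hM : 0 ≤ M := h.m_nonneg.trans h.m_le
  have hφ₂ : Smooth₂ (fun t (_ : ℝ) => parabola t₁ t) := smooth₂_fst (contDiff_parabola t₁)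
  have hw := isCutoffWeight_parabola (t₁ := t₁) (k := -2) h.smooth_u h.periodic_u hM (by simp)
    h.pt_u h.pth_u
  have hab : t₁ - 1 ≤ t₁ + 1 := by linarith
  have hg := h.smooth_betaDens
  have k1 := hw.divCurl hab h.smooth_β₁ h.periodic_β₁ h.smooth_β₂ h.periodic_β₂
  have k2 := hw.divCurl hab h.smooth_β₂ h.periodic_β₂ h.smooth_β₃ h.periodic_β₃
  have s1 : Cont₂ (fun t θ => ‖pt β₁ t θ‖ ^ 2 + ‖pth β₁ t θ‖ ^ 2 + ‖pt β₂ t θ‖ ^ 2 +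
      ‖pth β₂ t θ‖ ^ 2) := ((h.smooth_β₁.dt.norm_sq.add h.smooth_β₁.dth.norm_sq).add
    h.smooth_β₂.dt.norm_sq).add h.smooth_β₂.dth.norm_sq |>.cont₂
  have s2 : Cont₂ (fun t θ => ‖pt β₂ t θ‖ ^ 2 + ‖pth β₂ t θ‖ ^ 2 + ‖pt β₃ t θ‖ ^ 2 +
      ‖pth β₃ t θ‖ ^ 2) := ((h.smooth_β₂.dt.norm_sq.add h.smooth_β₂.dth.norm_sq).add
    h.smooth_β₃.dt.norm_sq).add h.smooth_β₃.dth.norm_sq |>.cont₂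
  have r1 : Cont₂ (fun t θ => 2 * (parabola t₁ t ^ 4 * Real.exp (-2 * u t θ) *
      (‖pt β₁ t θ + pth β₂ t θ‖ ^ 2 + ‖pth β₁ t θ - pt β₂ t θ‖ ^ 2)) +
      8 * (8 + 2 * M) ^ 2 * (Real.exp (-2 * u t θ) * ‖β₁ t θ‖ ^ 2)) :=
    (Cont₂.const_mul 2 (hw.smooth.cont₂.mul
      ((h.smooth_β₁.dt.add h.smooth_β₂.dth).cont₂.norm_sq.add
      (h.smooth_β₁.dth.sub h.smooth_β₂.dt).cont₂.norm_sq))).add (Cont₂.const_mul _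
      (hw.cont.mul h.smooth_β₁.cont₂.norm_sq))
  have r2 : Cont₂ (fun t θ => 2 * (parabola t₁ t ^ 4 * Real.exp (-2 * u t θ) *
      (‖pt β₂ t θ + pth β₃ t θ‖ ^ 2 + ‖pth β₂ t θ - pt β₃ t θ‖ ^ 2)) +
      8 * (8 + 2 * M) ^ 2 * (Real.exp (-2 * u t θ) * ‖β₂ t θ‖ ^ 2)) :=
    (Cont₂.const_mul 2 (hw.smooth.cont₂.mul
      ((h.smooth_β₂.dt.add h.smooth_β₃.dth).cont₂.norm_sq.add
      (h.smooth_β₂.dth.sub h.smooth_β₃.dt).cont₂.norm_sq))).add (Cont₂.const_mul _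
      (hw.cont.mul h.smooth_β₂.cont₂.norm_sq))
  have hw2 := isCutoffWeight_parabola (t₁ := t₁) (k := 2) h.smooth_u h.periodic_u hM (by simp)
    h.pt_u h.pth_u
  have cH : Cont₂ (fun t θ => parabola t₁ t ^ 4 * Real.exp (2 * u t θ) *
        (‖pt H t θ‖ ^ 2 + ‖pth H t θ‖ ^ 2)) :=
    hw2.smooth.cont₂.mul (h.smooth_H.dt.cont₂.norm_sq.add h.smooth_H.dth.cont₂.norm_sq)
  refine (le_trans ?_ (add_le_add k1 k2)).trans ?_
  · rw [← dblInt_add (hw.smooth.cont₂.mul s1) (hw.smooth.cont₂.mul s2)]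
    refine dblInt_mono hab ((hφ₂.pow 4).cont₂.mul h.cont_betaDirichlet)
      ((hw.smooth.cont₂.mul s1).add (hw.smooth.cont₂.mul s2)) fun t ht θ => ?_
    have e1 : -(2 * u t θ) = -2 * u t θ := by ring
    have p1 := mul_nonneg (hw.nonneg t θ) (sq_nonneg ‖pt β₂ t θ‖)
    have p2 := mul_nonneg (hw.nonneg t θ) (sq_nonneg ‖pth β₂ t θ‖)
    unfold betaDirichlet
    rw [e1]
    linarith
  rw [← dblInt_add r1 r2, ← dblInt_const_mul, ← dblInt_const_mul,
    ← dblInt_add (cH.const_mul _) (hg.const_mul _).cont₂]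
  refine dblInt_mono hab (r1.add r2) ((cH.const_mul _).add (hg.const_mul _).cont₂) fun t ht θ => ?_
  set φ := parabola t₁ t ^ 4 with hφ
  have hm := parabola_mem ht
  have hφ1 : φ ≤ 1 := pow_le_one₀ hm.1 hm.2
  have hφ0 : 0 ≤ φ := by positivity
  set ω := Real.exp (-2 * u t θ) with hω
  set e := Real.exp (2 * u t θ) with he
  have ω0 : 0 < ω := Real.exp_pos _
  have e0 : 0 < e := Real.exp_pos _
  have ωe : ω * e = 1 := by rw [hω, he, ← Real.exp_add]; simp
  set σ := β₁ t θ + β₃ t θ with hσ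
  have tr : σ = e • H t θ := h.trace t θ
  have tr_t : pt β₁ t θ + pt β₃ t θ = e • (pt H t θ + (2 * pt u t θ) • H t θ) := by
    have q1 := (h.smooth_β₁.hasDerivAt_pt t θ).add (h.smooth_β₃.hasDerivAt_pt t θ)
    have q2 := ((h.smooth_u.hasDerivAt_pt t θ).const_mul 2).exp.smul (h.smooth_H.hasDerivAt_pt t θ)
    have q3 : (fun s => β₁ s θ) + (fun s => β₃ s θ) =
      (fun s => Real.exp (2 * u s θ)) • (fun s => H s θ) := funext fun s => h.trace s θ
    rw [q3] at q1
    rw [q1.unique q2, smul_add, smul_smul]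
  have tr_th : pth β₁ t θ + pth β₃ t θ = e • (pth H t θ + (2 * pth u t θ) • H t θ) := by
    have q1 := (h.smooth_β₁.hasDerivAt_pth t θ).add (h.smooth_β₃.hasDerivAt_pth t θ)
    have q2 := ((h.smooth_u.hasDerivAt_pth t θ).const_mul 2).exp.smul
      (h.smooth_H.hasDerivAt_pth t θ)
    have q3 : (fun s => β₁ t s) + (fun s => β₃ t s) =
      (fun s => Real.exp (2 * u t s)) • (fun s => H t s) := funext fun s => h.trace t s
    rw [q3] at q1
    rw [q1.unique q2, smul_add, smul_smul]
  have i1 : pt β₁ t θ + pth β₂ t θ = (pt β₁ t θ + pt β₃ t θ) + m • σ := by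
    rw [← h.div]; abel
  have i2 : pth β₁ t θ - pt β₂ t θ = 0 := by rw [h.curl, sub_self]
  have i3 : pt β₂ t θ + pth β₃ t θ = pth β₁ t θ + pth β₃ t θ := by rw [h.curl]
  have i4 := h.div t θ
  rw [i1, i2, i3, i4, tr_t, tr_th, ← hσ, tr]
  have G0 : 0 ≤ betaDens u β₁ β₂ β₃ t θ := betaDens_nonneg t θ
  have hHG := h.exp_mul_norm_sq_le t θ
  have hG : betaDens u β₁ β₂ β₃ t θ = ω * (‖β₁ t θ‖ ^ 2 + ‖β₂ t θ‖ ^ 2 + ‖β₃ t θ‖ ^ 2) := by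
    rw [betaDens, hω]; congr 2; ring
  have key := weighted_divCurl_le (φ := φ) (ω := ω) (e := e) hφ0 ω0.le ωe h.m_nonneg h.m_le
    (h.pt_u t ht θ) (h.pth_u t ht θ) (pt H t θ) (pth H t θ) (H t θ)
  have f1 : φ * (e * (27 * M ^ 2 * ‖H t θ‖ ^ 2)) ≤ 54 * M ^ 2 * betaDens u β₁ β₂ β₃ t θ := by
    have : φ * (e * (27 * M ^ 2 * ‖H t θ‖ ^ 2)) ≤ 1 * (27 * M ^ 2 * (e * ‖H t θ‖ ^ 2)) := by
      have : e * (27 * M ^ 2 * ‖H t θ‖ ^ 2) = 27 * M ^ 2 * (e * ‖H t θ‖ ^ 2) := by ring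
      rw [this]; gcongr
    nlinarith [mul_le_mul_of_nonneg_left hHG (by positivity : 0 ≤ 27 * M ^ 2)]
  have f2 : 8 * (8 + 2 * M) ^ 2 * (ω * (‖β₁ t θ‖ ^ 2 + ‖β₂ t θ‖ ^ 2)) ≤
      8 * (8 + 2 * M) ^ 2 * betaDens u β₁ β₂ β₃ t θ := by
    rw [hG]
    refine mul_le_mul_of_nonneg_left (mul_le_mul_of_nonneg_left ?_ ω0.le) (by positivity)
    linarith [sq_nonneg ‖β₃ t θ‖]
  have f3 : 0 ≤ φ * (e * ‖pth H t θ‖ ^ 2) := by positivity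
  have f4 : 0 ≤ (8 + 2 * M) ^ 2 * betaDens u β₁ β₂ β₃ t θ := by positivity
  have f5 : 0 ≤ M ^ 2 * betaDens u β₁ β₂ β₃ t θ := by positivity
  rw [norm_zero]
  linarith

/-- `ε`-regularity for the Willmore system. -/
lemma IsWillmoreSystem.exists_integral_le (M C₀ : ℝ) (hM : 0 ≤ M) (hC₀ : 0 ≤ C₀) :
    ∃ C > 0, ∃ κ₀ > 0, ∀ {m t₁ : ℝ} {u : ℝ → ℝ → ℝ} {H P R β₁ β₂ β₃ : ℝ → ℝ → E} {κ : ℝ},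
      IsWillmoreSystem m M C₀ (t₁ - 1) (t₁ + 1) u H P R β₁ β₂ β₃ → 0 < κ → κ ≤ κ₀ →
      dblInt (t₁ - 1) (t₁ + 1) (betaDens u β₁ β₂ β₃) ≤ κ →
      ∫ θ in (0 : ℝ)..(2 * π), betaDens u β₁ β₂ β₃ t₁ θ ≤ C * κ := by
  set C₁ := 8 * (12 * (8 + 2 * M) ^ 2 + 2 * C₀) + (200 * M ^ 2 + 16 * (8 + 2 * M) ^ 2) with hC₁
  have C₁0 : 0 ≤ C₁ := by positivity
  set B := 16 * C₀ * (2 * M + 6) ^ 2 with hB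
  have B0 : 0 ≤ B := by positivity
  refine ⟨2 * M + 5 + (2 * C₁ + 1), by positivity, 1 / (2 * (B + 1)), by positivity, ?_⟩
  intro m t₁ u H P R β₁ β₂ β₃ κ h hκ hκ₀ hK
  have hi := h.isInterpolated
  have hD0 := h.dblInt_grad_beta_le
  have hS := h.dblInt_grad_H_le
  set D := dblInt (t₁ - 1) (t₁ + 1)
    (fun t θ => parabola t₁ t ^ 4 * betaDirichlet u β₁ β₂ β₃ t θ) with hDdef
  set K := dblInt (t₁ - 1) (t₁ + 1) (betaDens u β₁ β₂ β₃) with hKdef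
  set N := dblInt (t₁ - 1) (t₁ + 1)
    (fun t θ => parabola t₁ t ^ 4 * betaDens u β₁ β₂ β₃ t θ ^ 2) with hNdef
  have D0 : 0 ≤ D := dblInt_nonneg (by linarith) fun t _ θ =>
    mul_nonneg (by positivity) (betaDirichlet_nonneg t θ)
  have K0 : 0 ≤ K := dblInt_nonneg (by linarith) fun t _ θ => betaDens_nonneg t θ
  have hD : D ≤ C₁ * κ + 16 * C₀ * N := by
    have : C₁ * K ≤ C₁ * κ := by gcongr
    rw [hC₁] at this ⊢
    linarith
  have hN : N ≤ (2 * M + 6) ^ 2 * (κ * (D + κ)) := by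
    set s := √((D + κ) / κ) with hs
    have hs2 : s ^ 2 * κ = D + κ := by
      rw [hs, Real.sq_sqrt (by positivity)]; field_simp
    have hs1 : 1 ≤ s := by
      rw [hs, Real.one_le_sqrt, le_div_iff₀ hκ]; linarith
    have hs0 : 0 < s := by linarith
    refine (hi.dblInt_sq_le hs0).trans ?_
    have e1 : (2 * M + 4 + s) * K + D / s ≤ (2 * M + 6) * (s * κ) := by
      have a1 : (2 * M + 4 + s) * K ≤ ((2 * M + 5) * s) * κ := by
        gcongr
        nlinarith
      have a2 : D / s ≤ s * κ := by
        rw [div_le_iff₀ hs0]; nlinarith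
      linarith
    calc ((2 * M + 4 + s) * K + D / s) ^ 2 ≤ ((2 * M + 6) * (s * κ)) ^ 2 := by
          gcongr
      _ = (2 * M + 6) ^ 2 * (κ * (s ^ 2 * κ)) := by ring
      _ = _ := by rw [hs2]
  have hD2 : D ≤ (2 * C₁ + 1) * κ := by
    have a1 : 16 * C₀ * N ≤ B * κ * (D + κ) := by
      calc 16 * C₀ * N ≤ 16 * C₀ * ((2 * M + 6) ^ 2 * (κ * (D + κ))) := by gcongr
        _ = _ := by rw [hB]; ring
    have a2 : B * κ ≤ 1 / 2 := by
      have : κ * (2 * (B + 1)) ≤ 1 := by rwa [le_div_iff₀ (by positivity)] at hκ₀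
      nlinarith
    have a3 : B * κ * (D + κ) ≤ 1 / 2 * (D + κ) := by gcongr
    linarith
  have hfin := hi.sq_mul_integral_le one_pos (t := t₁) ⟨by linarith, by linarith⟩
  have e1 : parabola t₁ t₁ = 1 := by simp [parabola]
  rw [e1, one_pow, one_mul, div_one] at hfin
  have a1 : (2 * M + 4 + 1) * K ≤ (2 * M + 5) * κ := by
    rw [show 2 * M + 4 + 1 = 2 * M + 5 by ring]; gcongr
  linarith

end EpsilonRegularity

section ScalarODE

lemma integral_le_of_le_add_deriv {a b : ℝ} (hab : a ≤ b) {A B p p' : ℝ → ℝ} (hA : Continuous A)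
    (hB : Continuous B) (hp : ∀ t, HasDerivAt p (p' t) t) (hp' : Continuous p')
    (hpa : p a = 0) (hpb : p b = 0) (h : ∀ t ∈ Icc a b, A t ≤ B t + p' t) :
    ∫ t in a..b, A t ≤ ∫ t in a..b, B t := by
  have h1 := intervalIntegral.integral_mono_on hab (hA.intervalIntegrable (μ := volume) a b)
    ((hB.add hp').intervalIntegrable (μ := volume) a b) h
  have h2 : ∫ t in a..b, (B t + p' t) = (∫ t in a..b, B t) + ∫ t in a..b, p' t :=
    intervalIntegral.integral_add (hB.intervalIntegrable _ _) (hp'.intervalIntegrable _ _)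
  have h3 := intervalIntegral.integral_eq_sub_of_hasDerivAt (fun t _ => hp t)
    (hp'.intervalIntegrable (μ := volume) a b)
  simp only [Pi.add_apply] at h1
  rw [h2, h3, hpa, hpb] at h1
  linarith

/-- A positive weight on `[a,b]` that behaves like `e^{-2mt}` up to a relative error `2κ` in its
logarithmic derivative. -/
structure IsExpWeight (m κ a b : ℝ) (μ μ' : ℝ → ℝ) : Prop where
  hasDeriv : ∀ t, HasDerivAt μ (μ' t) t
  continuous' : Continuous μ'
  pos : ∀ t, 0 < μ t
  abs_le : ∀ t ∈ Icc a b, |μ' t + 2 * m * μ t| ≤ 2 * κ * μ t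

lemma IsExpWeight.continuous {m κ a b : ℝ} {μ μ' : ℝ → ℝ} (h : IsExpWeight m κ a b μ μ') :
    Continuous μ := continuous_iff_continuousAt.2 fun t => (h.hasDeriv t).continuousAt

lemma energy_pointwise {E : Type*} [NormedAddCommGroup E] [InnerProductSpace ℝ E]
    {μ μ' l γ s : ℝ} {y F : E} (hμ : 0 ≤ μ) (hs : s ^ 2 = 1) (hγ : 0 ≤ γ)
    (h : 2 * γ * μ ≤ s * (μ' + 2 * l * μ)) :
    γ ^ 2 * (μ * ‖y‖ ^ 2) ≤
      μ * ‖F‖ ^ 2 + γ * s * (μ' * ‖y‖ ^ 2 + μ * (2 * ⟪y, l • y + F⟫_ℝ)) := by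
  have h1 := mul_le_mul_of_nonneg_left h (mul_nonneg hγ (sq_nonneg ‖y‖))
  have h2 : 0 ≤ μ * ‖s • F + γ • y‖ ^ 2 := mul_nonneg hμ (sq_nonneg _)
  have h3 : μ * ‖s • F + γ • y‖ ^ 2 =
      μ * ‖F‖ ^ 2 + 2 * γ * s * (μ * ⟪y, F⟫_ℝ) + γ ^ 2 * (μ * ‖y‖ ^ 2) := by
    rw [norm_add_sq_real, norm_smul, norm_smul, mul_pow, mul_pow, norm_eq_abs, norm_eq_abs, sq_abs,
      sq_abs, inner_smul_left, inner_smul_right, real_inner_comm]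
    simp only [conj_trivial]
    linear_combination μ * ‖F‖ ^ 2 * hs
  rw [inner_add_right, inner_smul_right, real_inner_self_eq_norm_sq]
  nlinarith

lemma energy_le {E : Type*} [NormedAddCommGroup E] [InnerProductSpace ℝ E] {a b m κ : ℝ}
    (hab : a ≤ b) {μ μ' : ℝ → ℝ} {y F : ℝ → E} {l : ℝ}
    (hw : IsExpWeight m κ a b μ μ') (hF : Continuous F)
    (hy : ∀ t, HasDerivAt y (l • y t + F t) t) (hya : y a = 0) (hyb : y b = 0)
    (hγ : 0 ≤ |l - m| - κ) :
    (|l - m| - κ) ^ 2 * (∫ t in a..b, μ t * ‖y t‖ ^ 2) ≤ ∫ t in a..b, μ t * ‖F t‖ ^ 2 := by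
  have hyc : Continuous y := continuous_iff_continuousAt.2 fun t => (hy t).continuousAt
  have hμc := hw.continuous
  obtain ⟨s, hs, hsl⟩ : ∃ s : ℝ, s ^ 2 = 1 ∧ s * (l - m) = |l - m| := by
    rcases abs_cases (l - m) with ⟨h, _⟩ | ⟨h, _⟩
    · exact ⟨1, by norm_num, by rw [h]; ring⟩
    · exact ⟨-1, by norm_num, by rw [h]; ring⟩
  rw [← intervalIntegral.integral_const_mul]
  refine integral_le_of_le_add_deriv hab (p := fun t => (|l - m| - κ) * s * (μ t * ‖y t‖ ^ 2))
    (p' := fun t => (|l - m| - κ) * s * (μ' t * ‖y t‖ ^ 2 + μ t * (2 * ⟪y t, l • y t + F t⟫_ℝ)))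
    (by fun_prop) (by fun_prop) (fun t => ?_) ?_ (by simp [hya]) (by simp [hyb]) fun t ht => ?_
  · exact ((hw.hasDeriv t).mul (hy t).norm_sq).const_mul _
  · have := hw.continuous'
    fun_prop
  · refine energy_pointwise (hw.pos t).le hs hγ ?_
    have h1 := hw.abs_le t ht
    have h2 : s * (μ' t + 2 * l * μ t) = s * (μ' t + 2 * m * μ t) + 2 * |l - m| * μ t := by
      rw [← hsl]; ring
    have h3 : |s| = 1 := by
      have := sq_abs s
      nlinarith [abs_nonneg s]
    have h4 := neg_abs_le (s * (μ' t + 2 * m * μ t))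
    rw [abs_mul, h3, one_mul] at h4
    rw [h2]
    linarith

lemma one_sub_le_abs_sub_sub {k m κ : ℝ} (hm : 0 ≤ m) (hkm : 1 ≤ |k - m|) (hκ : κ < 1)
    (hκ0 : 0 ≤ κ) :
    1 - κ ≤ |k - m| - κ ∧ k ≤ (m + 1) / (1 - κ) * (|k - m| - κ) := by
  refine ⟨by linarith, ?_⟩
  have h1 : (1 - κ) * |k - m| ≤ |k - m| - κ := by nlinarith
  have h2 : k ≤ (m + 1) * |k - m| := by
    have := le_abs_self (k - m)
    nlinarith
  have hd : 0 < 1 - κ := by linarith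
  calc k ≤ (m + 1) * |k - m| := h2
    _ = (m + 1) / (1 - κ) * ((1 - κ) * |k - m|) := by field_simp
    _ ≤ _ := mul_le_mul_of_nonneg_left h1 (by positivity)

/-- The constant in the non-resonant mode estimate. -/
def modeConst (m κ : ℝ) : ℝ :=
  2 / (1 - κ) ^ 2 * (3 * ((m + 1) / (1 - κ)) ^ 2 + 3 / (1 - κ) ^ 2 + 1)

lemma modeConst_nonneg (m κ : ℝ) : 0 ≤ modeConst m κ := by
  unfold modeConst; positivity

/-- Weighted estimate for `w'' - k² w = p' + (σ k r + s)` away from the resonance `k = m`. -/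
lemma mode_estimate {a b m κ k σ : ℝ} (hab : a ≤ b) (hk : 0 ≤ k) (hm : 1 ≤ m)
    (hkm : 1 ≤ |k - m|) (hκ : κ < 1) (hκ0 : 0 ≤ κ) (hσ : σ ^ 2 = 1) {μ μ' : ℝ → ℝ}
    (hw : IsExpWeight m κ a b μ μ')
    {w w' w'' p p' r s : ℝ → ℝ} (hdw : ∀ t, HasDerivAt w (w' t) t)
    (hdw' : ∀ t, HasDerivAt w' (w'' t) t) (hdp : ∀ t, HasDerivAt p (p' t) t)
    (hr : Continuous r) (hs : Continuous s)
    (heq : ∀ t, w'' t - k ^ 2 * w t = p' t + (σ * k * r t + s t))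
    (hwa : w a = 0) (hwb : w b = 0) (hwa' : w' a = 0) (hwb' : w' b = 0)
    (hpa : p a = 0) (hpb : p b = 0) :
    ∫ t in a..b, μ t * w t ^ 2 ≤
      modeConst m κ * (∫ t in a..b, μ t * (p t ^ 2 + r t ^ 2 + s t ^ 2)) := by
  have hwc : Continuous w := continuous_iff_continuousAt.2 fun t => (hdw t).continuousAt
  have hwc' : Continuous w' := continuous_iff_continuousAt.2 fun t => (hdw' t).continuousAt
  have hpc : Continuous p := continuous_iff_continuousAt.2 fun t => (hdp t).continuousAt
  have hμc := hw.continuous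
  obtain ⟨hγ, hkγ⟩ := one_sub_le_abs_sub_sub (by linarith) hkm hκ hκ0
  have hδ : 0 < 1 - κ := by linarith
  set δ := 1 - κ with hδdef
  set γ := |k - m| - κ with hγdef
  have hγ0 : 0 < γ := by linarith
  set K := (m + 1) / δ with hK
  have hy := energy_le hab (y := fun t => w' t + k * w t - p t)
    (F := fun t => k * p t + (σ * k * r t + s t)) (l := k) hw (by fun_prop)
    (fun t => ((((hdw' t).add ((hdw t).const_mul k)).sub (hdp t))).congr_deriv
      (by rw [smul_eq_mul]; linear_combination heq t))
    (by simp [hwa, hwa', hpa]) (by simp [hwb, hwb', hpb]) hγ0.le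
  have hw2 := energy_le hab (y := w) (F := fun t => (w' t + k * w t - p t) + p t) (l := -k) hw
    (by fun_prop) (fun t => (hdw t).congr_deriv (by rw [smul_eq_mul]; ring)) hwa hwb (by
      rw [show -k - m = -(k + m) by ring, abs_neg, abs_of_nonneg (by linarith)]; linarith)
  simp only [norm_eq_abs, sq_abs, ← hγdef] at hy hw2
  set Y := ∫ t in a..b, μ t * (w' t + k * w t - p t) ^ 2 with hYdef
  set I := ∫ t in a..b, μ t * (p t ^ 2 + r t ^ 2 + s t ^ 2) with hI
  have hI0 : 0 ≤ I := intervalIntegral.integral_nonneg hab fun t _ =>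
    mul_nonneg (hw.pos t).le (by positivity)
  have hW0 : 0 ≤ ∫ t in a..b, μ t * w t ^ 2 := intervalIntegral.integral_nonneg hab fun t _ =>
    mul_nonneg (hw.pos t).le (by positivity)
  have h1 : ∫ t in a..b, μ t * (k * p t + (σ * k * r t + s t)) ^ 2 ≤ (3 * k ^ 2 + 3) * I := by
    rw [hI, ← intervalIntegral.integral_const_mul]
    refine intervalIntegral.integral_mono_on hab (Continuous.intervalIntegrable (by fun_prop) _ _)
      (Continuous.intervalIntegrable (by fun_prop) _ _) fun t _ => ?_
    have h2 : (k * p t + (σ * k * r t + s t)) ^ 2 ≤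
        (3 * k ^ 2 + 3) * (p t ^ 2 + r t ^ 2 + s t ^ 2) := by
      have : (σ * k * r t) ^ 2 = k ^ 2 * r t ^ 2 := by rw [mul_pow, mul_pow, hσ, one_mul]
      nlinarith [sq_nonneg (k * p t - σ * k * r t), sq_nonneg (k * p t - s t),
        sq_nonneg (σ * k * r t - s t), sq_nonneg (p t), sq_nonneg (r t), sq_nonneg (k * s t)]
    have := mul_le_mul_of_nonneg_left h2 (hw.pos t).le
    linarith
  have h2 : Y ≤ (3 * K ^ 2 + 3 / δ ^ 2) * I := by
    have h3 : 3 * k ^ 2 + 3 ≤ γ ^ 2 * (3 * K ^ 2 + 3 / δ ^ 2) := by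
      have h4 : k ^ 2 ≤ (K * γ) ^ 2 := by gcongr
      have h5 : 1 ≤ γ ^ 2 / δ ^ 2 := by
        rw [one_le_div (by positivity)]; gcongr
      calc 3 * k ^ 2 + 3 ≤ 3 * (K * γ) ^ 2 + 3 * (γ ^ 2 / δ ^ 2) := by linarith
        _ = _ := by ring
    have h6 : γ ^ 2 * Y ≤ γ ^ 2 * ((3 * K ^ 2 + 3 / δ ^ 2) * I) := by
      calc _ ≤ (3 * k ^ 2 + 3) * I := hy.trans h1
        _ ≤ _ := by
          rw [← mul_assoc]; exact mul_le_mul_of_nonneg_right h3 hI0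
    exact le_of_mul_le_mul_left h6 (by positivity)
  have h3 : ∫ t in a..b, μ t * ((w' t + k * w t - p t) + p t) ^ 2 ≤ 2 * Y + 2 * I := by
    rw [hI, hYdef, ← intervalIntegral.integral_const_mul, ← intervalIntegral.integral_const_mul,
      ← intervalIntegral.integral_add (Continuous.intervalIntegrable (by fun_prop) _ _)
        (Continuous.intervalIntegrable (by fun_prop) _ _)]
    refine intervalIntegral.integral_mono_on hab (Continuous.intervalIntegrable (by fun_prop) _ _)
      (Continuous.intervalIntegrable (by fun_prop) _ _) fun t _ => ?_
    have h2 : ((w' t + k * w t - p t) + p t) ^ 2 ≤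
        2 * (w' t + k * w t - p t) ^ 2 + 2 * (p t ^ 2 + r t ^ 2 + s t ^ 2) := by
      nlinarith [sq_nonneg ((w' t + k * w t - p t) - p t), sq_nonneg (r t), sq_nonneg (s t)]
    have := mul_le_mul_of_nonneg_left h2 (hw.pos t).le
    linarith
  have h4 : δ ^ 2 ≤ (|-k - m| - κ) ^ 2 := by
    rw [show -k - m = -(k + m) by ring, abs_neg, abs_of_nonneg (by linarith)]
    gcongr; linarith
  have h5 : δ ^ 2 * (∫ t in a..b, μ t * w t ^ 2) ≤ 2 * ((3 * K ^ 2 + 3 / δ ^ 2) * I) + 2 * I := by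
    calc _ ≤ _ := mul_le_mul_of_nonneg_right h4 hW0
      _ ≤ _ := hw2
      _ ≤ _ := h3
      _ ≤ _ := by linarith
  have h6 : δ ^ 2 * (modeConst m κ * I) = 2 * ((3 * K ^ 2 + 3 / δ ^ 2) * I) + 2 * I := by
    simp only [modeConst, ← hδdef, ← hK]
    field_simp
  rw [← h6] at h5
  exact le_of_mul_le_mul_left h5 (by positivity)

end ScalarODE

section Fourier

/-- The pairing of a function on the circle with the weight `e`. -/
def trigCoeff (e : ℝ → ℝ) (F : ℝ → ℝ → ℝ) (t : ℝ) : ℝ := ∫ θ in (0 : ℝ)..(2 * π), F t θ * e θ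

lemma norm_sq_fourierCoeffOn {f : ℝ → ℝ} (hf : Continuous f) (k : ℤ) :
    ‖fourierCoeffOn (a := 0) (b := 2 * π) (by positivity) (fun x => (f x : ℂ)) k‖ ^ 2 =
      (1 / (2 * π)) ^ 2 * ((∫ x in (0 : ℝ)..(2 * π), f x * cos (k * x)) ^ 2 +
        (∫ x in (0 : ℝ)..(2 * π), f x * sin (k * x)) ^ 2) := by
  rw [fourierCoeffOn_eq_integral]
  have h1 : ∀ x : ℝ, fourier (-k) (x : AddCircle (2 * π - 0)) • (f x : ℂ) =
      ((f x * cos (k * x) : ℝ) : ℂ) + ((-(f x * sin (k * x)) : ℝ) : ℂ) * Complex.I := by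
    intro x
    rw [fourier_coe_apply]
    have h2 : (2 * π * Complex.I * ((-k : ℤ) : ℂ) * x / ((2 * π - 0 : ℝ) : ℂ)) =
        ((-(k * x) : ℝ) : ℂ) * Complex.I := by
      have : (π : ℂ) ≠ 0 := by exact_mod_cast pi_ne_zero
      push_cast
      field_simp
      ring
    rw [h2, Complex.exp_mul_I, ← Complex.ofReal_cos, ← Complex.ofReal_sin, cos_neg, sin_neg]
    simp only [smul_eq_mul]
    push_cast
    ring
  simp only [h1]
  rw [intervalIntegral.integral_add
      (Continuous.intervalIntegrable (by fun_prop) _ _)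
      (Continuous.intervalIntegrable (by fun_prop) _ _),
    intervalIntegral.integral_mul_const, intervalIntegral.integral_ofReal,
    intervalIntegral.integral_ofReal, intervalIntegral.integral_neg, norm_smul, mul_pow,
    Complex.sq_norm, Complex.normSq_add_mul_I, norm_eq_abs, sq_abs, sub_zero]
  ring

lemma hasSum_trigCoeff {f : ℝ → ℝ} (hf : Continuous f) :
    HasSum (fun k : ℤ => (∫ x in (0 : ℝ)..(2 * π), f x * cos (k * x)) ^ 2 +
        (∫ x in (0 : ℝ)..(2 * π), f x * sin (k * x)) ^ 2)
      (2 * π * ∫ x in (0 : ℝ)..(2 * π), f x ^ 2) := by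
  have hfc : Continuous (fun x => (f x : ℂ)) := by fun_prop
  obtain ⟨C, hC⟩ := isCompact_Icc.exists_bound_of_continuousOn
    (hfc.continuousOn (s := Icc 0 (2 * π)))
  have hL2 : MemLp (fun x => (f x : ℂ)) 2 (volume.restrict (Ioc 0 (2 * π))) :=
    MemLp.of_bound hfc.aestronglyMeasurable C
      ((ae_restrict_mem measurableSet_Ioc).mono fun x hx => hC x (Ioc_subset_Icc_self hx))
  have h := hasSum_sq_fourierCoeffOn (a := 0) (b := 2 * π) (by positivity) hL2
  simp only [norm_sq_fourierCoeffOn hf] at h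
  have h2 := h.mul_left ((2 * π) ^ 2)
  have hpi : (π : ℝ) ≠ 0 := pi_ne_zero
  have h3 : ∀ x : ℝ, (2 * π) ^ 2 * ((1 / (2 * π)) ^ 2 * x) = x := fun x => by field_simp
  have h4 : ∀ x : ℝ, (2 * π) ^ 2 * ((2 * π)⁻¹ * x) = 2 * π * x := fun x => by field_simp
  simpa only [h3, sub_zero, smul_eq_mul, h4, Complex.norm_real, norm_eq_abs, sq_abs] using h2

/-- The weighted energy of the `k`-th Fourier mode. -/
def modeEnergy (μ : ℝ → ℝ) (a b : ℝ) (k : ℤ) (F : ℝ → ℝ → ℝ) : ℝ :=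
  ∫ t in a..b, μ t * (trigCoeff (fun x => cos (k * x)) F t ^ 2 +
    trigCoeff (fun x => sin (k * x)) F t ^ 2)

lemma continuous_trigCoeff {e : ℝ → ℝ} (he : Continuous e) {F : ℝ → ℝ → ℝ} (hF : Cont₂ F) :
    Continuous (trigCoeff e F) :=
  Cont₂.continuous_integral (F := fun t θ => F t θ * e θ)
    (hF.mul (he.comp continuous_snd)) _ _

lemma hasSum_modeEnergy {μ : ℝ → ℝ} (hμ : Continuous μ) (hμ0 : ∀ t, 0 ≤ μ t) {a b : ℝ}
    {F : ℝ → ℝ → ℝ} (hF : Cont₂ F) :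
    HasSum (fun k : ℤ => modeEnergy μ a b k F)
      (2 * π * ∫ t in a..b, μ t * ∫ θ in (0 : ℝ)..(2 * π), F t θ ^ 2) := by
  have hc : ∀ k : ℤ, Continuous fun t => μ t * (trigCoeff (fun x => cos (k * x)) F t ^ 2 +
      trigCoeff (fun x => sin (k * x)) F t ^ 2) := fun k =>
    hμ.mul (((continuous_trigCoeff (by fun_prop) hF).pow 2).add
      ((continuous_trigCoeff (by fun_prop) hF).pow 2))
  have hs : ∀ t, HasSum (fun k : ℤ => μ t * (trigCoeff (fun x => cos (k * x)) F t ^ 2 +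
      trigCoeff (fun x => sin (k * x)) F t ^ 2))
      (2 * π * (μ t * ∫ θ in (0 : ℝ)..(2 * π), F t θ ^ 2)) := fun t => by
    have := (hasSum_trigCoeff (hF.right t)).mul_left (μ t)
    rwa [mul_left_comm] at this
  have hcI : Continuous fun t => 2 * π * (μ t * ∫ θ in (0 : ℝ)..(2 * π), F t θ ^ 2) :=
    continuous_const.mul (hμ.mul ((hF.pow 2).continuous_integral _ _))
  rw [← intervalIntegral.integral_const_mul]
  refine intervalIntegral.hasSum_integral_of_dominated_convergence
    (fun (k : ℤ) t => μ t * (trigCoeff (fun x => cos (k * x)) F t ^ 2 +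
      trigCoeff (fun x => sin (k * x)) F t ^ 2)) (fun k => (hc k).aestronglyMeasurable)
    (fun k => ae_of_all _ fun t _ => ?_) (ae_of_all _ fun t _ => (hs t).summable) ?_
    (ae_of_all _ fun t _ => hs t)
  · rw [norm_eq_abs, abs_of_nonneg (mul_nonneg (hμ0 t) (by positivity))]
  · simp only [(hs _).tsum_eq]
    exact hcI.intervalIntegrable _ _

lemma hasDerivAt_trigCoeff {e : ℝ → ℝ} (he : ContDiff ℝ (⊤ : ℕ∞) e) {F : ℝ → ℝ → ℝ}
    (hF : Smooth₂ F) (t : ℝ) : HasDerivAt (trigCoeff e F) (trigCoeff e (pt F) t) t := by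
  refine ((hF.mul (smooth₂_snd he)).hasDerivAt_integral two_pi_nonneg t).congr_deriv ?_
  refine intervalIntegral.integral_congr fun θ _ => ?_
  exact ((hF.hasDerivAt_pt t θ).mul_const (e θ)).deriv

/-- Integration by parts for the coefficients of a `θ`-derivative. -/
lemma trigCoeff_pth {e e' : ℝ → ℝ} (he : ContDiff ℝ (⊤ : ℕ∞) e) (he' : ∀ x, HasDerivAt e (e' x) x)
    (hec : Continuous e')
    (hper : e (2 * π) = e 0) {F : ℝ → ℝ → ℝ} (hF : Smooth₂ F) (hp : Periodic₂ F) (t : ℝ) :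
    trigCoeff e (pth F) t = -trigCoeff e' F t := by
  have h := intervalIntegral.integral_eq_sub_of_hasDerivAt (a := 0) (b := 2 * π)
    (fun θ _ => (hF.hasDerivAt_pth t θ).mul (he' θ))
    (Continuous.intervalIntegrable (((hF.dth.continuous_right t).mul he.continuous).add
      ((hF.continuous_right t).mul hec)) _ _)
  have h1 := intervalIntegral.integral_add (a := 0) (b := 2 * π) (μ := volume)
    (((hF.dth.continuous_right t).mul he.continuous).intervalIntegrable _ _)
    (((hF.continuous_right t).mul hec).intervalIntegrable _ _)
  have h0 : F t (2 * π) = F t 0 := by have := hp t 0; rwa [zero_add] at this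
  simp only [Pi.mul_apply, h0, hper, sub_self] at h h1
  unfold trigCoeff
  linarith

lemma trigCoeff_add {e : ℝ → ℝ} (he : Continuous e) {F G : ℝ → ℝ → ℝ} (hF : Cont₂ F) (hG : Cont₂ G)
    (t : ℝ) : trigCoeff e (fun t θ => F t θ + G t θ) t = trigCoeff e F t + trigCoeff e G t := by
  unfold trigCoeff
  simp only [add_mul]
  exact intervalIntegral.integral_add (((hF.right t).mul he).intervalIntegrable _ _)
    (((hG.right t).mul he).intervalIntegrable _ _)

lemma trigCoeff_const_mul {e : ℝ → ℝ} {c : ℝ} {F : ℝ → ℝ → ℝ} (t : ℝ) :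
    trigCoeff (fun x => c * e x) F t = c * trigCoeff e F t := by
  unfold trigCoeff
  rw [← intervalIntegral.integral_const_mul]
  congr 1
  funext x
  ring

lemma trigCoeff_eq_zero {e : ℝ → ℝ} {F : ℝ → ℝ → ℝ} {t : ℝ} (h : ∀ θ, F t θ = 0) :
    trigCoeff e F t = 0 := by
  simp [trigCoeff, h]

/-- The mode estimate for a pair of trigonometric functions `e`, `d` of frequency `k`. -/
lemma trigCoeff_estimate {a b m κ : ℝ} (hab : a ≤ b) {k : ℤ} (hm : 1 ≤ m)
    (hkm : 1 ≤ |(|(k : ℝ)|) - m|) (hκ : κ < 1) (hκ0 : 0 ≤ κ) {μ μ' : ℝ → ℝ}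
    (hw : IsExpWeight m κ a b μ μ') {e d : ℝ → ℝ} (he : ContDiff ℝ (⊤ : ℕ∞) e)
    (hd : ContDiff ℝ (⊤ : ℕ∞) d) (hed : ∀ x, HasDerivAt e (-k * d x) x)
    (hde : ∀ x, HasDerivAt d (k * e x) x) (hep : e (2 * π) = e 0) (hdp : d (2 * π) = d 0)
    {w p r s : ℝ → ℝ → ℝ} (sw : Smooth₂ w) (sp : Smooth₂ p) (sr : Smooth₂ r) (ss : Smooth₂ s)
    (pw : Periodic₂ w) (pr : Periodic₂ r)
    (heq : ∀ t θ, pt (pt w) t θ + pth (pth w) t θ = pt p t θ + (pth r t θ + s t θ))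
    (hwa : ∀ θ, w a θ = 0) (hwb : ∀ θ, w b θ = 0) (hwa' : ∀ θ, pt w a θ = 0)
    (hwb' : ∀ θ, pt w b θ = 0) (hpa : ∀ θ, p a θ = 0) (hpb : ∀ θ, p b θ = 0) :
    ∫ t in a..b, μ t * trigCoeff e w t ^ 2 ≤ modeConst m κ *
      ∫ t in a..b, μ t * (trigCoeff e p t ^ 2 + trigCoeff d r t ^ 2 + trigCoeff e s t ^ 2) := by
  have hσ : ∃ σ : ℝ, σ ^ 2 = 1 ∧ (k : ℝ) = σ * |(k : ℝ)| := by
    rcases abs_cases (k : ℝ) with ⟨h, _⟩ | ⟨h, _⟩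
    · exact ⟨1, by norm_num, by rw [h]; ring⟩
    · exact ⟨-1, by norm_num, by rw [h]; ring⟩
  obtain ⟨σ, hσ, hk⟩ := hσ
  have key : ∀ (F : ℝ → ℝ → ℝ), Smooth₂ F → Periodic₂ F → ∀ t,
      trigCoeff e (pth F) t = k * trigCoeff d F t := fun F hF hpF t => by
    rw [trigCoeff_pth he hed (continuous_const.mul hd.continuous) hep hF hpF, trigCoeff_const_mul]
    ring
  have key' : ∀ (F : ℝ → ℝ → ℝ), Smooth₂ F → Periodic₂ F → ∀ t,
      trigCoeff d (pth F) t = -(k * trigCoeff e F t) := fun F hF hpF t => by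
    rw [trigCoeff_pth hd hde (continuous_const.mul he.continuous) hdp hF hpF, trigCoeff_const_mul]
  refine mode_estimate hab (abs_nonneg (k : ℝ)) hm hkm hκ hκ0 hσ hw
    (hasDerivAt_trigCoeff he sw) (hasDerivAt_trigCoeff he sw.dt) (hasDerivAt_trigCoeff he sp)
    (continuous_trigCoeff hd.continuous sr.cont₂) (continuous_trigCoeff he.continuous ss.cont₂)
    (fun t => ?_) (trigCoeff_eq_zero hwa) (trigCoeff_eq_zero hwb) (trigCoeff_eq_zero hwa')
    (trigCoeff_eq_zero hwb') (trigCoeff_eq_zero hpa) (trigCoeff_eq_zero hpb)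
  have h1 : trigCoeff e (fun t θ => pt (pt w) t θ + pth (pth w) t θ) t =
      trigCoeff e (fun t θ => pt p t θ + (pth r t θ + s t θ)) t := by
    simp only [heq]
  rw [trigCoeff_add he.continuous sw.dt.dt.cont₂ sw.dth.dth.cont₂,
    trigCoeff_add he.continuous sp.dt.cont₂ (sr.dth.add ss).cont₂,
    trigCoeff_add he.continuous sr.dth.cont₂ ss.cont₂] at h1
  change _ + trigCoeff e (pth (pth w)) t =
    trigCoeff e (pt p) t + (trigCoeff e (pth r) t + trigCoeff e s t) at h1
  rw [key _ sw.dth pw.dth, key' _ sw pw, key _ sr pr] at h1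
  rw [sq_abs, ← hk]
  change trigCoeff e (pt (pt w)) t + _ = _ at h1
  linear_combination h1

end Fourier

section Poisson

lemma modeEnergy_neg (μ : ℝ → ℝ) (a b : ℝ) (k : ℤ) (F : ℝ → ℝ → ℝ) :
    modeEnergy μ a b (-k) F = modeEnergy μ a b k F := by
  have hc : ∀ t, trigCoeff (fun x => cos (((-k : ℤ) : ℝ) * x)) F t =
      trigCoeff (fun x => cos (k * x)) F t := fun t => by
    simp [trigCoeff]
  have hs : ∀ t, trigCoeff (fun x => sin (((-k : ℤ) : ℝ) * x)) F t =
      -trigCoeff (fun x => sin (k * x)) F t := fun t => by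
    simp [trigCoeff]
  simp only [modeEnergy, hc, hs, neg_sq]

lemma one_le_abs_abs_sub_natCast {k : ℤ} {m : ℕ} (h1 : k ≠ m) (h2 : k ≠ -m) :
    (1 : ℝ) ≤ |(|(k : ℝ)|) - m| := by
  have h : (1 : ℤ) ≤ |(|k| - (m : ℤ))| := by
    refine Int.one_le_abs fun h => ?_
    rcases abs_cases k with ⟨h3, _⟩ | ⟨h3, _⟩ <;> omega
  exact_mod_cast h

lemma modeEnergy_estimate {a b κ : ℝ} {m : ℕ} (hab : a ≤ b) {k : ℤ} (hm : 1 ≤ m)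
    (h1 : k ≠ m) (h2 : k ≠ -m) (hκ : κ < 1) (hκ0 : 0 ≤ κ) {μ μ' : ℝ → ℝ}
    (hw : IsExpWeight m κ a b μ μ')
    {w p r s : ℝ → ℝ → ℝ} (sw : Smooth₂ w) (sp : Smooth₂ p) (sr : Smooth₂ r) (ss : Smooth₂ s)
    (pw : Periodic₂ w) (pr : Periodic₂ r)
    (heq : ∀ t θ, pt (pt w) t θ + pth (pth w) t θ = pt p t θ + (pth r t θ + s t θ))
    (hwa : ∀ θ, w a θ = 0) (hwb : ∀ θ, w b θ = 0) (hwa' : ∀ θ, pt w a θ = 0)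
    (hwb' : ∀ θ, pt w b θ = 0) (hpa : ∀ θ, p a θ = 0) (hpb : ∀ θ, p b θ = 0) :
    modeEnergy μ a b k w ≤ modeConst m κ *
      (modeEnergy μ a b k p + modeEnergy μ a b k r + modeEnergy μ a b k s) := by
  have hkm := one_le_abs_abs_sub_natCast h1 h2
  have hm' : (1 : ℝ) ≤ m := by exact_mod_cast hm
  have hlin : ∀ x : ℝ, HasDerivAt (fun x : ℝ => (k : ℝ) * x) k x := fun x => by
    simpa using (hasDerivAt_id x).const_mul (k : ℝ)
  have hcos : ∀ x : ℝ, HasDerivAt (fun x : ℝ => cos (k * x)) (-k * sin (k * x)) x := fun x =>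
    (hlin x).cos.congr_deriv (by ring)
  have hsin : ∀ x : ℝ, HasDerivAt (fun x : ℝ => sin (k * x)) (k * cos (k * x)) x := fun x =>
    (hlin x).sin.congr_deriv (by ring)
  have hC : ContDiff ℝ (⊤ : ℕ∞) (fun x : ℝ => cos (k * x)) := by fun_prop
  have hS : ContDiff ℝ (⊤ : ℕ∞) (fun x : ℝ => sin (k * x)) := by fun_prop
  have hcp : cos (k * (2 * π)) = cos (k * 0) := by
    rw [cos_int_mul_two_pi, mul_zero, cos_zero]
  have hsp : sin (k * (2 * π)) = sin (k * 0) := by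
    have := sin_periodic.int_mul_eq k
    rw [mul_zero]; simpa using this
  have e1 := trigCoeff_estimate hab (k := k) hm' hkm hκ hκ0 hw hC hS hcos hsin hcp hsp
    sw sp sr ss pw pr heq hwa hwb hwa' hwb' hpa hpb
  have e2 := trigCoeff_estimate hab (k := k) hm' hkm hκ hκ0 hw hS (hC.const_smul (-1 : ℝ))
    (fun x => (hsin x).congr_deriv (by simp))
    (fun x => ((hcos x).const_smul (-1 : ℝ)).congr_deriv (by
      simp)) hsp (by simp [hcp])
    sw sp sr ss pw pr heq hwa hwb hwa' hwb' hpa hpb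
  have hneg : ∀ t, trigCoeff ((-1 : ℝ) • fun x => cos (k * x)) r t ^ 2 =
      trigCoeff (fun x => cos (k * x)) r t ^ 2 := fun t => by
    have : ((-1 : ℝ) • fun x : ℝ => cos (k * x)) = fun x => (-1) * cos (k * x) := rfl
    rw [this, trigCoeff_const_mul]; ring
  change _ ≤ _ * ∫ t in a..b, μ t * (_ + trigCoeff ((-1 : ℝ) • fun x => cos (k * x)) r t ^ 2 + _)
    at e2
  simp only [hneg] at e2
  have hμc := hw.continuous
  have cc : ∀ {F : ℝ → ℝ → ℝ}, Smooth₂ F → Continuous (trigCoeff (fun x => cos (k * x)) F) :=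
    fun hF => continuous_trigCoeff hC.continuous hF.cont₂
  have cs : ∀ {F : ℝ → ℝ → ℝ}, Smooth₂ F → Continuous (trigCoeff (fun x => sin (k * x)) F) :=
    fun hF => continuous_trigCoeff hS.continuous hF.cont₂
  have := cc sw; have := cs sw; have := cc sp; have := cs sp
  have := cc sr; have := cs sr; have := cc ss; have := cs ss
  have e3 : modeEnergy μ a b k w =
      (∫ t in a..b, μ t * trigCoeff (fun x => cos (k * x)) w t ^ 2) +
      ∫ t in a..b, μ t * trigCoeff (fun x => sin (k * x)) w t ^ 2 := by
    rw [modeEnergy, ← intervalIntegral.integral_add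
      (Continuous.intervalIntegrable (by fun_prop) _ _)
      (Continuous.intervalIntegrable (by fun_prop) _ _)]
    simp only [mul_add]
  have e4 : modeEnergy μ a b k p + modeEnergy μ a b k r + modeEnergy μ a b k s =
      (∫ t in a..b, μ t * (trigCoeff (fun x => cos (k * x)) p t ^ 2 +
        trigCoeff (fun x => sin (k * x)) r t ^ 2 + trigCoeff (fun x => cos (k * x)) s t ^ 2)) +
      ∫ t in a..b, μ t * (trigCoeff (fun x => sin (k * x)) p t ^ 2 +
        trigCoeff (fun x => cos (k * x)) r t ^ 2 + trigCoeff (fun x => sin (k * x)) s t ^ 2) := by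
    simp only [modeEnergy]
    rw [← intervalIntegral.integral_add
      (Continuous.intervalIntegrable (by fun_prop) _ _)
      (Continuous.intervalIntegrable (by fun_prop) _ _), ← intervalIntegral.integral_add
      (Continuous.intervalIntegrable (by fun_prop) _ _)
      (Continuous.intervalIntegrable (by fun_prop) _ _), ← intervalIntegral.integral_add
      (Continuous.intervalIntegrable (by fun_prop) _ _)
      (Continuous.intervalIntegrable (by fun_prop) _ _)]
    congr 1
    funext t
    ring
  rw [e3, e4, mul_add]
  exact add_le_add e1 e2

lemma dblInt_weight {a b : ℝ} (μ : ℝ → ℝ) (F : ℝ → ℝ → ℝ) :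
    dblInt a b (fun t θ => μ t * F t θ) =
      ∫ t in a..b, μ t * ∫ θ in (0 : ℝ)..(2 * π), F t θ := by
  simp only [dblInt, intervalIntegral.integral_const_mul]

lemma modeEnergy_nonneg {a b : ℝ} (hab : a ≤ b) {μ : ℝ → ℝ} (hμ0 : ∀ t, 0 ≤ μ t) (k : ℤ)
    (F : ℝ → ℝ → ℝ) : 0 ≤ modeEnergy μ a b k F :=
  intervalIntegral.integral_nonneg hab fun t _ => mul_nonneg (hμ0 t) (by positivity)

/-- Weighted `L²` estimate for the Poisson equation on a cylinder, up to the resonant modes. -/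
theorem poisson_estimate {a b κ : ℝ} {m : ℕ} (hab : a ≤ b) (hm : 1 ≤ m)
    (hκ : κ < 1) (hκ0 : 0 ≤ κ) {μ μ' : ℝ → ℝ} (hw : IsExpWeight m κ a b μ μ')
    {w p r s : ℝ → ℝ → ℝ} (sw : Smooth₂ w) (sp : Smooth₂ p) (sr : Smooth₂ r) (ss : Smooth₂ s)
    (pw : Periodic₂ w) (pr : Periodic₂ r)
    (heq : ∀ t θ, pt (pt w) t θ + pth (pth w) t θ = pt p t θ + (pth r t θ + s t θ))
    (hwa : ∀ θ, w a θ = 0) (hwb : ∀ θ, w b θ = 0) (hwa' : ∀ θ, pt w a θ = 0)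
    (hwb' : ∀ θ, pt w b θ = 0) (hpa : ∀ θ, p a θ = 0) (hpb : ∀ θ, p b θ = 0) :
    dblInt a b (fun t θ => μ t * w t θ ^ 2) ≤
      modeConst m κ * dblInt a b (fun t θ => μ t * (p t θ ^ 2 + r t θ ^ 2 + s t θ ^ 2)) +
      modeEnergy μ a b m w := by
  have hμ0 : ∀ t, 0 ≤ μ t := fun t => (hw.pos t).le
  have hμc := hw.continuous
  have hN := modeEnergy_nonneg hab hμ0
  have H : ∀ {F : ℝ → ℝ → ℝ}, Smooth₂ F → HasSum (fun k : ℤ => modeEnergy μ a b k F)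
      (2 * π * dblInt a b (fun t θ => μ t * F t θ ^ 2)) := fun {F} hF => by
    rw [dblInt_weight μ (fun t θ => F t θ ^ 2)]
    exact hasSum_modeEnergy hμc hμ0 hF.cont₂
  have R := ((((H sp).add (H sr)).add (H ss)).mul_left (modeConst m κ)).add
    ((hasSum_ite_eq (m : ℤ) (modeEnergy μ a b m w)).add
      (hasSum_ite_eq (-m : ℤ) (modeEnergy μ a b m w)))
  have hle := hasSum_le (fun k => ?_) (H sw) R
  · have e : dblInt a b (fun t θ => μ t * (p t θ ^ 2 + r t θ ^ 2 + s t θ ^ 2)) =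
        dblInt a b (fun t θ => μ t * p t θ ^ 2) + dblInt a b (fun t θ => μ t * r t θ ^ 2) +
        dblInt a b (fun t θ => μ t * s t θ ^ 2) := by
      have c : ∀ {F : ℝ → ℝ → ℝ}, Smooth₂ F → Cont₂ (fun t θ => μ t * F t θ ^ 2) := fun hF =>
        (hμc.comp continuous_fst).mul (hF.cont₂.pow 2)
      rw [← dblInt_add (c sp) (c sr), ← dblInt_add ((c sp).add (c sr)) (c ss)]
      congr 1
      funext t θ
      ring
    have h1 : (1 : ℝ) ≤ π := by linarith [pi_gt_three]
    have h2 := hN m w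
    rw [e]
    have h3 : 2 * π * (dblInt a b fun t θ => μ t * w t θ ^ 2) ≤
        2 * π * (modeConst m κ * (dblInt a b (fun t θ => μ t * p t θ ^ 2) +
          dblInt a b (fun t θ => μ t * r t θ ^ 2) +
        dblInt a b (fun t θ => μ t * s t θ ^ 2)) + modeEnergy μ a b m w) := by
      refine hle.trans ?_
      nlinarith
    exact le_of_mul_le_mul_left h3 (by positivity)
  · by_cases h1 : k = m
    · subst h1
      have := mul_nonneg (modeConst_nonneg m κ) (add_nonneg (add_nonneg (hN m p) (hN m r)) (hN m s))
      have h3 : (0 : ℝ) ≤ if (m : ℤ) = -m then modeEnergy μ a b m w else 0 := by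
        split_ifs <;> [exact hN _ _; exact le_rfl]
      simp only [if_true]
      linarith
    by_cases h2 : k = -m
    · subst h2
      have := mul_nonneg (modeConst_nonneg m κ)
        (add_nonneg (add_nonneg (hN (-m) p) (hN (-m) r)) (hN (-m) s))
      simp only [h1, if_false, if_true]
      rw [modeEnergy_neg μ a b m w]
      linarith
    · simp only [h1, h2, if_false, add_zero]
      exact modeEnergy_estimate hab hm h1 h2 hκ hκ0 hw sw sp sr ss pw pr heq hwa hwb hwa' hwb'
        hpa hpb

/-- The vector-valued pairing of a function on the circle with the weight `e`. -/
def vecCoeff {V : Type*} [NormedAddCommGroup V] [NormedSpace ℝ V] (e : ℝ → ℝ) (F : ℝ → ℝ → V)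
    (t : ℝ) : V := ∫ θ in (0 : ℝ)..(2 * π), e θ • F t θ

variable {n : ℕ}

lemma trigCoeff_coord {e : ℝ → ℝ} (he : Continuous e) {F : ℝ → ℝ → EuclideanSpace ℝ (Fin n)}
    (hF : Cont₂ F) (j : Fin n) (t : ℝ) :
    trigCoeff e (fun t θ => F t θ j) t = vecCoeff e F t j := by
  have h := (EuclideanSpace.proj j : EuclideanSpace ℝ (Fin n) →L[ℝ] ℝ).intervalIntegral_comp_comm
    (a := 0) (b := 2 * π) (μ := volume) (f := fun θ => e θ • F t θ)
    ((he.smul (hF.right t)).intervalIntegrable _ _)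
  refine Eq.trans ?_ h
  rw [trigCoeff]
  congr 1
  funext θ
  simp [mul_comm]

lemma Smooth₂.coord {F : ℝ → ℝ → EuclideanSpace ℝ (Fin n)} (hF : Smooth₂ F) (j : Fin n) :
    Smooth₂ (fun t θ => F t θ j) :=
  hF.clm (EuclideanSpace.proj j : EuclideanSpace ℝ (Fin n) →L[ℝ] ℝ)

lemma Smooth₂.pt_coord {F : ℝ → ℝ → EuclideanSpace ℝ (Fin n)} (hF : Smooth₂ F) (j : Fin n) :
    pt (fun t θ => F t θ j) = fun t θ => pt F t θ j := by
  funext t θ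
  exact ((EuclideanSpace.proj j : EuclideanSpace ℝ (Fin n) →L[ℝ] ℝ).hasFDerivAt.comp_hasDerivAt t
    (hF.hasDerivAt_pt t θ)).deriv

lemma Smooth₂.pth_coord {F : ℝ → ℝ → EuclideanSpace ℝ (Fin n)} (hF : Smooth₂ F) (j : Fin n) :
    pth (fun t θ => F t θ j) = fun t θ => pth F t θ j := by
  funext t θ
  exact ((EuclideanSpace.proj j : EuclideanSpace ℝ (Fin n) →L[ℝ] ℝ).hasFDerivAt.comp_hasDerivAt θ
    (hF.hasDerivAt_pth t θ)).deriv

lemma dblInt_finset_sum {ι : Type*} (S : Finset ι) {a b : ℝ} {F : ι → ℝ → ℝ → ℝ}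
    (hF : ∀ j, Cont₂ (F j)) :
    dblInt a b (fun t θ => ∑ j ∈ S, F j t θ) = ∑ j ∈ S, dblInt a b (F j) := by
  unfold dblInt
  rw [← intervalIntegral.integral_finsetSum
    fun j _ => (hF j).intervalIntegrable_integral _ _ _ _]
  congr 1
  funext t
  exact intervalIntegral.integral_finsetSum fun j _ => ((hF j).right t).intervalIntegrable _ _

/-- Vector-valued version of `poisson_estimate`. -/
theorem poisson_estimate_vec {a b κ : ℝ} {m : ℕ} (hab : a ≤ b) (hm : 1 ≤ m)
    (hκ : κ < 1) (hκ0 : 0 ≤ κ) {μ μ' : ℝ → ℝ} (hw : IsExpWeight m κ a b μ μ')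
    {w p r s : ℝ → ℝ → EuclideanSpace ℝ (Fin n)}
    (sw : Smooth₂ w) (sp : Smooth₂ p) (sr : Smooth₂ r) (ss : Smooth₂ s)
    (pw : Periodic₂ w) (pr : Periodic₂ r)
    (heq : ∀ t θ, pt (pt w) t θ + pth (pth w) t θ = pt p t θ + (pth r t θ + s t θ))
    (hwa : ∀ θ, w a θ = 0) (hwb : ∀ θ, w b θ = 0) (hwa' : ∀ θ, pt w a θ = 0)
    (hwb' : ∀ θ, pt w b θ = 0) (hpa : ∀ θ, p a θ = 0) (hpb : ∀ θ, p b θ = 0) :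
    dblInt a b (fun t θ => μ t * ‖w t θ‖ ^ 2) ≤
      modeConst m κ * dblInt a b (fun t θ => μ t * (‖p t θ‖ ^ 2 + ‖r t θ‖ ^ 2 + ‖s t θ‖ ^ 2)) +
      ∫ t in a..b, μ t * (‖vecCoeff (fun x => cos (m * x)) w t‖ ^ 2 +
        ‖vecCoeff (fun x => sin (m * x)) w t‖ ^ 2) := by
  have hμc := hw.continuous
  have hμ₂ : Cont₂ (fun t (_ : ℝ) => μ t) := hμc.comp continuous_fst
  have h : ∀ j : Fin n, _ := fun j => poisson_estimate hab hm hκ hκ0 hw (sw.coord j) (sp.coord j)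
    (sr.coord j) (ss.coord j) (fun t θ => by rw [pw]) (fun t θ => by rw [pr]) (fun t θ => by
      rw [sw.pt_coord, sw.pth_coord, sp.pt_coord, sr.pth_coord]
      change pt (fun t θ => pt w t θ j) t θ + pth (fun t θ => pth w t θ j) t θ = _
      rw [sw.dt.pt_coord, sw.dth.pth_coord]
      have := congrArg (fun v : EuclideanSpace ℝ (Fin n) => v j) (heq t θ)
      simpa using this) (by simp [hwa]) (by simp [hwb])
      (by rw [sw.pt_coord]; simp [hwa']) (by rw [sw.pt_coord]; simp [hwb'])
      (by simp [hpa]) (by simp [hpb])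
  have hsum := Finset.sum_le_sum fun j (_ : j ∈ Finset.univ) => h j
  rw [Finset.sum_add_distrib, ← Finset.mul_sum, ← dblInt_finset_sum _ fun j =>
      hμ₂.mul ((sw.coord j).cont₂.pow 2),
    ← dblInt_finset_sum _ fun j => hμ₂.mul ((((sp.coord j).cont₂.pow 2).add
      ((sr.coord j).cont₂.pow 2)).add ((ss.coord j).cont₂.pow 2))] at hsum
  simp only [EuclideanSpace.real_norm_sq_eq]
  refine hsum.trans_eq' ?_ |>.trans_eq ?_
  · simp only [Finset.mul_sum]
  · congr 1
    · congr 2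
      funext t θ
      rw [← Finset.mul_sum, Finset.sum_add_distrib, Finset.sum_add_distrib]
    · simp only [modeEnergy]
      rw [← intervalIntegral.integral_finsetSum]
      · congr 1
        funext t
        rw [← Finset.mul_sum, Finset.sum_add_distrib]
        simp only [Int.cast_natCast,
          trigCoeff_coord (show Continuous fun x : ℝ => cos (m * x) by fun_prop) sw.cont₂,
          trigCoeff_coord (show Continuous fun x : ℝ => sin (m * x) by fun_prop) sw.cont₂]
      · intro j _
        refine (hμc.mul (((continuous_trigCoeff ?_ (sw.coord j).cont₂).pow 2).add
          ((continuous_trigCoeff ?_ (sw.coord j).cont₂).pow 2))).intervalIntegrable _ _ <;> fun_prop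

end Poisson

section Cutoff

lemma deriv_eq_zero_of_eqOn_const {g : ℝ → ℝ} {S : Set ℝ} {x c : ℝ} (hS : UniqueDiffOn ℝ S)
    (hx : x ∈ S) (hg : DifferentiableAt ℝ g x) (h : ∀ y ∈ S, g y = c) : deriv g x = 0 := by
  have h1 : HasDerivWithinAt g (deriv g x) S x := hg.hasDerivAt.hasDerivWithinAt
  have h2 : HasDerivWithinAt g 0 S x := (hasDerivWithinAt_const x S c).congr h (h x hx)
  exact (hS x hx).eq_deriv _ h1 h2

lemma exists_forall_abs_le {g : ℝ → ℝ} (hg : Continuous g) (h0 : ∀ x ∈ Iic (0 : ℝ), g x = 0)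
    (h1 : ∀ x ∈ Ici (1 : ℝ), g x = 0) : ∃ C, 0 ≤ C ∧ ∀ x, |g x| ≤ C := by
  obtain ⟨C, hC⟩ := isCompact_Icc.exists_bound_of_continuousOn
    (hg.continuousOn (s := Icc (0 : ℝ) 1))
  refine ⟨max C 0, le_max_right _ _, fun x => ?_⟩
  by_cases h : x ∈ Icc (0 : ℝ) 1
  · exact (hC x h).trans (le_max_left _ _)
  · rcases lt_or_ge x 0 with h2 | h2
    · simp [h0 x h2.le]
    · have : 1 ≤ x := by
        by_contra h3
        exact h ⟨h2, by linarith⟩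
      simp [h1 x this]

/-- A smooth cutoff function, supported in `[a,b]` and equal to one on `[a+1,b-1]`. -/
structure IsCutoff (c a b : ℝ) (χ : ℝ → ℝ) : Prop where
  smooth : ContDiff ℝ (⊤ : ℕ∞) χ
  nonneg : ∀ t, 0 ≤ χ t
  le_one : ∀ t, χ t ≤ 1
  eq_zero : ∀ t, t ≤ a ∨ b ≤ t → χ t = 0
  eq_one : ∀ t ∈ Icc (a + 1) (b - 1), χ t = 1
  deriv_le : ∀ t, |deriv χ t| ≤ c
  deriv_deriv_le : ∀ t, |deriv (deriv χ) t| ≤ c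

lemma contDiff_top_deriv {g : ℝ → ℝ} (hg : ContDiff ℝ (⊤ : ℕ∞) g) :
    ContDiff ℝ (⊤ : ℕ∞) (deriv g) := (contDiff_infty_iff_deriv.1 hg).2

lemma contDiff_top_differentiable {g : ℝ → ℝ} (hg : ContDiff ℝ (⊤ : ℕ∞) g) :
    Differentiable ℝ g := hg.differentiable (by simp)

lemma exists_isCutoff : ∃ c, 0 ≤ c ∧ ∀ a b, ∃ χ, IsCutoff c a b χ := by
  set S := Real.smoothTransition with hSdef
  have hS : ContDiff ℝ (⊤ : ℕ∞) S := Real.smoothTransition.contDiff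
  have hD := contDiff_top_deriv hS
  have hDD := contDiff_top_deriv hD
  have dS := contDiff_top_differentiable hS
  have dD := contDiff_top_differentiable hD
  have D0 : ∀ x ∈ Iic (0 : ℝ), deriv S x = 0 := fun x hx =>
    deriv_eq_zero_of_eqOn_const (uniqueDiffOn_Iic 0) hx (dS x)
      fun y hy => Real.smoothTransition.zero_of_nonpos hy
  have D1 : ∀ x ∈ Ici (1 : ℝ), deriv S x = 0 := fun x hx =>
    deriv_eq_zero_of_eqOn_const (uniqueDiffOn_Ici 1) hx (dS x)
      fun y hy => Real.smoothTransition.one_of_one_le hy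
  have DD0 : ∀ x ∈ Iic (0 : ℝ), deriv (deriv S) x = 0 := fun x hx =>
    deriv_eq_zero_of_eqOn_const (uniqueDiffOn_Iic 0) hx (dD x) D0
  have DD1 : ∀ x ∈ Ici (1 : ℝ), deriv (deriv S) x = 0 := fun x hx =>
    deriv_eq_zero_of_eqOn_const (uniqueDiffOn_Ici 1) hx (dD x) D1
  obtain ⟨K, hK0, hK⟩ := exists_forall_abs_le hD.continuous D0 D1
  obtain ⟨K', hK0', hK'⟩ := exists_forall_abs_le hDD.continuous DD0 DD1
  have S0 : ∀ x, 0 ≤ S x := Real.smoothTransition.nonneg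
  have S1 : ∀ x, S x ≤ 1 := Real.smoothTransition.le_one
  have Sa : ∀ x, |S x| ≤ 1 := fun x => by rw [abs_of_nonneg (S0 x)]; exact S1 x
  refine ⟨2 * K + 2 * K' + 2 * K ^ 2, by positivity, fun a b =>
    ⟨fun t => S (t - a) * S (b - t), ?_⟩⟩
  have l1 : ∀ (g : ℝ → ℝ), Differentiable ℝ g → ∀ t,
      HasDerivAt (fun t => g (t - a)) (deriv g (t - a)) t := fun g hg t => by
    exact ((hg (t - a)).hasDerivAt.comp t ((hasDerivAt_id t).sub_const a)).congr_deriv (mul_one _)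
  have l2 : ∀ (g : ℝ → ℝ), Differentiable ℝ g → ∀ t,
      HasDerivAt (fun t => g (b - t)) (-deriv g (b - t)) t := fun g hg t => by
    exact ((hg (b - t)).hasDerivAt.comp t ((hasDerivAt_id t).const_sub b)).congr_deriv
      (mul_neg_one _)
  have e1 : deriv (fun t => S (t - a) * S (b - t)) =
      fun t => deriv S (t - a) * S (b - t) - S (t - a) * deriv S (b - t) := by
    funext t
    refine ((l1 S dS t).mul (l2 S dS t)).deriv.trans ?_
    ring
  have e2 : deriv (deriv (fun t => S (t - a) * S (b - t))) =
      fun t => deriv (deriv S) (t - a) * S (b - t) - 2 * (deriv S (t - a) * deriv S (b - t)) +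
        S (t - a) * deriv (deriv S) (b - t) := by
    funext t
    rw [e1]
    have := ((l1 _ dD t).mul (l2 S dS t)).sub ((l1 S dS t).mul (l2 _ dD t))
    refine this.deriv.trans ?_
    ring
  have hmul : ∀ {x y A B : ℝ}, |x| ≤ A → |y| ≤ B → |x * y| ≤ A * B := fun {x y A B} hx hy => by
    rw [abs_mul]
    exact mul_le_mul hx hy (abs_nonneg _) ((abs_nonneg _).trans hx)
  constructor
  · exact (hS.comp (contDiff_id.sub contDiff_const)).mul (hS.comp (contDiff_const.sub contDiff_id))
  · exact fun t => mul_nonneg (S0 _) (S0 _)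
  · exact fun t => mul_le_one₀ (S1 _) (S0 _) (S1 _)
  · rintro t (h | h)
    · simp [hSdef, Real.smoothTransition.zero_of_nonpos (sub_nonpos.2 h)]
    · simp [hSdef, Real.smoothTransition.zero_of_nonpos (sub_nonpos.2 h)]
  · rintro t ⟨h1, h2⟩
    simp only [hSdef]
    rw [Real.smoothTransition.one_of_one_le (by linarith),
      Real.smoothTransition.one_of_one_le (by linarith), mul_one]
  · intro t
    rw [e1]
    have h1 := hmul (hK (t - a)) (Sa (b - t))
    have h2 := hmul (Sa (t - a)) (hK (b - t))
    have h3 := abs_sub (deriv S (t - a) * S (b - t)) (S (t - a) * deriv S (b - t))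
    nlinarith [sq_nonneg K]
  · intro t
    rw [e2]
    have h1 := abs_le.1 (hmul (hK' (t - a)) (Sa (b - t)))
    have h2 := abs_le.1 (hmul (Sa (t - a)) (hK' (b - t)))
    have h3 := abs_le.1 (hmul (hK (t - a)) (hK (b - t)))
    refine abs_le.2 ⟨?_, ?_⟩ <;> nlinarith [sq_nonneg K, h1.1, h1.2, h2.1, h2.2, h3.1, h3.2]

variable {c a b : ℝ} {χ : ℝ → ℝ}

lemma IsCutoff.hasDerivAt (h : IsCutoff c a b χ) (t : ℝ) : HasDerivAt χ (deriv χ t) t :=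
  (contDiff_top_differentiable h.smooth t).hasDerivAt

lemma IsCutoff.hasDerivAt_deriv (h : IsCutoff c a b χ) (t : ℝ) :
    HasDerivAt (deriv χ) (deriv (deriv χ) t) t :=
  (contDiff_top_differentiable (contDiff_top_deriv h.smooth) t).hasDerivAt

lemma IsCutoff.deriv_eq_zero (h : IsCutoff c a b χ) {t : ℝ} (ht : t ≤ a ∨ b ≤ t) :
    deriv χ t = 0 := by
  rcases ht with ht | ht
  · exact deriv_eq_zero_of_eqOn_const (uniqueDiffOn_Iic a) ht (h.hasDerivAt t).differentiableAt
      fun y hy => h.eq_zero y (Or.inl hy)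
  · exact deriv_eq_zero_of_eqOn_const (uniqueDiffOn_Ici b) ht (h.hasDerivAt t).differentiableAt
      fun y hy => h.eq_zero y (Or.inr hy)

lemma IsCutoff.deriv_eq_zero_of_mem (h : IsCutoff c a b χ) (hab : a + 1 < b - 1) {t : ℝ}
    (ht : t ∈ Icc (a + 1) (b - 1)) : deriv χ t = 0 :=
  deriv_eq_zero_of_eqOn_const (uniqueDiffOn_Icc hab) ht (h.hasDerivAt t).differentiableAt h.eq_one

lemma IsCutoff.deriv_deriv_eq_zero_of_mem (h : IsCutoff c a b χ) (hab : a + 1 < b - 1) {t : ℝ}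
    (ht : t ∈ Icc (a + 1) (b - 1)) : deriv (deriv χ) t = 0 :=
  deriv_eq_zero_of_eqOn_const (uniqueDiffOn_Icc hab) ht (h.hasDerivAt_deriv t).differentiableAt
    fun _ hy => h.deriv_eq_zero_of_mem hab hy

end Cutoff

section WeightedIntegrals

lemma dblInt_add_adjacent {a b c : ℝ} {F : ℝ → ℝ → ℝ} (hF : Cont₂ F) :
    dblInt a b F + dblInt b c F = dblInt a c F :=
  intervalIntegral.integral_add_adjacent_intervals (hF.intervalIntegrable_integral _ _ _ _)
    (hF.intervalIntegrable_integral _ _ _ _)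

lemma cont₂_fst {φ : ℝ → ℝ} (h : Continuous φ) : Cont₂ (fun t (_ : ℝ) => φ t) :=
  h.comp continuous_fst

/-- Slicewise comparison integrates against a weight. -/
lemma dblInt_weight_le {a b c : ℝ} (hab : a ≤ b) {ω : ℝ → ℝ} (hω : Continuous ω)
    (hω0 : ∀ t, 0 ≤ ω t) {F G : ℝ → ℝ → ℝ} (hF : Cont₂ F) (hG : Cont₂ G)
    (h : ∀ t ∈ Icc a b, ∫ θ in (0 : ℝ)..(2 * π), F t θ ≤ c * ∫ θ in (0 : ℝ)..(2 * π), G t θ) :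
    dblInt a b (fun t θ => ω t * F t θ) ≤ c * dblInt a b (fun t θ => ω t * G t θ) := by
  rw [dblInt_weight, dblInt_weight, ← intervalIntegral.integral_const_mul]
  refine intervalIntegral.integral_mono_on hab
    ((hω.mul (hF.continuous_integral _ _)).intervalIntegrable _ _)
    ((continuous_const.mul (hω.mul (hG.continuous_integral _ _))).intervalIntegrable _ _)
    fun t ht => ?_
  have := mul_le_mul_of_nonneg_left (h t ht) (hω0 t)
  linarith

/-- A weight that vanishes away from the two ends only sees the ends. -/
lemma dblInt_le_ends {a b K : ℝ} (hab : a + 1 ≤ b - 1) {e : ℝ → ℝ} (he : Continuous e)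
    {g : ℝ → ℝ → ℝ} (hg : Cont₂ g) (hg0 : ∀ t θ, 0 ≤ g t θ) (heK : ∀ t, e t ≤ K)
    (h0 : ∀ t ∈ Icc (a + 1) (b - 1), e t = 0) :
    dblInt a b (fun t θ => e t * g t θ) ≤ K * (dblInt a (a + 1) g + dblInt (b - 1) b g) := by
  have hF : Cont₂ (fun t θ => e t * g t θ) := (cont₂_fst he).mul hg
  have hle : ∀ c d, c ≤ d → dblInt c d (fun t θ => e t * g t θ) ≤ K * dblInt c d g :=
    fun c d hcd => by
      rw [← dblInt_const_mul]
      exact dblInt_mono hcd hF (hg.const_mul K) fun t _ θ =>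
        mul_le_mul_of_nonneg_right (heK t) (hg0 t θ)
  have hmid : dblInt (a + 1) (b - 1) (fun t θ => e t * g t θ) ≤ 0 := by
    have := dblInt_mono hab hF ((cont₂_fst continuous_const).mul hg : Cont₂ fun t θ => 0 * g t θ)
      fun t ht θ => by rw [h0 t ht]
    simpa [dblInt] using this
  rw [← dblInt_add_adjacent (b := b - 1) hF, ← dblInt_add_adjacent (b := a + 1) hF]
  have h1 := hle a (a + 1) (by linarith)
  have h2 := hle (b - 1) b (by linarith)
  linarith

lemma sq_integral_le {g : ℝ → ℝ} (hg : Continuous g) :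
    (∫ θ in (0 : ℝ)..(2 * π), g θ) ^ 2 ≤ 2 * π * ∫ θ in (0 : ℝ)..(2 * π), g θ ^ 2 := by
  set I := ∫ θ in (0 : ℝ)..(2 * π), g θ
  have hpi := pi_pos
  have h : 0 ≤ ∫ θ in (0 : ℝ)..(2 * π), (2 * π * g θ - I) ^ 2 :=
    intervalIntegral.integral_nonneg two_pi_nonneg fun _ _ => sq_nonneg _
  have e : ∀ θ, (2 * π * g θ - I) ^ 2 = (2 * π) ^ 2 * g θ ^ 2 - (4 * π * I * g θ - I ^ 2) :=
    fun θ => by ring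
  simp only [e] at h
  rw [intervalIntegral.integral_sub (Continuous.intervalIntegrable (by fun_prop) _ _)
      (Continuous.intervalIntegrable (by fun_prop) _ _),
    intervalIntegral.integral_sub (Continuous.intervalIntegrable (by fun_prop) _ _)
      (Continuous.intervalIntegrable (by fun_prop) _ _),
    intervalIntegral.integral_const_mul, intervalIntegral.integral_const_mul,
    intervalIntegral.integral_const, smul_eq_mul, sub_zero] at h
  have h2 : 0 ≤ 2 * π * (2 * π * (∫ θ in (0 : ℝ)..(2 * π), g θ ^ 2) - I ^ 2) := by
    refine h.trans_eq ?_
    change (2 * π) ^ 2 * _ - (4 * π * I * I - 2 * π * I ^ 2) = _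
    ring
  have := nonneg_of_mul_nonneg_right h2 (by positivity)
  linarith

lemma norm_vecCoeff_le {V : Type*} [NormedAddCommGroup V] [NormedSpace ℝ V] {e : ℝ → ℝ}
    (he1 : ∀ x, |e x| ≤ 1) {F : ℝ → ℝ → V} (hF : Cont₂ F) (t : ℝ) :
    ‖vecCoeff e F t‖ ≤ ∫ θ in (0 : ℝ)..(2 * π), ‖F t θ‖ := by
  refine intervalIntegral.norm_integral_le_of_norm_le two_pi_nonneg (ae_of_all _ fun θ _ => ?_)
    ((hF.right t).norm.intervalIntegrable _ _)
  rw [norm_smul, norm_eq_abs]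
  exact mul_le_of_le_one_left (norm_nonneg _) (he1 θ)

lemma norm_vecCoeff_sq_le {V : Type*} [NormedAddCommGroup V] [NormedSpace ℝ V] {e : ℝ → ℝ}
    (he1 : ∀ x, |e x| ≤ 1) {F : ℝ → ℝ → V} (hF : Cont₂ F) (t : ℝ) :
    ‖vecCoeff e F t‖ ^ 2 ≤ 2 * π * ∫ θ in (0 : ℝ)..(2 * π), ‖F t θ‖ ^ 2 := by
  refine le_trans ?_ (sq_integral_le (hF.right t).norm)
  gcongr
  exact norm_vecCoeff_le he1 hF t

lemma continuous_vecCoeff {V : Type*} [NormedAddCommGroup V] [NormedSpace ℝ V] {e : ℝ → ℝ}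
    (he : Continuous e) {F : ℝ → ℝ → V} (hF : Cont₂ F) : Continuous (vecCoeff e F) :=
  Cont₂.continuous_integral (F := fun t θ => e θ • F t θ)
    (Continuous.smul (he.comp continuous_snd) hF) _ _

lemma hasDerivAt_vecCoeff {V : Type*} [NormedAddCommGroup V] [NormedSpace ℝ V]
    [CompleteSpace V] {e : ℝ → ℝ}
    (he : ContDiff ℝ (⊤ : ℕ∞) e) {F : ℝ → ℝ → V} (hF : Smooth₂ F) (t : ℝ) :
    HasDerivAt (vecCoeff e F) (vecCoeff e (pt F) t) t := by
  refine (((smooth₂_snd he).smul hF).hasDerivAt_integral two_pi_nonneg t).congr_deriv ?_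
  refine intervalIntegral.integral_congr fun θ _ => ?_
  exact ((hF.hasDerivAt_pt t θ).const_smul (e θ)).deriv

lemma vecCoeff_add_const_smul {V : Type*} [NormedAddCommGroup V] [NormedSpace ℝ V] {e : ℝ → ℝ}
    (he : Continuous e) {F G : ℝ → ℝ → V} (hF : Cont₂ F) (hG : Cont₂ G) (c t : ℝ) :
    vecCoeff e (fun t θ => F t θ + c • G t θ) t = vecCoeff e F t + c • vecCoeff e G t := by
  unfold vecCoeff
  have h := intervalIntegral.integral_add (μ := volume) (a := 0) (b := 2 * π)
    (f := fun θ => e θ • F t θ) (g := fun θ => c • e θ • G t θ)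
    ((he.smul (hF.right t)).intervalIntegrable _ _)
    ((continuous_const.smul (he.smul (hG.right t))).intervalIntegrable _ _)
  rw [intervalIntegral.integral_smul] at h
  refine Eq.trans ?_ h
  congr 1
  funext θ
  rw [smul_add, smul_comm]

lemma vecCoeff_weight {V : Type*} [NormedAddCommGroup V] [NormedSpace ℝ V] (e ψ : ℝ → ℝ)
    (F : ℝ → ℝ → V) (t : ℝ) : vecCoeff e (fun t θ => ψ t • F t θ) t = ψ t • vecCoeff e F t := by
  unfold vecCoeff
  rw [← intervalIntegral.integral_smul]
  congr 1
  funext θ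
  rw [smul_comm]

end WeightedIntegrals

section ReducedSystem

lemma IsCutoff.sq {c a b : ℝ} {χ : ℝ → ℝ} (h : IsCutoff c a b χ) :
    IsCutoff (2 * c ^ 2 + 2 * c) a b (fun t => χ t ^ 2) ∧
      ∀ t, deriv (fun t => χ t ^ 2) t = 2 * (χ t * deriv χ t) := by
  have e1 : deriv (fun t => χ t ^ 2) = fun t => 2 * (χ t * deriv χ t) := by
    funext t
    refine ((h.hasDerivAt t).pow 2).deriv.trans ?_
    simp [mul_assoc]
  have e2 : ∀ t, deriv (deriv (fun t => χ t ^ 2)) t =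
      2 * (deriv χ t * deriv χ t + χ t * deriv (deriv χ) t) := fun t => by
    rw [e1]
    exact (((h.hasDerivAt t).mul (h.hasDerivAt_deriv t)).const_mul 2).deriv
  have hc : 0 ≤ c := (abs_nonneg _).trans (h.deriv_le a)
  refine ⟨⟨h.smooth.pow 2, fun t => sq_nonneg _, fun t => pow_le_one₀ (h.nonneg t) (h.le_one t),
    fun t ht => by simp [h.eq_zero t ht], fun t ht => by simp [h.eq_one t ht], fun t => ?_,
    fun t => ?_⟩, fun t => by rw [e1]⟩
  · rw [e1, abs_mul, abs_mul, abs_of_nonneg (h.nonneg t), abs_two]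
    nlinarith [mul_le_of_le_one_left (abs_nonneg (deriv χ t)) (h.le_one t), h.deriv_le t]
  · rw [e2, abs_mul, abs_two]
    have h1 := abs_add_le (deriv χ t * deriv χ t) (χ t * deriv (deriv χ) t)
    rw [abs_mul, abs_mul, abs_of_nonneg (h.nonneg t)] at h1
    have h2 := mul_le_of_le_one_left (abs_nonneg (deriv (deriv χ) t)) (h.le_one t)
    have h3 := mul_le_mul (h.deriv_le t) (h.deriv_le t) (abs_nonneg _) hc
    nlinarith [h.deriv_deriv_le t]

variable {n : ℕ}

/-- A linear system `2 ΔH + ∂_t P + ∂_θ R = 0` with small coefficients on a cylinder, together with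
an exponential weight. -/
structure IsReducedSystem (m κ C₀ η a b : ℝ) (μ μ' : ℝ → ℝ)
    (H P R : ℝ → ℝ → EuclideanSpace ℝ (Fin n)) (G : ℝ → ℝ → ℝ) : Prop where
  weight : IsExpWeight m κ a b μ μ'
  smooth_weight : ContDiff ℝ (⊤ : ℕ∞) μ
  smooth_H : Smooth₂ H
  smooth_P : Smooth₂ P
  smooth_R : Smooth₂ R
  periodic_H : Periodic₂ H
  periodic_R : Periodic₂ R
  eqn : ∀ t ∈ Icc (a - 1) (b + 1), ∀ θ,
    (2 : ℝ) • (pt (pt H) t θ + pth (pth H) t θ) + pt P t θ + pth R t θ = 0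
  cont_G : Cont₂ G
  G_nonneg : ∀ t θ, 0 ≤ G t θ
  C₀_nonneg : 0 ≤ C₀
  η_nonneg : 0 ≤ η
  bound : ∀ t ∈ Icc a b, ∀ θ, ‖P t θ‖ ^ 2 + ‖R t θ‖ ^ 2 ≤ C₀ * (‖H t θ‖ ^ 2 * G t θ)
  integral_le : ∀ t ∈ Icc a b, ∫ θ in (0 : ℝ)..(2 * π), G t θ ≤ η

variable {m κ C₀ η a b c : ℝ} {μ μ' χ : ℝ → ℝ} {H P R : ℝ → ℝ → EuclideanSpace ℝ (Fin n)}
  {G : ℝ → ℝ → ℝ}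

lemma IsReducedSystem.slice_le (h : IsReducedSystem m κ C₀ η a b μ μ' H P R G) {t : ℝ}
    (ht : t ∈ Icc a b) :
    ∫ θ in (0 : ℝ)..(2 * π), (‖P t θ‖ ^ 2 + ‖R t θ‖ ^ 2) ≤
      C₀ * η * ∫ θ in (0 : ℝ)..(2 * π), (2 * ‖H t θ‖ ^ 2 + (‖pt H t θ‖ ^ 2 + ‖pth H t θ‖ ^ 2)) := by
  set S := ∫ θ in (0 : ℝ)..(2 * π), (2 * ‖H t θ‖ ^ 2 + (‖pt H t θ‖ ^ 2 + ‖pth H t θ‖ ^ 2)) with hS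
  have hS0 : 0 ≤ S := intervalIntegral.integral_nonneg two_pi_nonneg fun _ _ => by positivity
  have cH := h.smooth_H.cont₂.right t
  have cHt := h.smooth_H.dt.cont₂.right t
  have cHth := h.smooth_H.dth.cont₂.right t
  have cG := h.cont_G.right t
  have cP := h.smooth_P.cont₂.right t
  have cR := h.smooth_R.cont₂.right t
  have hsup : ∀ θ ∈ Icc (0 : ℝ) (2 * π), ‖H t θ‖ ^ 2 ≤ S := fun θ hθ => by
    have h1 := le_integral_add_abs_deriv (k := fun θ => ‖H t θ‖ ^ 2)
      (k' := fun θ => 2 * ⟪H t θ, pth H t θ⟫_ℝ)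
      (fun x => (h.smooth_H.hasDerivAt_pth t x).norm_sq) (by fun_prop) (fun x => sq_nonneg _) hθ
    refine h1.trans (intervalIntegral.integral_mono_on two_pi_nonneg
      (Continuous.intervalIntegrable (by fun_prop) _ _)
      (Continuous.intervalIntegrable (by fun_prop) _ _) fun x _ => ?_)
    have := two_mul_abs_inner_le (H t x) (pth H t x)
    rw [abs_mul, abs_two]
    nlinarith [sq_nonneg ‖pt H t x‖]
  calc ∫ θ in (0 : ℝ)..(2 * π), (‖P t θ‖ ^ 2 + ‖R t θ‖ ^ 2)
      ≤ ∫ θ in (0 : ℝ)..(2 * π), C₀ * S * G t θ := by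
        refine intervalIntegral.integral_mono_on two_pi_nonneg
          (Continuous.intervalIntegrable (by fun_prop) _ _)
          (Continuous.intervalIntegrable (by fun_prop) _ _) fun θ hθ => ?_
        have h1 := mul_le_mul_of_nonneg_right (hsup θ hθ) (h.G_nonneg t θ)
        have h2 := mul_le_mul_of_nonneg_left h1 h.C₀_nonneg
        linarith [h.bound t ht θ]
    _ = C₀ * S * ∫ θ in (0 : ℝ)..(2 * π), G t θ := intervalIntegral.integral_const_mul _ _
    _ ≤ C₀ * S * η := mul_le_mul_of_nonneg_left (h.integral_le t ht) (mul_nonneg h.C₀_nonneg hS0)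
    _ = C₀ * η * S := by ring

lemma IsExpWeight.abs_deriv_le (h : IsExpWeight m κ a b μ μ') (hm : 0 ≤ m) (hκ : κ ≤ 1) {t : ℝ}
    (ht : t ∈ Icc a b) : |μ' t| ≤ 2 * (m + 1) * μ t := by
  have h1 := _root_.abs_le.1 (h.abs_le t ht)
  have h2 := h.pos t
  have h3 : κ * μ t ≤ μ t := mul_le_of_le_one_left h2.le hκ
  exact _root_.abs_le.2 ⟨by nlinarith, by nlinarith⟩

lemma IsReducedSystem.isCutoffWeight (h : IsReducedSystem m κ C₀ η a b μ μ' H P R G)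
    (hχ : IsCutoff c a b χ) (hm : 0 ≤ m) (hκ : κ ≤ 1) :
    IsCutoffWeight a b (8 + 8 * (m + 1) ^ 2) (fun t _ => χ t ^ 2 * μ t)
      (fun t _ => (1 + c ^ 2) * μ t) := by
  have hd : ∀ t θ, pt (fun t (_ : ℝ) => χ t ^ 2 * μ t) t θ =
      2 * (χ t * deriv χ t) * μ t + χ t ^ 2 * μ' t := fun t θ => by
    rw [← hχ.sq.2 t]
    exact ((hχ.sq.1.hasDerivAt t).mul (h.weight.hasDeriv t)).deriv
  refine ⟨(smooth₂_fst ((hχ.smooth.pow 2).mul h.smooth_weight)), fun _ _ => rfl,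
    cont₂_fst (continuous_const.mul h.weight.continuous), fun θ => by simp [hχ.eq_zero a],
    fun θ => by simp [hχ.eq_zero b], fun t θ => mul_nonneg (sq_nonneg _) (h.weight.pos t).le,
    fun t θ => mul_nonneg (by positivity) (h.weight.pos t).le, by positivity, fun t ht θ => ?_,
    fun t ht θ => ?_⟩
  · rw [hd]
    have h1 := h.weight.abs_deriv_le hm hκ ht
    have h2 : μ' t ^ 2 ≤ (2 * (m + 1) * μ t) ^ 2 := by
      rw [← sq_abs]; gcongr
    have h3 : deriv χ t ^ 2 ≤ c ^ 2 := by
      rw [← sq_abs (deriv χ t)]; have := hχ.deriv_le t; gcongr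
    have h4 : χ t ^ 2 ≤ 1 := pow_le_one₀ (hχ.nonneg t) (hχ.le_one t)
    have hμ := h.weight.pos t
    have h5 : (2 * (χ t * deriv χ t) * μ t + χ t ^ 2 * μ' t) ^ 2 ≤
        χ t ^ 2 * (8 * deriv χ t ^ 2 * μ t ^ 2 + 2 * (χ t ^ 2 * μ' t ^ 2)) := by
      nlinarith [sq_nonneg (2 * (χ t * deriv χ t) * μ t - χ t ^ 2 * μ' t)]
    have h6 : 8 * deriv χ t ^ 2 * μ t ^ 2 ≤ 8 * c ^ 2 * μ t ^ 2 := by gcongr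
    have h7 : χ t ^ 2 * μ' t ^ 2 ≤ 1 * (2 * (m + 1) * μ t) ^ 2 := by gcongr
    calc _ ≤ _ := h5
      _ ≤ χ t ^ 2 * (8 * c ^ 2 * μ t ^ 2 + 2 * (1 * (2 * (m + 1) * μ t) ^ 2)) := by gcongr
      _ ≤ χ t ^ 2 * ((8 + 8 * (m + 1) ^ 2) * (1 + c ^ 2) * μ t ^ 2) := by
        gcongr
        nlinarith [mul_nonneg (sq_nonneg ((m + 1) * c)) (sq_nonneg (μ t)), sq_nonneg (μ t)]
      _ = _ := by ring
  · have : pth (fun t (_ : ℝ) => χ t ^ 2 * μ t) t θ = 0 := by simp [pth]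
    rw [this]
    have := (h.weight.pos t).le
    have : 0 ≤ (8 + 8 * (m + 1) ^ 2) * (χ t ^ 2 * μ t) * ((1 + c ^ 2) * μ t) := by positivity
    simpa using this

/-- The constant in the gradient estimate. -/
def gradConst (m c : ℝ) : ℝ := 6 * (8 + 8 * (m + 1) ^ 2) * (1 + c ^ 2)

lemma gradConst_nonneg (m c : ℝ) : 0 ≤ gradConst m c := by unfold gradConst; positivity

/-- Weighted gradient and right-hand side estimates. -/
lemma IsReducedSystem.grad_le (h : IsReducedSystem m κ C₀ η a b μ μ' H P R G) (hab : a ≤ b)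
    (hχ : IsCutoff c a b χ) (hm : 0 ≤ m) (hκ : κ ≤ 1) (hη : C₀ * η ≤ 1 / 2) :
    dblInt a b (fun t θ => χ t ^ 2 * μ t * (‖pt H t θ‖ ^ 2 + ‖pth H t θ‖ ^ 2)) ≤
        2 * (gradConst m c + 1) * dblInt a b (fun t θ => μ t * ‖H t θ‖ ^ 2) ∧
      dblInt a b (fun t θ => χ t ^ 2 * μ t * (‖P t θ‖ ^ 2 + ‖R t θ‖ ^ 2)) ≤
        C₀ * η * ((2 * gradConst m c + 4) * dblInt a b (fun t θ => μ t * ‖H t θ‖ ^ 2)) := by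
  have hω : Continuous fun t => χ t ^ 2 * μ t :=
    (hχ.smooth.continuous.pow 2).mul h.weight.continuous
  have hω0 : ∀ t, 0 ≤ χ t ^ 2 * μ t := fun t => mul_nonneg (sq_nonneg _) (h.weight.pos t).le
  have cH := h.smooth_H.cont₂.norm_sq
  have cD := h.smooth_H.dt.cont₂.norm_sq.add h.smooth_H.dth.cont₂.norm_sq
  have cP := h.smooth_P.cont₂.norm_sq.add h.smooth_R.cont₂.norm_sq
  have cω := cont₂_fst hω
  have cμ := cont₂_fst h.weight.continuous
  set E := dblInt a b (fun t θ => μ t * ‖H t θ‖ ^ 2) with hE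
  have hE0 : 0 ≤ E := dblInt_nonneg hab fun t _ θ =>
    mul_nonneg (h.weight.pos t).le (sq_nonneg _)
  have h1 := (h.isCutoffWeight hχ hm hκ).caccioppoli hab h.smooth_H h.periodic_H h.smooth_P
    h.smooth_R h.periodic_R fun t ht θ => h.eqn t ⟨by linarith [ht.1], by linarith [ht.2]⟩ θ
  have cσ : Cont₂ fun t (_ : ℝ) => (1 + c ^ 2) * μ t :=
    cont₂_fst (continuous_const.mul h.weight.continuous)
  rw [dblInt_add ((cσ.mul cH).const_mul _) (cω.mul cP)] at h1
  have e1 : dblInt a b (fun t θ => 6 * (8 + 8 * (m + 1) ^ 2) * ((1 + c ^ 2) * μ t * ‖H t θ‖ ^ 2)) =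
      gradConst m c * E := by
    rw [hE, ← dblInt_const_mul]
    congr 1
    funext t θ
    unfold gradConst
    ring
  rw [e1] at h1
  have h2 := dblInt_weight_le hab hω hω0 cP ((cH.const_mul 2).add cD) fun t ht => h.slice_le ht
  have e2 : dblInt a b (fun t θ => χ t ^ 2 * μ t *
      (2 * ‖H t θ‖ ^ 2 + (‖pt H t θ‖ ^ 2 + ‖pth H t θ‖ ^ 2))) ≤ 2 * E +
      dblInt a b (fun t θ => χ t ^ 2 * μ t * (‖pt H t θ‖ ^ 2 + ‖pth H t θ‖ ^ 2)) := by
    rw [hE, ← dblInt_const_mul, ← dblInt_add ((cμ.mul cH).const_mul 2) (cω.mul cD)]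
    refine dblInt_mono hab (cω.mul ((cH.const_mul 2).add cD))
      (((cμ.mul cH).const_mul 2).add (cω.mul cD)) fun t _ θ => ?_
    have h4 : χ t ^ 2 ≤ 1 := pow_le_one₀ (hχ.nonneg t) (hχ.le_one t)
    have h5 := mul_le_mul_of_nonneg_right h4
      (mul_nonneg (h.weight.pos t).le (sq_nonneg ‖H t θ‖))
    linarith
  set D := dblInt a b (fun t θ => χ t ^ 2 * μ t * (‖pt H t θ‖ ^ 2 + ‖pth H t θ‖ ^ 2))
  have hCη := mul_nonneg h.C₀_nonneg h.η_nonneg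
  have h3 := h2.trans (mul_le_mul_of_nonneg_left e2 hCη)
  have hD0 : 0 ≤ D := dblInt_nonneg hab fun t _ θ => mul_nonneg (hω0 t) (by positivity)
  have h4 : D ≤ 2 * (gradConst m c + 1) * E := by nlinarith
  exact ⟨h4, h3.trans (mul_le_mul_of_nonneg_left (by linarith) hCη)⟩

end ReducedSystem

section ReducedEstimate

variable {n : ℕ} {κ C₀ η a b c : ℝ} {m : ℕ} {μ μ' χ : ℝ → ℝ}
  {H P R : ℝ → ℝ → EuclideanSpace ℝ (Fin n)} {G : ℝ → ℝ → ℝ}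

lemma Smooth₂.pt_weight_smul {V : Type*} [NormedAddCommGroup V] [NormedSpace ℝ V] {ψ : ℝ → ℝ}
    (hψ : ContDiff ℝ (⊤ : ℕ∞) ψ) {F : ℝ → ℝ → V} (hF : Smooth₂ F) (t θ : ℝ) :
    pt (fun t θ => ψ t • F t θ) t θ = ψ t • pt F t θ + deriv ψ t • F t θ :=
  ((contDiff_top_differentiable hψ t).hasDerivAt.smul (hF.hasDerivAt_pt t θ)).deriv

lemma Smooth₂.pth_weight_smul {V : Type*} [NormedAddCommGroup V] [NormedSpace ℝ V] {ψ : ℝ → ℝ}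
    {F : ℝ → ℝ → V} (hF : Smooth₂ F) (t θ : ℝ) :
    pth (fun t θ => ψ t • F t θ) t θ = ψ t • pth F t θ :=
  ((hF.hasDerivAt_pth t θ).const_smul (ψ t)).deriv

lemma Smooth₂.laplace_weight_smul {V : Type*} [NormedAddCommGroup V] [NormedSpace ℝ V]
    {ψ : ℝ → ℝ} (hψ : ContDiff ℝ (⊤ : ℕ∞) ψ) {H P R : ℝ → ℝ → V} (sH : Smooth₂ H)
    (sP : Smooth₂ P) (sR : Smooth₂ R) (t θ : ℝ)
    (h : ψ t • ((2 : ℝ) • (pt (pt H) t θ + pth (pth H) t θ) + pt P t θ + pth R t θ) = 0) :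
    pt (pt fun t θ => ψ t • H t θ) t θ + pth (pth fun t θ => ψ t • H t θ) t θ =
      pt (fun t θ => (2 * deriv ψ t) • H t θ - (1 / 2 * ψ t) • P t θ) t θ +
        (pth (fun t θ => -(1 / 2 * ψ t) • R t θ) t θ +
          ((1 / 2 * deriv ψ t) • P t θ - deriv (deriv ψ) t • H t θ)) := by
  have hψ' := contDiff_top_deriv hψ
  have e1 : pt (fun t θ => ψ t • H t θ) = fun t θ => ψ t • pt H t θ + deriv ψ t • H t θ := by
    funext t θ; exact sH.pt_weight_smul hψ t θ
  have e2 : pth (fun t θ => ψ t • H t θ) = fun t θ => ψ t • pth H t θ := by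
    funext t θ; exact sH.pth_weight_smul t θ
  have e3 : pt (fun t θ => ψ t • pt H t θ + deriv ψ t • H t θ) t θ = _ :=
    (((contDiff_top_differentiable hψ t).hasDerivAt.smul (sH.dt.hasDerivAt_pt t θ)).add
      ((contDiff_top_differentiable hψ' t).hasDerivAt.smul (sH.hasDerivAt_pt t θ))).deriv
  have e4 : pt (fun t θ => (2 * deriv ψ t) • H t θ - (1 / 2 * ψ t) • P t θ) t θ = _ :=
    ((((contDiff_top_differentiable hψ' t).hasDerivAt.const_mul 2).smul
        (sH.hasDerivAt_pt t θ)).sub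
      (((contDiff_top_differentiable hψ t).hasDerivAt.const_mul (1 / 2)).smul
        (sP.hasDerivAt_pt t θ))).deriv
  have e5 : pth (fun t θ => -(1 / 2 * ψ t) • R t θ) t θ = _ :=
    ((sR.hasDerivAt_pth t θ).const_smul (-(1 / 2 * ψ t))).deriv
  have e6 : pth (fun t θ => ψ t • pth H t θ) t θ = _ := sH.dth.pth_weight_smul t θ
  rw [e1, e2, e3, e4, e5, e6]
  have h2 := congrArg (fun v => (1 / 2 : ℝ) • v) h
  simp only [smul_zero] at h2
  rw [← sub_eq_zero]
  refine Eq.trans ?_ h2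
  module

lemma norm_sub_sq_le {V : Type*} [NormedAddCommGroup V] [InnerProductSpace ℝ V] (x y : V) :
    ‖x - y‖ ^ 2 ≤ 2 * ‖x‖ ^ 2 + 2 * ‖y‖ ^ 2 := by
  have := norm_add_sq_le x (-y)
  rwa [norm_neg, ← sub_eq_add_neg] at this

/-- The commutator terms are controlled by `H` near the ends and by the right-hand side. -/
lemma IsCutoff.commutator_le (hχ : IsCutoff c a b χ) {V : Type*} [NormedAddCommGroup V]
    [InnerProductSpace ℝ V] (h p r : V) (t : ℝ) :
    ‖(2 * deriv (fun t => χ t ^ 2) t) • h - (1 / 2 * χ t ^ 2) • p‖ ^ 2 +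
        ‖-(1 / 2 * χ t ^ 2) • r‖ ^ 2 +
        ‖(1 / 2 * deriv (fun t => χ t ^ 2) t) • p -
          deriv (deriv fun t => χ t ^ 2) t • h‖ ^ 2 ≤
      (8 * deriv (fun t => χ t ^ 2) t ^ 2 + 2 * deriv (deriv fun t => χ t ^ 2) t ^ 2) * ‖h‖ ^ 2 +
        (1 + 2 * c ^ 2) * (χ t ^ 2 * (‖p‖ ^ 2 + ‖r‖ ^ 2)) := by
  have h1 := norm_sub_sq_le ((2 * deriv (fun t => χ t ^ 2) t) • h) ((1 / 2 * χ t ^ 2) • p)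
  have h2 := norm_sub_sq_le ((1 / 2 * deriv (fun t => χ t ^ 2) t) • p)
    (deriv (deriv fun t => χ t ^ 2) t • h)
  simp only [norm_smul, mul_pow, norm_eq_abs, sq_abs, neg_sq] at h1 h2 ⊢
  have h3 : (χ t ^ 2) ^ 2 ≤ χ t ^ 2 := by
    have := pow_le_one₀ (n := 2) (hχ.nonneg t) (hχ.le_one t)
    nlinarith [sq_nonneg (χ t)]
  have h4 : deriv (fun t => χ t ^ 2) t ^ 2 ≤ 4 * c ^ 2 * χ t ^ 2 := by
    rw [hχ.sq.2, mul_pow, mul_pow]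
    have : deriv χ t ^ 2 ≤ c ^ 2 := by
      rw [← sq_abs (deriv χ t)]; have := hχ.deriv_le t; gcongr
    nlinarith [sq_nonneg (χ t)]
  have h5 := mul_le_mul_of_nonneg_right h3 (sq_nonneg ‖p‖)
  have h6 := mul_le_mul_of_nonneg_right h3 (sq_nonneg ‖r‖)
  have h7 := mul_le_mul_of_nonneg_right h4 (sq_nonneg ‖p‖)
  have h8 : 0 ≤ χ t ^ 2 * ‖p‖ ^ 2 := by positivity
  have h9 : 0 ≤ χ t ^ 2 * ‖r‖ ^ 2 := by positivity
  have h10 : 0 ≤ c ^ 2 * (χ t ^ 2 * ‖r‖ ^ 2) := by positivity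
  nlinarith

/-- Weighted estimate for the localised system up to the resonant modes. -/
lemma IsReducedSystem.cutoff_estimate (h : IsReducedSystem m κ C₀ η a b μ μ' H P R G)
    (hab : a + 2 < b) (hχ : IsCutoff c a b χ) (hm : 1 ≤ m) (hκ : κ < 1) (hκ0 : 0 ≤ κ) :
    dblInt a b (fun t θ => μ t * ‖χ t ^ 2 • H t θ‖ ^ 2) ≤
      modeConst m κ * (10 * (2 * c ^ 2 + 2 * c) ^ 2 *
          (dblInt a (a + 1) (fun t θ => μ t * ‖H t θ‖ ^ 2) +
            dblInt (b - 1) b (fun t θ => μ t * ‖H t θ‖ ^ 2)) +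
        (1 + 2 * c ^ 2) * dblInt a b (fun t θ => χ t ^ 2 * μ t * (‖P t θ‖ ^ 2 + ‖R t θ‖ ^ 2))) +
      ∫ t in a..b, μ t * (‖χ t ^ 2 • vecCoeff (fun x => cos (m * x)) H t‖ ^ 2 +
        ‖χ t ^ 2 • vecCoeff (fun x => sin (m * x)) H t‖ ^ 2) := by
  have hψ := hχ.sq.1
  have sψ := smooth₂_fst hψ.smooth
  have sψ' := smooth₂_fst (contDiff_top_deriv hψ.smooth)
  have sψ'' := smooth₂_fst (contDiff_top_deriv (contDiff_top_deriv hψ.smooth))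
  have hza : ∀ θ : ℝ, χ a ^ 2 = 0 := fun _ => hψ.eq_zero a (Or.inl le_rfl)
  have hzb : ∀ θ : ℝ, χ b ^ 2 = 0 := fun _ => hψ.eq_zero b (Or.inr le_rfl)
  have hza' := hψ.deriv_eq_zero (t := a) (Or.inl le_rfl)
  have hzb' := hψ.deriv_eq_zero (t := b) (Or.inr le_rfl)
  have sp : Smooth₂ fun t θ => (2 * deriv (fun t => χ t ^ 2) t) • H t θ -
      (1 / 2 * χ t ^ 2) • P t θ :=
    ((sψ'.const_mul 2).smul h.smooth_H).sub ((sψ.const_mul (1 / 2)).smul h.smooth_P)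
  have sr : Smooth₂ fun t θ => -(1 / 2 * χ t ^ 2) • R t θ := by
    have : Smooth₂ fun t θ => (-(1 / 2) * χ t ^ 2) • R t θ :=
      (sψ.const_mul (-(1 / 2))).smul h.smooth_R
    simpa only [neg_mul] using this
  have ss : Smooth₂ fun t θ => (1 / 2 * deriv (fun t => χ t ^ 2) t) • P t θ -
      deriv (deriv fun t => χ t ^ 2) t • H t θ :=
    ((sψ'.const_mul (1 / 2)).smul h.smooth_P).sub (sψ''.smul h.smooth_H)
  have key := poisson_estimate_vec (by linarith) hm hκ hκ0 h.weight (sψ.smul h.smooth_H) sp sr ss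
    (fun t θ => by rw [h.periodic_H]) (fun t θ => by rw [h.periodic_R])
    (fun t θ => h.smooth_H.laplace_weight_smul hψ.smooth h.smooth_P h.smooth_R t θ (by
      by_cases ht : t ∈ Icc (a - 1) (b + 1)
      · rw [h.eqn t ht θ, smul_zero]
      · have h0 : χ t ^ 2 = 0 := hψ.eq_zero t (by
          by_contra! hc
          exact ht ⟨by linarith, by linarith⟩)
        simp only [h0, zero_smul]))
    (fun θ => by simp [hza θ]) (fun θ => by simp [hzb θ])
    (fun θ => by rw [h.smooth_H.pt_weight_smul hψ.smooth]; simp [hza θ, hza'])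
    (fun θ => by rw [h.smooth_H.pt_weight_smul hψ.smooth]; simp [hzb θ, hzb'])
    (fun θ => by simp [hza θ, hza']) (fun θ => by simp [hzb θ, hzb'])
  simp only [vecCoeff_weight] at key
  refine key.trans (add_le_add_left (mul_le_mul_of_nonneg_left ?_ (modeConst_nonneg _ _)) _)
  have cμ := cont₂_fst h.weight.continuous
  have cH := cμ.mul h.smooth_H.cont₂.norm_sq
  have cE : Continuous fun t => 8 * deriv (fun t => χ t ^ 2) t ^ 2 +
      2 * deriv (deriv fun t => χ t ^ 2) t ^ 2 := by
    have := (contDiff_top_deriv hψ.smooth).continuous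
    have := (contDiff_top_deriv (contDiff_top_deriv hψ.smooth)).continuous
    fun_prop
  have cω : Cont₂ fun t (_ : ℝ) => χ t ^ 2 * μ t :=
    cont₂_fst (hψ.smooth.continuous.mul h.weight.continuous)
  have cPR := cω.mul (h.smooth_P.cont₂.norm_sq.add h.smooth_R.cont₂.norm_sq)
  have hends := dblInt_le_ends (a := a) (b := b) (K := 10 * (2 * c ^ 2 + 2 * c) ^ 2)
    (by linarith) cE cH (fun t θ => mul_nonneg (h.weight.pos t).le (sq_nonneg _)) (fun t => by
      have h1 : deriv (fun t => χ t ^ 2) t ^ 2 ≤ (2 * c ^ 2 + 2 * c) ^ 2 := by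
        rw [← sq_abs (deriv _ t)]; have := hψ.deriv_le t; gcongr
      have h2 : deriv (deriv fun t => χ t ^ 2) t ^ 2 ≤ (2 * c ^ 2 + 2 * c) ^ 2 := by
        rw [← sq_abs (deriv _ t)]; have := hψ.deriv_deriv_le t; gcongr
      linarith) (fun t ht => by
      rw [hψ.deriv_eq_zero_of_mem (by linarith) ht, hψ.deriv_deriv_eq_zero_of_mem (by linarith) ht]
      ring)
  refine le_trans ?_ (add_le_add_left hends _)
  rw [← dblInt_const_mul, ← dblInt_add ((cont₂_fst cE).mul cH) (cPR.const_mul _)]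
  refine dblInt_mono (by linarith) (cμ.mul ((sp.cont₂.norm_sq.add sr.cont₂.norm_sq).add
    ss.cont₂.norm_sq)) (((cont₂_fst cE).mul cH).add (cPR.const_mul _)) fun t _ θ => ?_
  have := mul_le_mul_of_nonneg_left (hχ.commutator_le (H t θ) (P t θ) (R t θ) t)
    (h.weight.pos t).le
  linarith

/-- One resonant Fourier coefficient is controlled by the associated first-order quantity. -/
lemma IsReducedSystem.resonant_le (h : IsReducedSystem m κ C₀ η a b μ μ' H P R G)
    (hab : a ≤ b) (hχ : IsCutoff c a b χ) (hm : 1 ≤ m) (hκ : κ < 1) {e : ℝ → ℝ}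
    (he : ContDiff ℝ (⊤ : ℕ∞) e) :
    ∫ t in a..b, μ t * ‖χ t ^ 2 • vecCoeff e H t‖ ^ 2 ≤
      ∫ t in a..b, μ t * (2 * (deriv (fun t => χ t ^ 2) t ^ 2 * ‖vecCoeff e H t‖ ^ 2) +
        2 * (χ t ^ 2 *
          ‖vecCoeff e (fun t θ => pt H t θ + (m : ℝ) • H t θ) t‖ ^ 2)) := by
  have hψ := hχ.sq.1
  have hm' : (1 : ℝ) ≤ m := by exact_mod_cast hm
  have cμ := h.weight.continuous
  have cχ := hχ.smooth.continuous
  have cψ' := (contDiff_top_deriv hψ.smooth).continuous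
  have ch := continuous_vecCoeff he.continuous h.smooth_H.cont₂
  have cY : Continuous (vecCoeff e (fun t θ => pt H t θ + (m : ℝ) • H t θ)) :=
    continuous_vecCoeff he.continuous (h.smooth_H.dt.add (h.smooth_H.const_smul (m : ℝ))).cont₂
  have hγ : |(-m : ℝ) - m| - κ = 2 * m - κ := by
    rw [show (-m : ℝ) - m = -(2 * m) by ring, abs_neg, abs_of_nonneg (by linarith)]
  have h1 := energy_le hab (y := fun t => χ t ^ 2 • vecCoeff e H t)
    (F := fun t => deriv (fun t => χ t ^ 2) t • vecCoeff e H t +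
      χ t ^ 2 • vecCoeff e (fun t θ => pt H t θ + (m : ℝ) • H t θ) t) (l := -m) h.weight
    (by fun_prop) (fun t => by
      refine ((hψ.hasDerivAt t).smul
        (hasDerivAt_vecCoeff he h.smooth_H t)).congr_deriv ?_
      rw [vecCoeff_add_const_smul he.continuous h.smooth_H.dt.cont₂ h.smooth_H.cont₂]
      module)
    (by simp [hχ.eq_zero a (Or.inl le_rfl)]) (by simp [hχ.eq_zero b (Or.inr le_rfl)])
    (by rw [hγ]; linarith)
  rw [hγ] at h1
  have h0 : 0 ≤ ∫ t in a..b, μ t * ‖χ t ^ 2 • vecCoeff e H t‖ ^ 2 :=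
    intervalIntegral.integral_nonneg hab fun t _ => mul_nonneg (h.weight.pos t).le (sq_nonneg _)
  have h2 : 1 ≤ (2 * (m : ℝ) - κ) ^ 2 := by nlinarith
  refine (le_mul_of_one_le_left h0 h2).trans (h1.trans ?_)
  refine intervalIntegral.integral_mono_on hab (Continuous.intervalIntegrable (by fun_prop) _ _)
    (Continuous.intervalIntegrable (by fun_prop) _ _) fun t _ => ?_
  refine mul_le_mul_of_nonneg_left ?_ (h.weight.pos t).le
  refine (norm_add_sq_le _ _).trans ?_
  rw [norm_smul, norm_smul, mul_pow, mul_pow, norm_eq_abs, norm_eq_abs, sq_abs, sq_abs]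
  have h3 : (χ t ^ 2) ^ 2 ≤ χ t ^ 2 := by
    have := pow_le_one₀ (n := 2) (hχ.nonneg t) (hχ.le_one t)
    nlinarith [sq_nonneg (χ t)]
  have := mul_le_mul_of_nonneg_right h3
    (sq_nonneg ‖vecCoeff e (fun t θ => pt H t θ + (m : ℝ) • H t θ) t‖)
  linarith

/-- The condition controlling the resonant modes of order `m`. -/
def ResonanceBound (m : ℕ) (C₁ η a b : ℝ) (H P : ℝ → ℝ → EuclideanSpace ℝ (Fin n)) : Prop :=
  ∀ t ∈ Icc a b, ‖vecCoeff (fun x => cos (m * x)) (fun t θ => pt H t θ + (m : ℝ) • H t θ) t‖ ^ 2 +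
    ‖vecCoeff (fun x => sin (m * x)) (fun t θ => pt H t θ + (m : ℝ) • H t θ) t‖ ^ 2 ≤
      C₁ * (η * (∫ θ in (0 : ℝ)..(2 * π), (‖H t θ‖ ^ 2 + (‖pt H t θ‖ ^ 2 + ‖pth H t θ‖ ^ 2))) +
        ∫ θ in (0 : ℝ)..(2 * π), ‖P t θ‖ ^ 2)

lemma IsReducedSystem.resonance_le (h : IsReducedSystem m κ C₀ η a b μ μ' H P R G)
    (hab : a + 2 < b) (hχ : IsCutoff c a b χ) (hm : 1 ≤ m) (hκ : κ < 1) {C₁ : ℝ}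
    (hres : ResonanceBound m C₁ η a b H P) (hC₁ : 0 ≤ C₁) :
    ∫ t in a..b, μ t * (‖χ t ^ 2 • vecCoeff (fun x => cos (m * x)) H t‖ ^ 2 +
        ‖χ t ^ 2 • vecCoeff (fun x => sin (m * x)) H t‖ ^ 2) ≤
      8 * π * (2 * c ^ 2 + 2 * c) ^ 2 *
          (dblInt a (a + 1) (fun t θ => μ t * ‖H t θ‖ ^ 2) +
            dblInt (b - 1) b (fun t θ => μ t * ‖H t θ‖ ^ 2)) +
        2 * C₁ * (η * (dblInt a b (fun t θ => μ t * ‖H t θ‖ ^ 2) +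
          dblInt a b (fun t θ => χ t ^ 2 * μ t * (‖pt H t θ‖ ^ 2 + ‖pth H t θ‖ ^ 2))) +
          dblInt a b (fun t θ => χ t ^ 2 * μ t * (‖P t θ‖ ^ 2 + ‖R t θ‖ ^ 2))) := by
  have hψ := hχ.sq.1
  have hab' : a ≤ b := by linarith
  have cos_smooth : ContDiff ℝ (⊤ : ℕ∞) fun x : ℝ => cos (m * x) := by fun_prop
  have sin_smooth : ContDiff ℝ (⊤ : ℕ∞) fun x : ℝ => sin (m * x) := by fun_prop
  have cμ := h.weight.continuous
  have cχ := hχ.smooth.continuous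
  have cψ' := (contDiff_top_deriv hψ.smooth).continuous
  have chc := continuous_vecCoeff cos_smooth.continuous h.smooth_H.cont₂
  have chs := continuous_vecCoeff sin_smooth.continuous h.smooth_H.cont₂
  have sY : Smooth₂ fun t θ => pt H t θ + (m : ℝ) • H t θ :=
    h.smooth_H.dt.add (h.smooth_H.const_smul (m : ℝ))
  have cYc := continuous_vecCoeff cos_smooth.continuous sY.cont₂
  have cYs := continuous_vecCoeff sin_smooth.continuous sY.cont₂
  have cH := h.smooth_H.cont₂.norm_sq
  have cD := h.smooth_H.dt.cont₂.norm_sq.add h.smooth_H.dth.cont₂.norm_sq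
  have cP := h.smooth_P.cont₂.norm_sq
  have cPR := cP.add h.smooth_R.cont₂.norm_sq
  have cω : Cont₂ fun t (_ : ℝ) => χ t ^ 2 * μ t := cont₂_fst (by fun_prop)
  have cμ₂ := cont₂_fst cμ
  have h1 : ∫ t in a..b, μ t * (‖χ t ^ 2 • vecCoeff (fun x => cos (m * x)) H t‖ ^ 2 +
      ‖χ t ^ 2 • vecCoeff (fun x => sin (m * x)) H t‖ ^ 2) ≤
      ∫ t in a..b, (8 * π * (deriv (fun t => χ t ^ 2) t ^ 2 * (μ t *
          ∫ θ in (0 : ℝ)..(2 * π), ‖H t θ‖ ^ 2)) +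
        2 * C₁ * (η * (χ t ^ 2 * μ t * ∫ θ in (0 : ℝ)..(2 * π),
          (‖H t θ‖ ^ 2 + (‖pt H t θ‖ ^ 2 + ‖pth H t θ‖ ^ 2))) +
          χ t ^ 2 * μ t * ∫ θ in (0 : ℝ)..(2 * π), ‖P t θ‖ ^ 2)) := by
    have hc := h.resonant_le hab' hχ hm hκ cos_smooth
    have hs := h.resonant_le hab' hχ hm hκ sin_smooth
    simp only [mul_add] at hc hs ⊢
    have i1 := intervalIntegral.integral_add (μ := volume) (a := a) (b := b)
      (f := fun t => μ t * ‖χ t ^ 2 • vecCoeff (fun x => cos (m * x)) H t‖ ^ 2)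
      (g := fun t => μ t * ‖χ t ^ 2 • vecCoeff (fun x => sin (m * x)) H t‖ ^ 2)
      (Continuous.intervalIntegrable (by fun_prop) _ _)
      (Continuous.intervalIntegrable (by fun_prop) _ _)
    rw [i1]
    refine (add_le_add hc hs).trans ?_
    rw [← intervalIntegral.integral_add (Continuous.intervalIntegrable (by fun_prop) _ _)
      (Continuous.intervalIntegrable (by fun_prop) _ _)]
    have c1 := cH.continuous_integral 0 (2 * π)
    have c2 : Continuous fun t => ∫ θ in (0 : ℝ)..(2 * π),
      (‖H t θ‖ ^ 2 + (‖pt H t θ‖ ^ 2 + ‖pth H t θ‖ ^ 2)) :=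
        (cH.add cD).continuous_integral 0 (2 * π)
    have c3 := cP.continuous_integral 0 (2 * π)
    refine intervalIntegral.integral_mono_on hab' (Continuous.intervalIntegrable (by fun_prop) _ _)
      (Continuous.intervalIntegrable (by fun_prop) _ _) fun t ht => ?_
    have k1 := norm_vecCoeff_sq_le (e := fun x => cos (m * x)) (fun x => abs_cos_le_one _)
      h.smooth_H.cont₂ t
    have k2 := norm_vecCoeff_sq_le (e := fun x => sin (m * x)) (fun x => abs_sin_le_one _)
      h.smooth_H.cont₂ t
    have k3 := mul_le_mul_of_nonneg_left (hres t ht)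
      (mul_nonneg (sq_nonneg (χ t)) (h.weight.pos t).le)
    have k4 := mul_le_mul_of_nonneg_left (add_le_add k1 k2)
      (mul_nonneg (sq_nonneg (deriv (fun t => χ t ^ 2) t)) (h.weight.pos t).le)
    linarith
  refine h1.trans ?_
  have e1 : dblInt a b (fun t θ => deriv (fun t => χ t ^ 2) t ^ 2 * (μ t * ‖H t θ‖ ^ 2)) =
      ∫ t in a..b, deriv (fun t => χ t ^ 2) t ^ 2 * (μ t *
          ∫ θ in (0 : ℝ)..(2 * π), ‖H t θ‖ ^ 2) := by
    simp only [dblInt, intervalIntegral.integral_const_mul]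
  have e2 : dblInt a b (fun t θ => χ t ^ 2 * μ t *
        (‖H t θ‖ ^ 2 + (‖pt H t θ‖ ^ 2 + ‖pth H t θ‖ ^ 2))) =
      ∫ t in a..b, χ t ^ 2 * μ t * ∫ θ in (0 : ℝ)..(2 * π),
          (‖H t θ‖ ^ 2 + (‖pt H t θ‖ ^ 2 + ‖pth H t θ‖ ^ 2)) :=
    dblInt_weight _ _
  have e3 : dblInt a b (fun t θ => χ t ^ 2 * μ t * ‖P t θ‖ ^ 2) =
      ∫ t in a..b, χ t ^ 2 * μ t * ∫ θ in (0 : ℝ)..(2 * π), ‖P t θ‖ ^ 2 :=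
    dblInt_weight _ _
  have c1 := cH.continuous_integral 0 (2 * π)
  have c2 : Continuous fun t => ∫ θ in (0 : ℝ)..(2 * π),
    (‖H t θ‖ ^ 2 + (‖pt H t θ‖ ^ 2 + ‖pth H t θ‖ ^ 2)) :=
      (cH.add cD).continuous_integral 0 (2 * π)
  have c3 := cP.continuous_integral 0 (2 * π)
  rw [intervalIntegral.integral_add (Continuous.intervalIntegrable (by fun_prop) _ _)
      (Continuous.intervalIntegrable (by fun_prop) _ _), intervalIntegral.integral_const_mul,
    intervalIntegral.integral_const_mul,
    intervalIntegral.integral_add (Continuous.intervalIntegrable (by fun_prop) _ _)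
      (Continuous.intervalIntegrable (by fun_prop) _ _), intervalIntegral.integral_const_mul,
    ← e1, ← e2, ← e3]
  have hends := dblInt_le_ends (a := a) (b := b) (K := (2 * c ^ 2 + 2 * c) ^ 2)
    (e := fun t => deriv (fun t => χ t ^ 2) t ^ 2) (by linarith) (by fun_prop) (cμ₂.mul cH)
    (fun t θ => mul_nonneg (h.weight.pos t).le (sq_nonneg _)) (fun t => by
      rw [← sq_abs (deriv _ t)]; have := hψ.deriv_le t; gcongr) (fun t ht => by
      rw [hψ.deriv_eq_zero_of_mem (by linarith) ht]; ring)
  have l2 : dblInt a b (fun t θ => χ t ^ 2 * μ t *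
        (‖H t θ‖ ^ 2 + (‖pt H t θ‖ ^ 2 + ‖pth H t θ‖ ^ 2))) ≤
      dblInt a b (fun t θ => μ t * ‖H t θ‖ ^ 2) +
          dblInt a b (fun t θ => χ t ^ 2 * μ t * (‖pt H t θ‖ ^ 2 + ‖pth H t θ‖ ^ 2)) := by
    rw [← dblInt_add (cμ₂.mul cH) (cω.mul cD)]
    refine dblInt_mono hab' (cω.mul (cH.add cD)) ((cμ₂.mul cH).add (cω.mul cD)) fun t _ θ => ?_
    have h4 : χ t ^ 2 ≤ 1 := pow_le_one₀ (hχ.nonneg t) (hχ.le_one t)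
    have h5 := mul_le_mul_of_nonneg_right h4
      (mul_nonneg (h.weight.pos t).le (sq_nonneg ‖H t θ‖))
    linarith
  have l3 : dblInt a b (fun t θ => χ t ^ 2 * μ t * ‖P t θ‖ ^ 2) ≤
      dblInt a b (fun t θ => χ t ^ 2 * μ t * (‖P t θ‖ ^ 2 + ‖R t θ‖ ^ 2)) :=
    dblInt_mono hab' (cω.mul cP) (cω.mul cPR) fun t _ θ =>
      mul_le_mul_of_nonneg_left (le_add_of_nonneg_right (sq_nonneg _))
        (mul_nonneg (sq_nonneg _) (h.weight.pos t).le)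
  have l4 := mul_le_mul_of_nonneg_left l2 h.η_nonneg
  have l5 := mul_le_mul_of_nonneg_left (add_le_add l4 l3) (by linarith : 0 ≤ 2 * C₁)
  have l6 := mul_le_mul_of_nonneg_left hends (by positivity : (0 : ℝ) ≤ 8 * π)
  linarith

/-- A solution of a reduced system satisfying the resonance bound is controlled by its values at
the two ends of the cylinder. -/
theorem IsReducedSystem.exists_le_ends (n m : ℕ) (hm : 1 ≤ m) {κ : ℝ} (hκ : κ < 1) (hκ0 : 0 ≤ κ)
    {C₀ C₁ : ℝ} (hC₀ : 0 ≤ C₀) (hC₁ : 0 ≤ C₁) :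
    ∃ C > 0, ∃ η₀ > 0, ∀ {η a b : ℝ} {μ μ' : ℝ → ℝ} {H P R : ℝ → ℝ → EuclideanSpace ℝ (Fin n)}
      {G : ℝ → ℝ → ℝ}, IsReducedSystem m κ C₀ η a b μ μ' H P R G → a + 2 < b → η ≤ η₀ →
      ResonanceBound m C₁ η a b H P →
      dblInt a b (fun t θ => μ t * ‖H t θ‖ ^ 2) ≤
        C * (dblInt a (a + 1) (fun t θ => μ t * ‖H t θ‖ ^ 2) +
            dblInt (b - 1) b (fun t θ => μ t * ‖H t θ‖ ^ 2)) := by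
  obtain ⟨c, hc, hcut⟩ := exists_isCutoff
  set K := modeConst m κ with hK
  have hK0 : 0 ≤ K := modeConst_nonneg _ _
  set g := gradConst m c with hg
  have hg0 : 0 ≤ g := gradConst_nonneg _ _
  set d := (2 * c ^ 2 + 2 * c) ^ 2 with hd
  have hd0 : 0 ≤ d := sq_nonneg _
  set B := K * ((1 + 2 * c ^ 2) * (C₀ * (2 * g + 4))) +
    2 * C₁ * ((2 * g + 3) + C₀ * (2 * g + 4)) with hB
  have hB0 : 0 ≤ B := by positivity
  have hpi := pi_pos
  refine ⟨2 * (1 + K * (10 * d) + 8 * π * d), by positivity, 1 / (2 * (B + C₀ + 1)), by positivity,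
    fun {η a b μ μ' H P R G} h hab hη hres => ?_⟩
  obtain ⟨χ, hχ⟩ := hcut a b
  have hη0 := h.η_nonneg
  rw [le_div_iff₀ (by positivity)] at hη
  have hBη : η * B ≤ 1 / 2 := by nlinarith [mul_nonneg hη0 hC₀]
  have hCη : C₀ * η ≤ 1 / 2 := by nlinarith [mul_nonneg hη0 hB0]
  have h1 := h.cutoff_estimate hab hχ hm hκ hκ0
  have h2 := h.resonance_le hab hχ hm hκ hres hC₁
  obtain ⟨h3, h4⟩ := h.grad_le (by linarith) hχ (Nat.cast_nonneg m) hκ.le hCη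
  have cμ := cont₂_fst h.weight.continuous
  have cH := cμ.mul h.smooth_H.cont₂.norm_sq
  have cχ := hχ.smooth.continuous
  have hψ := hχ.sq.1
  have h5 := dblInt_le_ends (a := a) (b := b) (K := 1) (e := fun t => 1 - (χ t ^ 2) ^ 2)
    (by linarith) (by fun_prop) cH (fun t θ => mul_nonneg (h.weight.pos t).le (sq_nonneg _))
    (fun t => by nlinarith [sq_nonneg (χ t ^ 2)]) (fun t ht => by
      rw [hψ.eq_one t ht]; ring)
  have h6 : dblInt a b (fun t θ => μ t * ‖H t θ‖ ^ 2) =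
      dblInt a b (fun t θ => (1 - (χ t ^ 2) ^ 2) * (μ t * ‖H t θ‖ ^ 2)) +
        dblInt a b (fun t θ => μ t * ‖χ t ^ 2 • H t θ‖ ^ 2) := by
    have c1 : Cont₂ fun t θ => (1 - (χ t ^ 2) ^ 2) * (μ t * ‖H t θ‖ ^ 2) :=
      (cont₂_fst (by fun_prop)).mul cH
    have c2 : Cont₂ fun t θ => μ t * ‖χ t ^ 2 • H t θ‖ ^ 2 :=
      cμ.mul ((smooth₂_fst hψ.smooth).smul h.smooth_H).cont₂.norm_sq
    rw [← dblInt_add c1 c2]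
    congr 1
    funext t θ
    rw [norm_smul, mul_pow, norm_eq_abs, sq_abs]
    ring
  set E := dblInt a b (fun t θ => μ t * ‖H t θ‖ ^ 2)
  set Z := dblInt a (a + 1) (fun t θ => μ t * ‖H t θ‖ ^ 2) +
            dblInt (b - 1) b (fun t θ => μ t * ‖H t θ‖ ^ 2)
  set PR := dblInt a b (fun t θ => χ t ^ 2 * μ t * (‖P t θ‖ ^ 2 + ‖R t θ‖ ^ 2))
  set D := dblInt a b (fun t θ => χ t ^ 2 * μ t * (‖pt H t θ‖ ^ 2 + ‖pth H t θ‖ ^ 2))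
  have hE0 : 0 ≤ E := dblInt_nonneg (by linarith) fun t _ θ =>
    mul_nonneg (h.weight.pos t).le (sq_nonneg _)
  have h7 : K * ((1 + 2 * c ^ 2) * PR) ≤
      K * ((1 + 2 * c ^ 2) * (C₀ * η * ((2 * g + 4) * E))) := by gcongr
  have h8 : 2 * C₁ * (η * (E + D) + PR) ≤
      2 * C₁ * (η * (E + 2 * (g + 1) * E) + C₀ * η * ((2 * g + 4) * E)) := by gcongr
  have h9 : η * B * E ≤ 1 / 2 * E := mul_le_mul_of_nonneg_right hBη hE0
  have h10 : K * ((1 + 2 * c ^ 2) * (C₀ * η * ((2 * g + 4) * E))) +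
      2 * C₁ * (η * (E + 2 * (g + 1) * E) + C₀ * η * ((2 * g + 4) * E)) = η * B * E := by
    rw [hB]; ring
  linarith

end ReducedEstimate

section ResonantSlice

lemma integral_mul_sq_le {g k : ℝ → ℝ} (hg : Continuous g) (hk : Continuous k) {a b : ℝ}
    (hab : a ≤ b) :
    (∫ θ in a..b, g θ * k θ) ^ 2 ≤ (∫ θ in a..b, g θ ^ 2) * ∫ θ in a..b, k θ ^ 2 := by
  have h : ∀ x : ℝ, 0 ≤ (∫ θ in a..b, g θ ^ 2) * (x * x) + (2 * ∫ θ in a..b, g θ * k θ) * x +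
      ∫ θ in a..b, k θ ^ 2 := fun x => by
    have h0 : 0 ≤ ∫ θ in a..b, (x * g θ + k θ) ^ 2 :=
      intervalIntegral.integral_nonneg hab fun _ _ => sq_nonneg _
    have e : ∀ θ, (x * g θ + k θ) ^ 2 = (x * x * g θ ^ 2 + 2 * x * (g θ * k θ)) + k θ ^ 2 :=
      fun θ => by ring
    simp only [e] at h0
    rw [intervalIntegral.integral_add (Continuous.intervalIntegrable (by fun_prop) _ _)
        (Continuous.intervalIntegrable (by fun_prop) _ _),
      intervalIntegral.integral_add (Continuous.intervalIntegrable (by fun_prop) _ _)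
        (Continuous.intervalIntegrable (by fun_prop) _ _),
      intervalIntegral.integral_const_mul, intervalIntegral.integral_const_mul] at h0
    linarith
  have := discrim_le_zero h
  rw [discrim] at this
  linarith

variable {V : Type*} [NormedAddCommGroup V] [InnerProductSpace ℝ V]

lemma norm_sub_le_integral [CompleteSpace V] {e e' : ℝ → V} {k : ℝ → ℝ}
    (he : ∀ θ, HasDerivAt e (e' θ) θ) (he' : Continuous e') (hk : Continuous k)
    (hle : ∀ θ, ‖e' θ‖ ≤ k θ) {θ : ℝ} (hθ : θ ∈ Icc 0 (2 * π)) :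
    ‖e θ - e 0‖ ≤ ∫ x in (0 : ℝ)..(2 * π), k x := by
  rw [← intervalIntegral.integral_eq_sub_of_hasDerivAt (fun x _ => he x)
    (he'.intervalIntegrable _ _)]
  refine (intervalIntegral.norm_integral_le_of_norm_le hθ.1 (ae_of_all _ fun x _ => hle x)
    (hk.intervalIntegrable _ _)).trans ?_
  exact intervalIntegral.integral_mono_interval le_rfl hθ.1 hθ.2
    (ae_of_all _ fun x => (norm_nonneg _).trans (hle x)) (hk.intervalIntegrable _ _)

lemma integral_inner_const [CompleteSpace V] {g : ℝ → V} (hg : Continuous g) (w : V) (a b : ℝ) :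
    ∫ θ in a..b, ⟪g θ, w⟫_ℝ = ⟪∫ θ in a..b, g θ, w⟫_ℝ := by
  have := (innerSL ℝ w).intervalIntegral_comp_comm (hg.intervalIntegrable (μ := volume) a b)
  simp only [innerSL_apply_apply] at this
  rw [real_inner_comm, ← this]
  congr 1
  funext θ
  rw [real_inner_comm]

lemma norm_cos_smul_add_sin_smul_le (x y : V) (α : ℝ) :
    ‖cos α • x + sin α • y‖ ≤ ‖x‖ + ‖y‖ := by
  refine (norm_add_le _ _).trans ?_
  rw [norm_smul, norm_smul]
  exact add_le_add (mul_le_of_le_one_left (norm_nonneg _) (abs_cos_le_one _))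
    (mul_le_of_le_one_left (norm_nonneg _) (abs_sin_le_one _))

/-- The infinitesimal rotation in the plane spanned by `x` and `y`. -/
def wedge (x y : V) : V →L[ℝ] V :=
  (innerSL ℝ y).smulRight x - (innerSL ℝ x).smulRight y

lemma wedge_apply (x y w : V) : wedge x y w = ⟪y, w⟫_ℝ • x - ⟪x, w⟫_ℝ • y := by
  simp [wedge]

lemma norm_wedge_apply_le (x y w : V) : ‖wedge x y w‖ ≤ 2 * ‖x‖ * ‖y‖ * ‖w‖ := by
  rw [wedge_apply]
  refine (norm_sub_le _ _).trans ?_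
  rw [norm_smul, norm_smul, norm_eq_abs, norm_eq_abs]
  have h1 := mul_le_mul_of_nonneg_right (abs_real_inner_le_norm y w) (norm_nonneg x)
  have h2 := mul_le_mul_of_nonneg_right (abs_real_inner_le_norm x w) (norm_nonneg y)
  linarith

/-- The data on one circle `{t} × S¹`: position `F`, tangent vectors `X`, `Z`, mean curvature `h`
with `t`-derivative `h'`, the flux `P`, and the deviations `β₁`, `β₂`, `β₃` from a flat cover. -/
structure IsResonantSlice (m η U : ℝ) (F X Z h h' P β₁ β₂ β₃ : ℝ → V) : Prop where
  cont_h : Continuous h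
  cont_h' : Continuous h'
  cont_P : Continuous P
  cont_β₁ : Continuous β₁
  cont_β₂ : Continuous β₂
  cont_β₃ : Continuous β₃
  one_le_m : 1 ≤ m
  η_nonneg : 0 ≤ η
  η_le : 4 * π * η ≤ 1
  U_pos : 0 < U
  hasDeriv_F : ∀ θ, HasDerivAt F (Z θ) θ
  hasDeriv_X : ∀ θ, HasDerivAt X (β₂ θ - m • Z θ) θ
  hasDeriv_Z : ∀ θ, HasDerivAt Z (β₃ θ + m • X θ) θ
  norm_X : ‖X 0‖ = U
  norm_Z : ‖Z 0‖ = U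
  orth : ⟪X 0, Z 0⟫_ℝ = 0
  inner_X : ∀ θ, ⟪h' θ + m • h θ, X θ⟫_ℝ = -⟪h θ, β₁ θ⟫_ℝ
  inner_Z : ∀ θ, ⟪h' θ + m • h θ, Z θ⟫_ℝ = -⟪h θ, β₂ θ⟫_ℝ
  integral_le : ∫ θ in (0 : ℝ)..(2 * π), (‖β₁ θ‖ ^ 2 + ‖β₂ θ‖ ^ 2 + ‖β₃ θ‖ ^ 2) ≤ η * U ^ 2
  flux : ∫ θ in (0 : ℝ)..(2 * π), ((2 : ℝ) • h' θ + P θ) = 0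
  torque : ∀ x y, ∫ θ in (0 : ℝ)..(2 * π), (2 * ⟪h θ, wedge x y (X θ)⟫_ℝ -
    ⟪(2 : ℝ) • h' θ + P θ, wedge x y (F θ)⟫_ℝ) = 0

namespace IsResonantSlice

variable {m η U : ℝ} {F X Z h h' P β₁ β₂ β₃ : ℝ → V}

lemma cont_X (H : IsResonantSlice m η U F X Z h h' P β₁ β₂ β₃) : Continuous X :=
  continuous_iff_continuousAt.2 fun t => (H.hasDeriv_X t).continuousAt

lemma cont_Z (H : IsResonantSlice m η U F X Z h h' P β₁ β₂ β₃) : Continuous Z :=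
  continuous_iff_continuousAt.2 fun t => (H.hasDeriv_Z t).continuousAt

lemma cont_F (H : IsResonantSlice m η U F X Z h h' P β₁ β₂ β₃) : Continuous F :=
  continuous_iff_continuousAt.2 fun t => (H.hasDeriv_F t).continuousAt

lemma integral_norm_le (H : IsResonantSlice m η U F X Z h h' P β₁ β₂ β₃) :
    ∫ θ in (0 : ℝ)..(2 * π), (‖β₂ θ‖ + ‖β₃ θ‖) ≤ U * √(4 * π * η) := by
  have c2 := H.cont_β₂
  have c3 := H.cont_β₃
  have c1 := H.cont_β₁
  have h1 := sq_integral_le (g := fun θ => ‖β₂ θ‖ + ‖β₃ θ‖) (by fun_prop)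
  have h2 : ∫ θ in (0 : ℝ)..(2 * π), (‖β₂ θ‖ + ‖β₃ θ‖) ^ 2 ≤
      ∫ θ in (0 : ℝ)..(2 * π), 2 * (‖β₁ θ‖ ^ 2 + ‖β₂ θ‖ ^ 2 + ‖β₃ θ‖ ^ 2) :=
    intervalIntegral.integral_mono_on two_pi_nonneg
      (Continuous.intervalIntegrable (by fun_prop) _ _)
      (Continuous.intervalIntegrable (by fun_prop) _ _) fun θ _ => by
        nlinarith [sq_nonneg (‖β₂ θ‖ - ‖β₃ θ‖), sq_nonneg ‖β₁ θ‖]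
  rw [intervalIntegral.integral_const_mul] at h2
  have h3 := H.integral_le
  have hη := H.η_nonneg
  have hpi := pi_pos
  refine abs_le_of_sq_le_sq' ?_ (mul_nonneg H.U_pos.le (sqrt_nonneg _)) |>.2
  rw [mul_pow, sq_sqrt (by positivity)]
  nlinarith

variable [CompleteSpace V]

lemma rotated_X_sub_le (H : IsResonantSlice m η U F X Z h h' P β₁ β₂ β₃) {θ : ℝ}
    (hθ : θ ∈ Icc 0 (2 * π)) :
    ‖cos (m * θ) • X θ + sin (m * θ) • Z θ - X 0‖ ≤ U * √(4 * π * η) := by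
  have c2 := H.cont_β₂
  have c3 := H.cont_β₃
  refine le_trans ?_ H.integral_norm_le
  have hd : ∀ θ, HasDerivAt (fun θ => cos (m * θ) • X θ + sin (m * θ) • Z θ)
      (cos (m * θ) • β₂ θ + sin (m * θ) • β₃ θ) θ := fun θ => by
    have hm : HasDerivAt (fun θ => m * θ) m θ := by simpa using (hasDerivAt_id θ).const_mul m
    refine ((hm.cos.smul (H.hasDeriv_X θ)).add (hm.sin.smul (H.hasDeriv_Z θ))).congr_deriv ?_
    module
  have := norm_sub_le_integral hd (by fun_prop) (k := fun θ => ‖β₂ θ‖ + ‖β₃ θ‖) (by fun_prop)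
    (fun θ => (norm_add_le _ _).trans (by
      rw [norm_smul, norm_smul]
      exact add_le_add (mul_le_of_le_one_left (norm_nonneg _) (abs_cos_le_one _))
        (mul_le_of_le_one_left (norm_nonneg _) (abs_sin_le_one _)))) hθ
  simpa using this

lemma rotated_Z_add_le (H : IsResonantSlice m η U F X Z h h' P β₁ β₂ β₃) {θ : ℝ}
    (hθ : θ ∈ Icc 0 (2 * π)) :
    ‖sin (m * θ) • X θ - cos (m * θ) • Z θ + Z 0‖ ≤ U * √(4 * π * η) := by
  have c2 := H.cont_β₂
  have c3 := H.cont_β₃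
  refine le_trans ?_ H.integral_norm_le
  have hd : ∀ θ, HasDerivAt (fun θ => sin (m * θ) • X θ - cos (m * θ) • Z θ)
      (sin (m * θ) • β₂ θ - cos (m * θ) • β₃ θ) θ := fun θ => by
    have hm : HasDerivAt (fun θ => m * θ) m θ := by simpa using (hasDerivAt_id θ).const_mul m
    refine ((hm.sin.smul (H.hasDeriv_X θ)).sub (hm.cos.smul (H.hasDeriv_Z θ))).congr_deriv ?_
    module
  have := norm_sub_le_integral hd (by fun_prop) (k := fun θ => ‖β₂ θ‖ + ‖β₃ θ‖) (by fun_prop)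
    (fun θ => (norm_sub_le _ _).trans (by
      rw [norm_smul, norm_smul]
      exact add_le_add (mul_le_of_le_one_left (norm_nonneg _) (abs_sin_le_one _))
        (mul_le_of_le_one_left (norm_nonneg _) (abs_cos_le_one _)))) hθ
  simpa using this

lemma X_sub_le (H : IsResonantSlice m η U F X Z h h' P β₁ β₂ β₃) {θ : ℝ}
    (hθ : θ ∈ Icc 0 (2 * π)) :
    ‖X θ - (cos (m * θ) • X 0 - sin (m * θ) • Z 0)‖ ≤ 2 * (U * √(4 * π * η)) := by
  have h1 := norm_cos_smul_add_sin_smul_le (cos (m * θ) • X θ + sin (m * θ) • Z θ - X 0)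
    (sin (m * θ) • X θ - cos (m * θ) • Z θ + Z 0) (m * θ)
  have h2 := H.rotated_X_sub_le hθ
  have h3 := H.rotated_Z_add_le hθ
  have h4 : X θ = (cos (m * θ) ^ 2 + sin (m * θ) ^ 2) • X θ := by
    rw [cos_sq_add_sin_sq, one_smul]
  have e : cos (m * θ) • (cos (m * θ) • X θ + sin (m * θ) • Z θ - X 0) +
      sin (m * θ) • (sin (m * θ) • X θ - cos (m * θ) • Z θ + Z 0) =
      X θ - (cos (m * θ) • X 0 - sin (m * θ) • Z 0) := by
    rw [h4]
    have h5 : cos (m * θ) ^ 2 + sin (m * θ) ^ 2 = 1 := cos_sq_add_sin_sq _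
    match_scalars <;> simp <;> nlinarith
  rw [e] at h1
  linarith

lemma Z_sub_le (H : IsResonantSlice m η U F X Z h h' P β₁ β₂ β₃) {θ : ℝ}
    (hθ : θ ∈ Icc 0 (2 * π)) :
    ‖Z θ - (sin (m * θ) • X 0 + cos (m * θ) • Z 0)‖ ≤ 2 * (U * √(4 * π * η)) := by
  have h1 := norm_cos_smul_add_sin_smul_le (-(sin (m * θ) • X θ - cos (m * θ) • Z θ + Z 0))
    (cos (m * θ) • X θ + sin (m * θ) • Z θ - X 0) (m * θ)
  have h2 := H.rotated_X_sub_le hθ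
  have h3 := H.rotated_Z_add_le hθ
  have h4 : Z θ = (cos (m * θ) ^ 2 + sin (m * θ) ^ 2) • Z θ := by
    rw [cos_sq_add_sin_sq, one_smul]
  have e : cos (m * θ) • -(sin (m * θ) • X θ - cos (m * θ) • Z θ + Z 0) +
      sin (m * θ) • (cos (m * θ) • X θ + sin (m * θ) • Z θ - X 0) =
      Z θ - (sin (m * θ) • X 0 + cos (m * θ) • Z 0) := by
    rw [h4]
    have h5 : cos (m * θ) ^ 2 + sin (m * θ) ^ 2 = 1 := cos_sq_add_sin_sq _
    match_scalars <;> simp <;> nlinarith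
  rw [e, norm_neg] at h1
  linarith

lemma F_sub_le (H : IsResonantSlice m η U F X Z h h' P β₁ β₂ β₃) {θ : ℝ}
    (hθ : θ ∈ Icc 0 (2 * π)) :
    ‖F θ - (F 0 + (1 / m) • X 0) + (1 / m) • (cos (m * θ) • X 0 - sin (m * θ) • Z 0)‖ ≤
      4 * π * (U * √(4 * π * η)) := by
  have hm := H.one_le_m
  have hm0 : m ≠ 0 := by positivity
  have cZ := H.cont_Z
  have hd : ∀ θ, HasDerivAt (fun θ => F θ - (F 0 + (1 / m) • X 0) +
      (1 / m) • (cos (m * θ) • X 0 - sin (m * θ) • Z 0))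
      (Z θ - (sin (m * θ) • X 0 + cos (m * θ) • Z 0)) θ := fun θ => by
    have hm1 : HasDerivAt (fun θ => m * θ) m θ := by simpa using (hasDerivAt_id θ).const_mul m
    refine (((H.hasDeriv_F θ).sub_const _).add (((hm1.cos.smul_const (X 0)).sub
      (hm1.sin.smul_const (Z 0))).const_smul (1 / m))).congr_deriv ?_
    rw [smul_sub, smul_smul, smul_smul,
      show 1 / m * (-sin (m * θ) * m) = -sin (m * θ) by field_simp,
      show 1 / m * (cos (m * θ) * m) = cos (m * θ) by field_simp]
    module
  have h1 := intervalIntegral.integral_eq_sub_of_hasDerivAt (a := 0) (b := θ) (fun x _ => hd x)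
    (Continuous.intervalIntegrable (by fun_prop) _ _)
  have e0 : F 0 - (F 0 + (1 / m) • X 0) +
      (1 / m) • (cos (m * 0) • X 0 - sin (m * 0) • Z 0) = 0 := by
    simp
  rw [e0, sub_zero] at h1
  rw [← h1]
  have h2 := intervalIntegral.norm_integral_le_of_norm_le_const (a := 0) (b := θ)
    (f := fun θ => Z θ - (sin (m * θ) • X 0 + cos (m * θ) • Z 0)) (C := 2 * (U * √(4 * π * η)))
    fun x hx => by
      rw [uIoc_of_le hθ.1] at hx
      exact H.Z_sub_le ⟨hx.1.le, hx.2.trans hθ.2⟩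
  refine h2.trans ?_
  rw [sub_zero, abs_of_nonneg hθ.1]
  have : 0 ≤ U * √(4 * π * η) := mul_nonneg H.U_pos.le (sqrt_nonneg _)
  nlinarith [hθ.2]

end IsResonantSlice

end ResonantSlice

section ResonanceFromTorque

variable {V : Type*} [NormedAddCommGroup V] [InnerProductSpace ℝ V]

lemma coeff_algebra {a b x z : V} {U δ₁ d : ℝ} (hU : 0 < U) (hx : ‖x‖ = U) (hz : ‖z‖ = U)
    (hxz : ⟪x, z⟫_ℝ = 0)
    (h1 : ⟪a, wedge a x x⟫_ℝ - ⟪b, wedge a x z⟫_ℝ ≤ 2 * ‖a‖ * ‖x‖ * U * δ₁)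
    (h2 : -(⟪a, wedge b z x⟫_ℝ - ⟪b, wedge b z z⟫_ℝ) ≤ 2 * ‖b‖ * ‖z‖ * U * δ₁)
    (hax : ⟪a, x⟫_ℝ ^ 2 ≤ U ^ 2 * d) (haz : ⟪a, z⟫_ℝ ^ 2 ≤ U ^ 2 * d)
    (hbx : ⟪b, x⟫_ℝ ^ 2 ≤ U ^ 2 * d) (hbz : ⟪b, z⟫_ℝ ^ 2 ≤ U ^ 2 * d) :
    ‖a‖ ^ 2 + ‖b‖ ^ 2 ≤ 8 * (δ₁ ^ 2 + d) := by
  simp only [wedge_apply, inner_sub_right, inner_smul_right, real_inner_self_eq_norm_sq, hx, hz,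
    real_inner_comm x z ▸ hxz, hxz] at h1 h2
  rw [real_inner_comm] at hxz
  have key : U ^ 2 * (‖a‖ ^ 2 + ‖b‖ ^ 2) ≤ U ^ 2 * (8 * (δ₁ ^ 2 + d)) := by
    have k1 := sq_nonneg (⟪a, z⟫_ℝ - ⟪b, x⟫_ℝ)
    have k2 := sq_nonneg (⟪a, z⟫_ℝ + ⟪b, x⟫_ℝ)
    have k3 : 0 ≤ U ^ 2 * (‖a‖ - 2 * δ₁) ^ 2 := by positivity
    have k4 : 0 ≤ U ^ 2 * (‖b‖ - 2 * δ₁) ^ 2 := by positivity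
    nlinarith
  exact le_of_mul_le_mul_left key (by positivity)

/-- The constant in the resonance bound. -/
def resonanceConst (m : ℝ) : ℝ :=
  8 * (338 * m ^ 2 * (16 * π ^ 2) + (32 * π ^ 2 * (1 + m ^ 2) + 4))

variable [CompleteSpace V]

namespace IsResonantSlice

variable {m η U : ℝ} {F X Z h h' P β₁ β₂ β₃ : ℝ → V}

lemma norm_F_sub_le (H : IsResonantSlice m η U F X Z h h' P β₁ β₂ β₃) {θ : ℝ}
    (hθ : θ ∈ Icc 0 (2 * π)) : ‖F θ - (F 0 + (1 / m) • X 0)‖ ≤ 15 * U := by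
  have h1 := H.F_sub_le hθ
  have hm := H.one_le_m
  have hU := H.U_pos
  have h2 : ‖(1 / m) • (cos (m * θ) • X 0 - sin (m * θ) • Z 0)‖ ≤ 2 * U := by
    have h3 := norm_cos_smul_add_sin_smul_le (X 0) (-Z 0) (m * θ)
    rw [smul_neg, ← sub_eq_add_neg, norm_neg, H.norm_X, H.norm_Z] at h3
    rw [norm_smul, norm_eq_abs, abs_of_nonneg (by positivity)]
    refine (mul_le_of_le_one_left (norm_nonneg _) ?_).trans (by linarith)
    rw [div_le_one (by linarith)]
    exact hm
  have h3 : √(4 * π * η) ≤ 1 := by rw [sqrt_le_one]; exact H.η_le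
  have h4 : 4 * π * (U * √(4 * π * η)) ≤ 4 * π * (U * 1) := by gcongr
  have h5 := norm_sub_le (F θ - (F 0 + (1 / m) • X 0) +
    (1 / m) • (cos (m * θ) • X 0 - sin (m * θ) • Z 0))
    ((1 / m) • (cos (m * θ) • X 0 - sin (m * θ) • Z 0))
  rw [add_sub_cancel_right] at h5
  have := pi_lt_d2
  nlinarith

/-- The vanishing of the torque along an infinitesimal rotation `S` controls the pairing of the
resonant coefficients with the image under `S` of the tangent plane. -/
lemma abs_torque_le (H : IsResonantSlice m η U F X Z h h' P β₁ β₂ β₃) {S : V →L[ℝ] V} {K : ℝ}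
    (hK : 0 ≤ K) (hS : ∀ w, ‖S w‖ ≤ K * ‖w‖)
    (hSt : ∫ θ in (0 : ℝ)..(2 * π), (2 * ⟪h θ, S (X θ)⟫_ℝ -
      ⟪(2 : ℝ) • h' θ + P θ, S (F θ)⟫_ℝ) = 0) :
    |⟪∫ θ in (0 : ℝ)..(2 * π), cos (m * θ) • (h' θ + m • h θ), S (X 0)⟫_ℝ -
        ⟪∫ θ in (0 : ℝ)..(2 * π), sin (m * θ) • (h' θ + m • h θ), S (Z 0)⟫_ℝ| ≤
      K * U * (13 * m * (√(4 * π * η) * (∫ θ in (0 : ℝ)..(2 * π), (‖h θ‖ + ‖h' θ‖)) +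
        ∫ θ in (0 : ℝ)..(2 * π), ‖P θ‖)) := by
  have ch := H.cont_h
  have ch' := H.cont_h'
  have cP := H.cont_P
  have cX := H.cont_X
  have cF := H.cont_F
  have hm := H.one_le_m
  have hU := H.U_pos
  set ρ := √(4 * π * η) with hρ
  have hρ0 : 0 ≤ ρ := sqrt_nonneg _
  set c₀ := F 0 + (1 / m) • X 0 with hc₀
  set T : ℝ → V := fun θ => cos (m * θ) • X 0 - sin (m * θ) • Z 0 with hT
  have cT : Continuous T := by fun_prop
  set r : ℝ → ℝ := fun θ => -(2 * ⟪h θ, S (X θ - T θ)⟫_ℝ) +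
    2 * ⟪h' θ, S (F θ - c₀ + (1 / m) • T θ)⟫_ℝ + ⟪P θ, S (F θ - c₀)⟫_ℝ with hr
  have cr : Continuous r := by fun_prop
  have hflux : ∫ θ in (0 : ℝ)..(2 * π), ⟪(2 : ℝ) • h' θ + P θ, S c₀⟫_ℝ = 0 := by
    rw [integral_inner_const (by fun_prop), H.flux, inner_zero_left]
  have e1 : ⟪∫ θ in (0 : ℝ)..(2 * π), cos (m * θ) • (h' θ + m • h θ), S (X 0)⟫_ℝ -
      ⟪∫ θ in (0 : ℝ)..(2 * π), sin (m * θ) • (h' θ + m • h θ), S (Z 0)⟫_ℝ =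
      ∫ θ in (0 : ℝ)..(2 * π), ⟪h' θ + m • h θ, S (T θ)⟫_ℝ := by
    rw [← integral_inner_const (by fun_prop), ← integral_inner_const (by fun_prop),
      ← intervalIntegral.integral_sub (Continuous.intervalIntegrable (by fun_prop) _ _)
        (Continuous.intervalIntegrable (by fun_prop) _ _)]
    congr 1
    funext θ
    simp only [hT, map_sub, map_smul, inner_sub_right, inner_smul_right, real_inner_smul_left]
  have e2 : 2 / m * ∫ θ in (0 : ℝ)..(2 * π), ⟪h' θ + m • h θ, S (T θ)⟫_ℝ =
      ∫ θ in (0 : ℝ)..(2 * π), r θ := by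
    have hsum := intervalIntegral.integral_add (μ := volume) (a := 0) (b := 2 * π)
      (f := fun θ => (2 * ⟪h θ, S (X θ)⟫_ℝ - ⟪(2 : ℝ) • h' θ + P θ, S (F θ)⟫_ℝ) +
        ⟪(2 : ℝ) • h' θ + P θ, S c₀⟫_ℝ) (g := r)
      (Continuous.intervalIntegrable (by fun_prop) _ _)
      (Continuous.intervalIntegrable (by fun_prop) _ _)
    have hzero := intervalIntegral.integral_add (μ := volume) (a := 0) (b := 2 * π)
      (f := fun θ => 2 * ⟪h θ, S (X θ)⟫_ℝ - ⟪(2 : ℝ) • h' θ + P θ, S (F θ)⟫_ℝ)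
      (g := fun θ => ⟪(2 : ℝ) • h' θ + P θ, S c₀⟫_ℝ)
      (Continuous.intervalIntegrable (by fun_prop) _ _)
      (Continuous.intervalIntegrable (by fun_prop) _ _)
    rw [hSt, hflux, add_zero] at hzero
    rw [hzero, zero_add] at hsum
    rw [← hsum, ← intervalIntegral.integral_const_mul]
    congr 1
    funext θ
    simp only [hr, map_sub, map_add, map_smul, inner_sub_right, inner_add_right, inner_smul_right,
      real_inner_smul_left, inner_add_left]
    field_simp
    ring
  have e3 : |∫ θ in (0 : ℝ)..(2 * π), r θ| ≤
      K * U * (26 * (ρ * (∫ θ in (0 : ℝ)..(2 * π), (‖h θ‖ + ‖h' θ‖)) +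
        ∫ θ in (0 : ℝ)..(2 * π), ‖P θ‖)) := by
    rw [← intervalIntegral.integral_const_mul, ← intervalIntegral.integral_add
      (Continuous.intervalIntegrable (by fun_prop) _ _)
      (Continuous.intervalIntegrable (by fun_prop) _ _), ← intervalIntegral.integral_const_mul,
      ← intervalIntegral.integral_const_mul]
    refine (intervalIntegral.abs_integral_le_integral_abs two_pi_nonneg).trans
      (intervalIntegral.integral_mono_on two_pi_nonneg
      (Continuous.intervalIntegrable (by fun_prop) _ _)
      (Continuous.intervalIntegrable (by fun_prop) _ _) fun θ hθ => ?_)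
    have hin : ∀ v w : V, ∀ M : ℝ, ‖w‖ ≤ M → |⟪v, S w⟫_ℝ| ≤ K * M * ‖v‖ := fun v w M hM => by
      have h1 := (abs_real_inner_le_norm v (S w)).trans
        (mul_le_mul_of_nonneg_left ((hS w).trans (mul_le_mul_of_nonneg_left hM hK)) (norm_nonneg v))
      linarith
    have k1 := hin (h θ) _ _ (H.X_sub_le hθ)
    have k2 := hin (h' θ) _ _ (H.F_sub_le hθ)
    have k3 := hin (P θ) _ _ (H.norm_F_sub_le hθ)
    have k4 : |r θ| ≤ 2 * |⟪h θ, S (X θ - T θ)⟫_ℝ| +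
        2 * |⟪h' θ, S (F θ - c₀ + (1 / m) • T θ)⟫_ℝ| + |⟪P θ, S (F θ - c₀)⟫_ℝ| := by
      refine (abs_add_le _ _).trans (add_le_add_left ((abs_add_le _ _).trans ?_) _)
      rw [abs_neg, abs_mul, abs_mul, abs_two]
    have k5 : 0 ≤ K * U * (ρ * ‖h θ‖) := by positivity
    have k6 : 0 ≤ K * U * (ρ * ‖h' θ‖) := by positivity
    have k7 : 0 ≤ K * U * ‖P θ‖ := by positivity
    have k8 : π * (K * U * (ρ * ‖h' θ‖)) ≤ 3.15 * (K * U * (ρ * ‖h' θ‖)) :=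
      mul_le_mul_of_nonneg_right pi_lt_d2.le k6
    linarith
  rw [e1]
  have e4 : ∫ θ in (0 : ℝ)..(2 * π), ⟪h' θ + m • h θ, S (T θ)⟫_ℝ =
      m / 2 * ∫ θ in (0 : ℝ)..(2 * π), r θ := by
    rw [← e2]
    field_simp
  rw [e4, abs_mul, abs_of_nonneg (by positivity)]
  calc _ ≤ _ := mul_le_mul_of_nonneg_left e3 (by positivity : 0 ≤ m / 2)
    _ = _ := by ring

/-- The resonant coefficients are almost normal. -/
lemma sq_inner_coeff_le (H : IsResonantSlice m η U F X Z h h' P β₁ β₂ β₃) {e : ℝ → ℝ}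
    (he : Continuous e) (he1 : ∀ x, |e x| ≤ 1) {E : ℝ → V} {w : V}
    (hw : ∀ θ ∈ Icc 0 (2 * π), ‖E θ - w‖ ≤ U * √(4 * π * η))
    (hin : ∀ θ, |⟪h' θ + m • h θ, E θ⟫_ℝ| ≤ ‖h θ‖ * (‖β₁ θ‖ + ‖β₂ θ‖)) :
    ⟪∫ θ in (0 : ℝ)..(2 * π), e θ • (h' θ + m • h θ), w⟫_ℝ ^ 2 ≤
      U ^ 2 * (η * ((32 * π ^ 2 * (1 + m ^ 2) + 4) *
        ∫ θ in (0 : ℝ)..(2 * π), (‖h θ‖ ^ 2 + ‖h' θ‖ ^ 2))) := by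
  have ch := H.cont_h
  have ch' := H.cont_h'
  have c1 := H.cont_β₁
  have c2 := H.cont_β₂
  have c3 := H.cont_β₃
  have hη := H.η_nonneg
  have hpi := pi_pos
  set ρ := √(4 * π * η) with hρ
  have hρ0 : 0 ≤ ρ := sqrt_nonneg _
  have hρ2 : ρ ^ 2 = 4 * π * η := sq_sqrt (by positivity)
  have hUρ : 0 ≤ U * ρ := mul_nonneg H.U_pos.le hρ0
  set N := ∫ θ in (0 : ℝ)..(2 * π), (‖h θ‖ ^ 2 + ‖h' θ‖ ^ 2) with hN
  have hN0 : 0 ≤ N := intervalIntegral.integral_nonneg two_pi_nonneg fun _ _ => by positivity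
  set A := ∫ θ in (0 : ℝ)..(2 * π), ‖h' θ + m • h θ‖ with hA
  set B := ∫ θ in (0 : ℝ)..(2 * π), ‖h θ‖ * (‖β₁ θ‖ + ‖β₂ θ‖) with hB
  have hA0 : 0 ≤ A := intervalIntegral.integral_nonneg two_pi_nonneg fun _ _ => by positivity
  have hB0 : 0 ≤ B := intervalIntegral.integral_nonneg two_pi_nonneg fun _ _ => by positivity
  have h1 : |⟪∫ θ in (0 : ℝ)..(2 * π), e θ • (h' θ + m • h θ), w⟫_ℝ| ≤ U * ρ * A + B := by
    rw [← integral_inner_const (by fun_prop), hA, hB, ← intervalIntegral.integral_const_mul,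
      ← intervalIntegral.integral_add (Continuous.intervalIntegrable (by fun_prop) _ _)
        (Continuous.intervalIntegrable (by fun_prop) _ _)]
    refine (intervalIntegral.abs_integral_le_integral_abs two_pi_nonneg).trans
      (intervalIntegral.integral_mono_on two_pi_nonneg
      (Continuous.intervalIntegrable (by fun_prop) _ _)
      (Continuous.intervalIntegrable (by fun_prop) _ _) fun θ hθ => ?_)
    rw [real_inner_smul_left, abs_mul]
    refine (mul_le_of_le_one_left (abs_nonneg _) (he1 θ)).trans ?_
    have k1 : ⟪h' θ + m • h θ, w⟫_ℝ = -⟪h' θ + m • h θ, E θ - w⟫_ℝ + ⟪h' θ + m • h θ, E θ⟫_ℝ := by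
      rw [inner_sub_right]; ring
    rw [k1]
    refine (abs_add_le _ _).trans (add_le_add ?_ (hin θ))
    rw [abs_neg]
    refine (abs_real_inner_le_norm _ _).trans ?_
    rw [mul_comm]
    exact mul_le_mul_of_nonneg_right (hw θ hθ) (norm_nonneg _)
  have hA2 : A ^ 2 ≤ 2 * π * (2 * (1 + m ^ 2) * N) := by
    refine (sq_integral_le (g := fun θ => ‖h' θ + m • h θ‖) (by fun_prop)).trans
      (mul_le_mul_of_nonneg_left ?_ two_pi_nonneg)
    rw [hN, ← intervalIntegral.integral_const_mul]
    refine intervalIntegral.integral_mono_on two_pi_nonneg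
      (Continuous.intervalIntegrable (by fun_prop) _ _)
      (Continuous.intervalIntegrable (by fun_prop) _ _) fun θ hθ => ?_
    refine (norm_add_sq_le _ _).trans ?_
    rw [norm_smul, mul_pow, norm_eq_abs, sq_abs]
    nlinarith [sq_nonneg ‖h θ‖, mul_nonneg (sq_nonneg m) (sq_nonneg ‖h' θ‖)]
  have hB2 : B ^ 2 ≤ N * (2 * (η * U ^ 2)) := by
    refine (integral_mul_sq_le (g := fun θ => ‖h θ‖) (k := fun θ => ‖β₁ θ‖ + ‖β₂ θ‖)
      (by fun_prop) (by fun_prop) two_pi_nonneg).trans ?_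
    have k1 : ∫ θ in (0 : ℝ)..(2 * π), ‖h θ‖ ^ 2 ≤ N :=
      intervalIntegral.integral_mono_on two_pi_nonneg
        (Continuous.intervalIntegrable (by fun_prop) _ _)
        (Continuous.intervalIntegrable (by fun_prop) _ _) fun θ _ =>
          le_add_of_nonneg_right (sq_nonneg _)
    have k2 : ∫ θ in (0 : ℝ)..(2 * π), (‖β₁ θ‖ + ‖β₂ θ‖) ^ 2 ≤ 2 * (η * U ^ 2) := by
      refine le_trans ?_ (mul_le_mul_of_nonneg_left H.integral_le zero_le_two)
      rw [← intervalIntegral.integral_const_mul]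
      refine intervalIntegral.integral_mono_on two_pi_nonneg
        (Continuous.intervalIntegrable (by fun_prop) _ _)
        (Continuous.intervalIntegrable (by fun_prop) _ _) fun θ _ => ?_
      nlinarith [sq_nonneg (‖β₁ θ‖ - ‖β₂ θ‖), sq_nonneg ‖β₃ θ‖]
    exact mul_le_mul k1 k2 (intervalIntegral.integral_nonneg two_pi_nonneg fun _ _ => sq_nonneg _)
      hN0
  calc _ ≤ (U * ρ * A + B) ^ 2 := by rw [← sq_abs]; gcongr
    _ ≤ 2 * (U ^ 2 * ρ ^ 2 * A ^ 2) + 2 * B ^ 2 := by nlinarith [sq_nonneg (U * ρ * A - B)]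
    _ ≤ 2 * (U ^ 2 * ρ ^ 2 * (2 * π * (2 * (1 + m ^ 2) * N))) + 2 * (N * (2 * (η * U ^ 2))) := by
      gcongr
    _ = _ := by rw [hρ2]; ring

lemma resonance_bound (H : IsResonantSlice m η U F X Z h h' P β₁ β₂ β₃) :
    ‖∫ θ in (0 : ℝ)..(2 * π), cos (m * θ) • (h' θ + m • h θ)‖ ^ 2 +
        ‖∫ θ in (0 : ℝ)..(2 * π), sin (m * θ) • (h' θ + m • h θ)‖ ^ 2 ≤
      resonanceConst m * (η * (∫ θ in (0 : ℝ)..(2 * π), (‖h θ‖ ^ 2 + ‖h' θ‖ ^ 2)) +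
        ∫ θ in (0 : ℝ)..(2 * π), ‖P θ‖ ^ 2) := by
  have ch := H.cont_h
  have ch' := H.cont_h'
  have cP := H.cont_P
  have cX := H.cont_X
  have cZ := H.cont_Z
  have hη := H.η_nonneg
  have hpi := pi_pos
  have hm := H.one_le_m
  have inX : ∀ θ, |⟪h' θ + m • h θ, X θ⟫_ℝ| ≤ ‖h θ‖ * ‖β₁ θ‖ := fun θ => by
    rw [H.inner_X, abs_neg]; exact abs_real_inner_le_norm _ _
  have inZ : ∀ θ, |⟪h' θ + m • h θ, Z θ⟫_ℝ| ≤ ‖h θ‖ * ‖β₂ θ‖ := fun θ => by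
    rw [H.inner_Z, abs_neg]; exact abs_real_inner_le_norm _ _
  have hsc : ∀ s c θ : ℝ, |s| ≤ 1 → |c| ≤ 1 →
      |⟪h' θ + m • h θ, s • X θ + c • Z θ⟫_ℝ| ≤ ‖h θ‖ * (‖β₁ θ‖ + ‖β₂ θ‖) :=
    fun s c θ hs hc => by
      rw [inner_add_right, inner_smul_right, inner_smul_right, mul_add]
      refine (abs_add_le _ _).trans (add_le_add ?_ ?_)
      · rw [abs_mul]
        exact (mul_le_of_le_one_left (abs_nonneg _) hs).trans (inX θ)
      · rw [abs_mul]
        exact (mul_le_of_le_one_left (abs_nonneg _) hc).trans (inZ θ)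
  have cc : Continuous fun θ => cos (m * θ) := by fun_prop
  have cs : Continuous fun θ => sin (m * θ) := by fun_prop
  have hX : ∀ {e : ℝ → ℝ} (_ : Continuous e) (_ : ∀ x, |e x| ≤ 1), _ := fun {e} he he1 =>
    H.sq_inner_coeff_le he he1 (E := fun θ => cos (m * θ) • X θ + sin (m * θ) • Z θ)
      (w := X 0) (fun θ hθ => H.rotated_X_sub_le hθ)
      (fun θ => hsc _ _ θ (abs_cos_le_one _) (abs_sin_le_one _))
  have hZ : ∀ {e : ℝ → ℝ} (_ : Continuous e) (_ : ∀ x, |e x| ≤ 1), _ := fun {e} he he1 =>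
    H.sq_inner_coeff_le he he1
      (E := fun θ => -(sin (m * θ) • X θ - cos (m * θ) • Z θ))
      (w := Z 0) (fun θ hθ => by
        rw [← norm_neg, neg_sub, sub_neg_eq_add, add_comm]; exact H.rotated_Z_add_le hθ)
      (fun θ => by
        have := hsc (-sin (m * θ)) (cos (m * θ)) θ (by rw [abs_neg]; exact abs_sin_le_one _)
          (abs_cos_le_one _)
        rwa [show -sin (m * θ) • X θ + cos (m * θ) • Z θ =
          -(sin (m * θ) • X θ - cos (m * θ) • Z θ) by module] at this)
  set a := ∫ θ in (0 : ℝ)..(2 * π), cos (m * θ) • (h' θ + m • h θ) with ha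
  set b := ∫ θ in (0 : ℝ)..(2 * π), sin (m * θ) • (h' θ + m • h θ) with hb
  have t1 := H.abs_torque_le (S := wedge a (X 0)) (K := 2 * ‖a‖ * ‖X 0‖) (by positivity)
    (norm_wedge_apply_le _ _) (H.torque _ _)
  have t2 := H.abs_torque_le (S := wedge b (Z 0)) (K := 2 * ‖b‖ * ‖Z 0‖) (by positivity)
    (norm_wedge_apply_le _ _) (H.torque _ _)
  have key := coeff_algebra H.U_pos H.norm_X H.norm_Z H.orth ((le_abs_self _).trans t1)
    ((neg_le_abs _).trans t2) (hX cc fun x => abs_cos_le_one _) (hZ cc fun x => abs_cos_le_one _)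
    (hX cs fun x => abs_sin_le_one _) (hZ cs fun x => abs_sin_le_one _)
  refine key.trans ?_
  set ρ := √(4 * π * η) with hρ
  have hρ2 : ρ ^ 2 = 4 * π * η := sq_sqrt (by positivity)
  set N := ∫ θ in (0 : ℝ)..(2 * π), (‖h θ‖ ^ 2 + ‖h' θ‖ ^ 2) with hN
  set p := ∫ θ in (0 : ℝ)..(2 * π), ‖P θ‖ ^ 2 with hp
  have hp0 : 0 ≤ p := intervalIntegral.integral_nonneg two_pi_nonneg fun _ _ => by positivity
  have k1 : (∫ θ in (0 : ℝ)..(2 * π), (‖h θ‖ + ‖h' θ‖)) ^ 2 ≤ 2 * π * (2 * N) := by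
    refine (sq_integral_le (by fun_prop)).trans (mul_le_mul_of_nonneg_left ?_ two_pi_nonneg)
    rw [hN, ← intervalIntegral.integral_const_mul]
    exact intervalIntegral.integral_mono_on two_pi_nonneg
      (Continuous.intervalIntegrable (by fun_prop) _ _)
      (Continuous.intervalIntegrable (by fun_prop) _ _) fun θ hθ => by
        nlinarith [sq_nonneg (‖h θ‖ - ‖h' θ‖)]
  have k2 : (∫ θ in (0 : ℝ)..(2 * π), ‖P θ‖) ^ 2 ≤ 2 * π * p := sq_integral_le cP.norm
  set A := ∫ θ in (0 : ℝ)..(2 * π), (‖h θ‖ + ‖h' θ‖)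
  set B := ∫ θ in (0 : ℝ)..(2 * π), ‖P θ‖
  have k3 : (13 * m * (ρ * A + B)) ^ 2 ≤ 338 * m ^ 2 * (16 * π ^ 2) * (η * N + p) := by
    calc (13 * m * (ρ * A + B)) ^ 2 ≤ 338 * m ^ 2 * (ρ ^ 2 * A ^ 2 + B ^ 2) := by
          nlinarith [mul_nonneg (sq_nonneg m) (sq_nonneg (ρ * A - B))]
      _ ≤ 338 * m ^ 2 * (ρ ^ 2 * (2 * π * (2 * N)) + 2 * π * p) := by gcongr
      _ = 338 * m ^ 2 * (16 * π ^ 2 * (η * N) + 2 * π * p) := by rw [hρ2]; ring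
      _ ≤ 338 * m ^ 2 * (16 * π ^ 2 * (η * N) + 16 * π ^ 2 * p) := by
          have : 2 * π ≤ 16 * π ^ 2 := by nlinarith [pi_gt_three]
          gcongr
      _ = _ := by ring
  have k4 : 0 ≤ (32 * π ^ 2 * (1 + m ^ 2) + 4) * p := by positivity
  unfold resonanceConst
  linarith

end IsResonantSlice

end ResonanceFromTorque

section Geometry

variable {n : ℕ} {f : ℝ → ℝ → EuclideanSpace ℝ (Fin n)} {u : ℝ → ℝ → ℝ}

/-- The `t`-component of the lower order part of the Willmore equation in divergence form. -/
def fluxT (f : ℝ → ℝ → EuclideanSpace ℝ (Fin n)) (u : ℝ → ℝ → ℝ) (t θ : ℝ) :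
    EuclideanSpace ℝ (Fin n) :=
  (4 : ℝ) • (Real.exp (-(2 * u t θ)) •
    (⟪Hmc f u t θ, Att f u t θ⟫_ℝ • pt f t θ + ⟪Hmc f u t θ, Atth f u t θ⟫_ℝ • pth f t θ)) -
    ‖Hmc f u t θ‖ ^ 2 • pt f t θ

/-- The `θ`-component of the lower order part of the Willmore equation in divergence form. -/
def fluxTh (f : ℝ → ℝ → EuclideanSpace ℝ (Fin n)) (u : ℝ → ℝ → ℝ) (t θ : ℝ) :
    EuclideanSpace ℝ (Fin n) :=
  (4 : ℝ) • (Real.exp (-(2 * u t θ)) •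
    (⟪Hmc f u t θ, Atth f u t θ⟫_ℝ • pt f t θ + ⟪Hmc f u t θ, Athth f u t θ⟫_ℝ • pth f t θ)) -
    ‖Hmc f u t θ‖ ^ 2 • pth f t θ

/-- The deviation `f_tt + m f_t` from the model end. -/
def defTT (m : ℝ) (f : ℝ → ℝ → EuclideanSpace ℝ (Fin n)) (t θ : ℝ) : EuclideanSpace ℝ (Fin n) :=
  pt (pt f) t θ + m • pt f t θ

/-- The deviation `f_tθ + m f_θ` from the model end. -/
def defTTh (m : ℝ) (f : ℝ → ℝ → EuclideanSpace ℝ (Fin n)) (t θ : ℝ) : EuclideanSpace ℝ (Fin n) :=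
  pt (pth f) t θ + m • pth f t θ

/-- The deviation `f_θθ - m f_t` from the model end. -/
def defThTh (m : ℝ) (f : ℝ → ℝ → EuclideanSpace ℝ (Fin n)) (t θ : ℝ) : EuclideanSpace ℝ (Fin n) :=
  pth (pth f) t θ - m • pt f t θ

lemma Smooth₂.defTT (hf : Smooth₂ f) (m : ℝ) : Smooth₂ (defTT m f) :=
  hf.dt.dt.add (hf.dt.const_smul m)

lemma Smooth₂.defTTh (hf : Smooth₂ f) (m : ℝ) : Smooth₂ (defTTh m f) :=
  hf.dth.dt.add (hf.dth.const_smul m)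

lemma Smooth₂.defThTh (hf : Smooth₂ f) (m : ℝ) : Smooth₂ (defThTh m f) :=
  hf.dth.dth.sub (hf.dt.const_smul m)

lemma Smooth₂.exp_neg_two_mul (hu : Smooth₂ u) : Smooth₂ fun t θ => Real.exp (-(2 * u t θ)) := by
  have h1 : Smooth₂ (fun t θ => -(2 * u t θ)) := by simpa using hu.const_mul (-2)
  exact h1.exp

lemma Smooth₂.Hmc (hf : Smooth₂ f) (hu : Smooth₂ u) : Smooth₂ (Hmc f u) :=
  hu.exp_neg_two_mul.smul (hf.dt.dt.add hf.dth.dth)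

lemma Smooth₂.Att (hf : Smooth₂ f) (hu : Smooth₂ u) : Smooth₂ (Att f u) :=
  (hf.dt.dt.sub (hu.dt.smul hf.dt)).add (hu.dth.smul hf.dth)

lemma Smooth₂.Atth (hf : Smooth₂ f) (hu : Smooth₂ u) : Smooth₂ (Atth f u) :=
  (hf.dth.dt.sub (hu.dth.smul hf.dt)).sub (hu.dt.smul hf.dth)

lemma Smooth₂.Athth (hf : Smooth₂ f) (hu : Smooth₂ u) : Smooth₂ (Athth f u) :=
  (hf.dth.dth.add (hu.dt.smul hf.dt)).sub (hu.dth.smul hf.dth)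

lemma Smooth₂.fluxT_main (hf : Smooth₂ f) (hu : Smooth₂ u) :
    Smooth₂ fun t θ => Real.exp (-(2 * u t θ)) •
      (⟪_root_.Hmc f u t θ, _root_.Att f u t θ⟫_ℝ • pt f t θ +
        ⟪_root_.Hmc f u t θ, _root_.Atth f u t θ⟫_ℝ • pth f t θ) :=
  hu.exp_neg_two_mul.smul ((((hf.Hmc hu).inner (hf.Att hu)).smul hf.dt).add
    (((hf.Hmc hu).inner (hf.Atth hu)).smul hf.dth))

lemma Smooth₂.fluxTh_main (hf : Smooth₂ f) (hu : Smooth₂ u) :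
    Smooth₂ fun t θ => Real.exp (-(2 * u t θ)) •
      (⟪_root_.Hmc f u t θ, _root_.Atth f u t θ⟫_ℝ • pt f t θ +
        ⟪_root_.Hmc f u t θ, _root_.Athth f u t θ⟫_ℝ • pth f t θ) :=
  hu.exp_neg_two_mul.smul ((((hf.Hmc hu).inner (hf.Atth hu)).smul hf.dt).add
    (((hf.Hmc hu).inner (hf.Athth hu)).smul hf.dth))

lemma Smooth₂.fluxT (hf : Smooth₂ f) (hu : Smooth₂ u) : Smooth₂ (fluxT f u) :=
  ((hf.fluxT_main hu).const_smul 4).sub ((hf.Hmc hu).norm_sq.smul hf.dt)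

lemma Smooth₂.fluxTh (hf : Smooth₂ f) (hu : Smooth₂ u) : Smooth₂ (fluxTh f u) :=
  ((hf.fluxTh_main hu).const_smul 4).sub ((hf.Hmc hu).norm_sq.smul hf.dth)

lemma willmoreOp_eq (hf : Smooth₂ f) (hu : Smooth₂ u) (t θ : ℝ) :
    willmoreOp f u t θ = (2 : ℝ) • (pt (pt (Hmc f u)) t θ + pth (pth (Hmc f u)) t θ) +
      pt (fluxT f u) t θ + pth (fluxTh f u) t θ := by
  have h1 : pt (fluxT f u) t θ = _ :=
    ((((hf.fluxT_main hu).hasDerivAt_pt t θ).const_smul (4 : ℝ)).sub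
      (((hf.Hmc hu).norm_sq.smul hf.dt).hasDerivAt_pt t θ)).deriv
  have h2 : pth (fluxTh f u) t θ = _ :=
    ((((hf.fluxTh_main hu).hasDerivAt_pth t θ).const_smul (4 : ℝ)).sub
      (((hf.Hmc hu).norm_sq.smul hf.dth).hasDerivAt_pth t θ)).deriv
  rw [h1, h2, willmoreOp]
  abel

namespace ConfImm

variable {s : Set ℝ}

lemma norm_pt (h : ConfImm f u s) {t : ℝ} (ht : t ∈ s) (θ : ℝ) : ‖pt f t θ‖ = Real.exp (u t θ) := by
  have h1 := h.conf_t t ht θ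
  rw [two_mul, Real.exp_add, ← sq] at h1
  exact (pow_left_inj₀ (norm_nonneg _) (Real.exp_pos _).le two_ne_zero).1 h1

lemma norm_pth (h : ConfImm f u s) {t : ℝ} (ht : t ∈ s) (θ : ℝ) :
    ‖pth f t θ‖ = Real.exp (u t θ) := by
  have h1 := h.conf_th t ht θ
  rw [two_mul, Real.exp_add, ← sq] at h1
  exact (pow_left_inj₀ (norm_nonneg _) (Real.exp_pos _).le two_ne_zero).1 h1

lemma smooth₂_f (h : ConfImm f u s) : Smooth₂ f := h.smooth_f

lemma smooth₂_u (h : ConfImm f u s) : Smooth₂ u := h.smooth_u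

lemma periodic₂_f (h : ConfImm f u s) : Periodic₂ f := h.periodic_f

lemma periodic₂_u (h : ConfImm f u s) : Periodic₂ u := h.periodic_u

lemma periodic₂_Hmc (h : ConfImm f u s) : Periodic₂ (Hmc f u) := fun t θ => by
  simp only [Hmc, h.periodic_u t θ, h.periodic₂_f.dt.dt t θ, h.periodic₂_f.dth.dth t θ]

lemma periodic₂_fluxTh (h : ConfImm f u s) : Periodic₂ (fluxTh f u) := fun t θ => by
  simp only [fluxTh, Atth, Athth, h.periodic_u t θ, h.periodic₂_Hmc t θ, h.periodic₂_f.dt t θ,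
    h.periodic₂_f.dth t θ, h.periodic₂_f.dth.dt t θ, h.periodic₂_f.dth.dth t θ,
    h.periodic₂_u.dt t θ, h.periodic₂_u.dth t θ]

lemma periodic₂_defTT (h : ConfImm f u s) (m : ℝ) : Periodic₂ (defTT m f) := fun t θ => by
  simp only [defTT, h.periodic₂_f.dt t θ, h.periodic₂_f.dt.dt t θ]

lemma periodic₂_defTTh (h : ConfImm f u s) (m : ℝ) : Periodic₂ (defTTh m f) := fun t θ => by
  simp only [defTTh, h.periodic₂_f.dth t θ, h.periodic₂_f.dth.dt t θ]

lemma periodic₂_defThTh (h : ConfImm f u s) (m : ℝ) : Periodic₂ (defThTh m f) := fun t θ => by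
  simp only [defThTh, h.periodic₂_f.dt t θ, h.periodic₂_f.dth.dth t θ]

section Interior

variable {a b t : ℝ} (h : ConfImm f u (Icc a b)) (ht : t ∈ Ioo a b) (θ : ℝ)

include h ht

lemma inner_pt_pt_pt : ⟪pt (pt f) t θ, pt f t θ⟫_ℝ = pt u t θ * Real.exp (2 * u t θ) := by
  have h1 := (h.smooth₂_f.dt.hasDerivAt_pt t θ).norm_sq
  have h2 := ((h.smooth₂_u.hasDerivAt_pt t θ).const_mul 2).exp
  have h3 : (fun s => ‖pt f s θ‖ ^ 2) =ᶠ[nhds t] fun s => Real.exp (2 * u s θ) := by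
    filter_upwards [Icc_mem_nhds ht.1 ht.2] with s hs using h.conf_t s hs θ
  have h4 := (h1.congr_of_eventuallyEq h3.symm).unique h2
  rw [real_inner_comm]
  linarith

lemma inner_pt_pth_pth : ⟪pt (pth f) t θ, pth f t θ⟫_ℝ = pt u t θ * Real.exp (2 * u t θ) := by
  have h1 := (h.smooth₂_f.dth.hasDerivAt_pt t θ).norm_sq
  have h2 := ((h.smooth₂_u.hasDerivAt_pt t θ).const_mul 2).exp
  have h3 : (fun s => ‖pth f s θ‖ ^ 2) =ᶠ[nhds t] fun s => Real.exp (2 * u s θ) := by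
    filter_upwards [Icc_mem_nhds ht.1 ht.2] with s hs using h.conf_th s hs θ
  have h4 := (h1.congr_of_eventuallyEq h3.symm).unique h2
  rw [real_inner_comm]
  linarith

lemma inner_pth_pt_pt : ⟪pt (pth f) t θ, pt f t θ⟫_ℝ = pth u t θ * Real.exp (2 * u t θ) := by
  have h1 := (h.smooth₂_f.dt.hasDerivAt_pth t θ).norm_sq
  have h2 := ((h.smooth₂_u.hasDerivAt_pth t θ).const_mul 2).exp
  have h3 : (fun s => ‖pt f t s‖ ^ 2) = fun s => Real.exp (2 * u t s) :=
    funext fun s => h.conf_t t (Ioo_subset_Icc_self ht) s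
  rw [h3] at h1
  have h4 := h1.unique h2
  rw [h.smooth₂_f.pt_pth, real_inner_comm]
  linarith

lemma inner_pth_pth_pth : ⟪pth (pth f) t θ, pth f t θ⟫_ℝ = pth u t θ * Real.exp (2 * u t θ) := by
  have h1 := (h.smooth₂_f.dth.hasDerivAt_pth t θ).norm_sq
  have h2 := ((h.smooth₂_u.hasDerivAt_pth t θ).const_mul 2).exp
  have h3 : (fun s => ‖pth f t s‖ ^ 2) = fun s => Real.exp (2 * u t s) :=
    funext fun s => h.conf_th t (Ioo_subset_Icc_self ht) s
  rw [h3] at h1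
  have h4 := h1.unique h2
  rw [real_inner_comm]
  linarith

lemma inner_pt_pt_pth : ⟪pt (pt f) t θ, pth f t θ⟫_ℝ = -⟪pt (pth f) t θ, pt f t θ⟫_ℝ := by
  have h1 := (h.smooth₂_f.dt.hasDerivAt_pt t θ).inner ℝ (h.smooth₂_f.dth.hasDerivAt_pt t θ)
  have h3 : (fun s => ⟪pt f s θ, pth f s θ⟫_ℝ) =ᶠ[nhds t] fun _ => 0 := by
    filter_upwards [Icc_mem_nhds ht.1 ht.2] with s hs using h.conf_orth s hs θ
  have h4 := (h1.congr_of_eventuallyEq h3.symm).unique (hasDerivAt_const t 0)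
  rw [real_inner_comm (pt f t θ)]
  linarith

lemma inner_pth_pth_pt : ⟪pth (pth f) t θ, pt f t θ⟫_ℝ = -⟪pt (pth f) t θ, pth f t θ⟫_ℝ := by
  have h1 := (h.smooth₂_f.dt.hasDerivAt_pth t θ).inner ℝ (h.smooth₂_f.dth.hasDerivAt_pth t θ)
  have h3 : (fun s => ⟪pt f t s, pth f t s⟫_ℝ) = fun _ => 0 :=
    funext fun s => h.conf_orth t (Ioo_subset_Icc_self ht) s
  rw [h3] at h1
  have h4 := h1.unique (hasDerivAt_const θ 0)
  rw [h.smooth₂_f.pt_pth, real_inner_comm (pt f t θ)]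
  linarith

lemma inner_Hmc_pt : ⟪Hmc f u t θ, pt f t θ⟫_ℝ = 0 := by
  rw [Hmc, real_inner_smul_left, inner_add_left, h.inner_pt_pt_pt ht, h.inner_pth_pth_pt ht,
    h.inner_pt_pth_pth ht, add_neg_cancel, mul_zero]

lemma inner_Hmc_pth : ⟪Hmc f u t θ, pth f t θ⟫_ℝ = 0 := by
  rw [Hmc, real_inner_smul_left, inner_add_left, h.inner_pt_pt_pth ht, h.inner_pth_pth_pth ht,
    h.inner_pth_pt_pt ht, neg_add_cancel, mul_zero]

lemma inner_pt_Hmc_pt : ⟪pt (Hmc f u) t θ, pt f t θ⟫_ℝ = -⟪Hmc f u t θ, pt (pt f) t θ⟫_ℝ := by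
  have h1 := ((h.smooth₂_f.Hmc h.smooth₂_u).hasDerivAt_pt t θ).inner ℝ
    (h.smooth₂_f.dt.hasDerivAt_pt t θ)
  have h3 : (fun s => ⟪Hmc f u s θ, pt f s θ⟫_ℝ) =ᶠ[nhds t] fun _ => 0 := by
    filter_upwards [Ioo_mem_nhds ht.1 ht.2] with s hs using h.inner_Hmc_pt hs θ
  have h4 := (h1.congr_of_eventuallyEq h3.symm).unique (hasDerivAt_const t 0)
  linarith

lemma inner_pt_Hmc_pth : ⟪pt (Hmc f u) t θ, pth f t θ⟫_ℝ = -⟪Hmc f u t θ, pt (pth f) t θ⟫_ℝ := by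
  have h1 := ((h.smooth₂_f.Hmc h.smooth₂_u).hasDerivAt_pt t θ).inner ℝ
    (h.smooth₂_f.dth.hasDerivAt_pt t θ)
  have h3 : (fun s => ⟪Hmc f u s θ, pth f s θ⟫_ℝ) =ᶠ[nhds t] fun _ => 0 := by
    filter_upwards [Ioo_mem_nhds ht.1 ht.2] with s hs using h.inner_Hmc_pth hs θ
  have h4 := (h1.congr_of_eventuallyEq h3.symm).unique (hasDerivAt_const t 0)
  linarith

end Interior

end ConfImm

end Geometry

section NearEnd

lemma norm_sq_flux_le {V : Type*} [NormedAddCommGroup V] [InnerProductSpace ℝ V]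
    {H T Θ x y z : V} {w : ℝ} (hT : ‖T‖ = Real.exp w) (hΘ : ‖Θ‖ = Real.exp w)
    (hH : ‖H‖ ≤ Real.exp (-(2 * w)) * (‖x‖ + ‖z‖)) :
    ‖(4 : ℝ) • (Real.exp (-(2 * w)) • (⟪H, x⟫_ℝ • T + ⟪H, y⟫_ℝ • Θ)) - ‖H‖ ^ 2 • T‖ ^ 2 ≤
      42 * (‖H‖ ^ 2 * (Real.exp (-(2 * w)) * (‖x‖ ^ 2 + ‖y‖ ^ 2 + ‖z‖ ^ 2))) := by
  have e1 : Real.exp (-(2 * w)) * Real.exp w = Real.exp (-w) := by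
    rw [← Real.exp_add]; congr 1; ring
  have e2 : Real.exp (-w) ^ 2 = Real.exp (-(2 * w)) := by
    rw [← Real.exp_nat_mul]; congr 1; push_cast; ring
  have k1 : ‖(4 : ℝ) • (Real.exp (-(2 * w)) • (⟪H, x⟫_ℝ • T + ⟪H, y⟫_ℝ • Θ)) - ‖H‖ ^ 2 • T‖ ≤
      ‖H‖ * (Real.exp (-w) * (5 * ‖x‖ + 4 * ‖y‖ + ‖z‖)) := by
    have h1 : ‖⟪H, x⟫_ℝ • T + ⟪H, y⟫_ℝ • Θ‖ ≤ ‖H‖ * (‖x‖ + ‖y‖) * Real.exp w := by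
      refine (norm_add_le _ _).trans ?_
      rw [norm_smul, norm_smul, hT, hΘ, ← add_mul, mul_add]
      exact mul_le_mul_of_nonneg_right (add_le_add (norm_inner_le_norm _ _)
        (norm_inner_le_norm _ _)) (Real.exp_pos _).le
    refine (norm_sub_le _ _).trans ?_
    rw [norm_smul, norm_smul, norm_smul, hT, Real.norm_ofNat, norm_of_nonneg (Real.exp_pos _).le,
      norm_of_nonneg (sq_nonneg _)]
    have h2 : 4 * (Real.exp (-(2 * w)) * ‖⟪H, x⟫_ℝ • T + ⟪H, y⟫_ℝ • Θ‖) ≤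
        4 * (Real.exp (-(2 * w)) * (‖H‖ * (‖x‖ + ‖y‖) * Real.exp w)) := by gcongr
    have h3 : ‖H‖ ^ 2 * Real.exp w ≤
        ‖H‖ * (Real.exp (-(2 * w)) * (‖x‖ + ‖z‖)) * Real.exp w := by
      rw [sq]; gcongr
    have h4 : 4 * (Real.exp (-(2 * w)) * (‖H‖ * (‖x‖ + ‖y‖) * Real.exp w)) +
        ‖H‖ * (Real.exp (-(2 * w)) * (‖x‖ + ‖z‖)) * Real.exp w =
        ‖H‖ * ((Real.exp (-(2 * w)) * Real.exp w) * (5 * ‖x‖ + 4 * ‖y‖ + ‖z‖)) := by ring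
    rw [e1] at h4
    linarith
  refine (pow_le_pow_left₀ (norm_nonneg _) k1 2).trans ?_
  rw [mul_pow, mul_pow, e2]
  have k2 : (5 * ‖x‖ + 4 * ‖y‖ + ‖z‖) ^ 2 ≤ 42 * (‖x‖ ^ 2 + ‖y‖ ^ 2 + ‖z‖ ^ 2) := by
    nlinarith [sq_nonneg (4 * ‖x‖ - 5 * ‖y‖), sq_nonneg (‖x‖ - 5 * ‖z‖), sq_nonneg (‖y‖ - 4 * ‖z‖)]
  calc _ ≤ ‖H‖ ^ 2 * (Real.exp (-(2 * w)) * (42 * (‖x‖ ^ 2 + ‖y‖ ^ 2 + ‖z‖ ^ 2))) := by gcongr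
    _ = _ := by ring

variable {n : ℕ} {f : ℝ → ℝ → EuclideanSpace ℝ (Fin n)} {u : ℝ → ℝ → ℝ} {m ε a b : ℝ}

/-- A conformal Willmore cylinder whose conformal factor is close to `-m t` in `C¹`, up to an
additive constant. -/
structure IsNearEnd (m ε : ℝ) (f : ℝ → ℝ → EuclideanSpace ℝ (Fin n)) (u : ℝ → ℝ → ℝ)
    (a b : ℝ) : Prop extends ConfWillmore f u (Icc a b) where
  one_le_m : 1 ≤ m
  ε_nonneg : 0 ≤ ε
  ε_le : 2 * π * ε ≤ 1
  pt_u : ∀ t ∈ Icc a b, ∀ θ, |pt u t θ + m| ≤ ε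
  pth_u : ∀ t ∈ Icc a b, ∀ θ, |pth u t θ| ≤ ε

lemma Hmc_eq (f : ℝ → ℝ → EuclideanSpace ℝ (Fin n)) (u : ℝ → ℝ → ℝ) (t θ : ℝ) :
    Hmc f u t θ = Real.exp (-(2 * u t θ)) • (Att f u t θ + Athth f u t θ) := by
  rw [Hmc, Att, Athth]
  congr 1
  abel

lemma betaDens_le_Adens (f : ℝ → ℝ → EuclideanSpace ℝ (Fin n)) (u : ℝ → ℝ → ℝ) (t θ : ℝ) :
    betaDens u (Att f u) (Atth f u) (Athth f u) t θ ≤ Adens f u t θ := by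
  rw [Adens, Asq, betaDens, mul_right_comm, ← Real.exp_add,
    show -(4 * u t θ) + 2 * u t θ = -(2 * u t θ) by ring]
  have := sq_nonneg ‖Atth f u t θ‖
  gcongr
  linarith

lemma norm_sq_add_smul_le {V : Type*} [NormedAddCommGroup V] [InnerProductSpace ℝ V]
    {x T Θ : V} {p q w : ℝ} (hT : ‖T‖ = Real.exp w) (hΘ : ‖Θ‖ = Real.exp w) (hp : |p| ≤ ε)
    (hq : |q| ≤ ε) :
    ‖x + (p • T + q • Θ)‖ ^ 2 ≤ 2 * ‖x‖ ^ 2 + 8 * ε ^ 2 * Real.exp (2 * w) := by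
  have h1 : ‖p • T + q • Θ‖ ≤ 2 * ε * Real.exp w := by
    refine (norm_add_le _ _).trans ?_
    rw [norm_smul, norm_smul, hT, hΘ, ← add_mul]
    exact mul_le_mul_of_nonneg_right (by rw [norm_eq_abs, norm_eq_abs]; linarith)
      (Real.exp_pos _).le
  have h2 := pow_le_pow_left₀ (norm_nonneg _) h1 2
  have h3 : (2 * ε * Real.exp w) ^ 2 = 4 * ε ^ 2 * Real.exp (2 * w) := by
    rw [two_mul w, Real.exp_add]; ring
  linarith [norm_add_sq_le x (p • T + q • Θ)]

lemma betaDens_le_add {V : Type*} [NormedAddCommGroup V] {x₁ x₂ x₃ y₁ y₂ y₃ : ℝ → ℝ → V}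
    {t θ c : ℝ}
    (h₁ : ‖x₁ t θ‖ ^ 2 ≤ 2 * ‖y₁ t θ‖ ^ 2 + c * Real.exp (2 * u t θ))
    (h₂ : ‖x₂ t θ‖ ^ 2 ≤ 2 * ‖y₂ t θ‖ ^ 2 + c * Real.exp (2 * u t θ))
    (h₃ : ‖x₃ t θ‖ ^ 2 ≤ 2 * ‖y₃ t θ‖ ^ 2 + c * Real.exp (2 * u t θ)) :
    betaDens u x₁ x₂ x₃ t θ ≤ 2 * betaDens u y₁ y₂ y₃ t θ + 3 * c := by
  have h4 : Real.exp (-(2 * u t θ)) * Real.exp (2 * u t θ) = 1 := by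
    rw [← Real.exp_add, neg_add_cancel, Real.exp_zero]
  have h5 := mul_le_mul_of_nonneg_left (add_le_add (add_le_add h₁ h₂) h₃)
    (Real.exp_pos (-(2 * u t θ))).le
  unfold betaDens
  linear_combination h5 + 3 * c * h4

namespace IsNearEnd

lemma betaDens_A_le (h : IsNearEnd m ε f u a b) {t : ℝ} (ht : t ∈ Icc a b) (θ : ℝ) :
    betaDens u (Att f u) (Atth f u) (Athth f u) t θ ≤
      2 * betaDens u (defTT m f) (defTTh m f) (defThTh m f) t θ + 24 * ε ^ 2 := by
  have hT := h.norm_pt ht θ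
  have hΘ := h.norm_pth ht θ
  have hp := h.pt_u t ht θ
  have hq := h.pth_u t ht θ
  have hp' := (abs_neg (pt u t θ + m)).trans_le hp
  have hq' := (abs_neg (pth u t θ)).trans_le hq
  refine (betaDens_le_add (c := 8 * ε ^ 2) ?_ ?_ ?_).trans_eq (by ring)
  · convert norm_sq_add_smul_le (x := defTT m f t θ) hT hΘ hp' hq using 3
    simp only [Att, defTT]; module
  · convert norm_sq_add_smul_le (x := defTTh m f t θ) hT hΘ hq' hp' using 3
    simp only [Atth, defTTh]; module
  · convert norm_sq_add_smul_le (x := defThTh m f t θ) hT hΘ hp hq' using 3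
    simp only [Athth, defThTh]; module

lemma betaDens_def_le (h : IsNearEnd m ε f u a b) {t : ℝ} (ht : t ∈ Icc a b) (θ : ℝ) :
    betaDens u (defTT m f) (defTTh m f) (defThTh m f) t θ ≤ 2 * Adens f u t θ + 24 * ε ^ 2 := by
  have hT := h.norm_pt ht θ
  have hΘ := h.norm_pth ht θ
  have hp := h.pt_u t ht θ
  have hq := h.pth_u t ht θ
  have hp' := (abs_neg (pt u t θ + m)).trans_le hp
  have hq' := (abs_neg (pth u t θ)).trans_le hq
  have key := betaDens_le_Adens f u t θ
  refine (betaDens_le_add (c := 8 * ε ^ 2) (y₁ := Att f u) (y₂ := Atth f u) (y₃ := Athth f u)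
    ?_ ?_ ?_).trans (by linarith)
  · convert norm_sq_add_smul_le (x := Att f u t θ) hT hΘ hp hq' using 3
    simp only [Att, defTT]; module
  · convert norm_sq_add_smul_le (x := Atth f u t θ) hT hΘ hq hp using 3
    simp only [Atth, defTTh]; module
  · convert norm_sq_add_smul_le (x := Athth f u t θ) hT hΘ hp' hq using 3
    simp only [Athth, defThTh]; module

lemma norm_sq_flux_le (h : IsNearEnd m ε f u a b) {t : ℝ} (ht : t ∈ Icc a b) (θ : ℝ) :
    ‖fluxT f u t θ‖ ^ 2 + ‖fluxTh f u t θ‖ ^ 2 ≤ 2016 * (‖Hmc f u t θ‖ ^ 2 *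
      (betaDens u (defTT m f) (defTTh m f) (defThTh m f) t θ + ε ^ 2)) := by
  have hT := h.norm_pt ht θ
  have hΘ := h.norm_pth ht θ
  have hH : ‖Hmc f u t θ‖ ≤ Real.exp (-(2 * u t θ)) * (‖Att f u t θ‖ + ‖Athth f u t θ‖) := by
    rw [Hmc_eq, norm_smul, norm_of_nonneg (Real.exp_pos _).le]
    exact mul_le_mul_of_nonneg_left (norm_add_le _ _) (Real.exp_pos _).le
  have h1 := _root_.norm_sq_flux_le (y := Atth f u t θ) hT hΘ hH
  have h2 := _root_.norm_sq_flux_le (x := Athth f u t θ) (y := Atth f u t θ)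
    (z := Att f u t θ) hΘ hT (hH.trans_eq (by rw [add_comm]))
  rw [add_comm (⟪Hmc f u t θ, Athth f u t θ⟫_ℝ • _)] at h2
  have h3 := mul_le_mul_of_nonneg_left (h.betaDens_A_le ht θ) (sq_nonneg ‖Hmc f u t θ‖)
  have h4 : 0 ≤ ‖Hmc f u t θ‖ ^ 2 * betaDens u (defTT m f) (defTTh m f) (defThTh m f) t θ :=
    mul_nonneg (sq_nonneg _) (betaDens_nonneg _ _)
  unfold fluxT fluxTh
  unfold betaDens at *
  linarith

lemma isWillmoreSystem (h : IsNearEnd m ε f u a b) :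
    IsWillmoreSystem m (m + 1) 2016 a b u (Hmc f u) (fluxT f u) (fluxTh f u)
      (defTT m f) (defTTh m f) (defThTh m f) := by
  have hf := h.smooth₂_f
  have hu := h.smooth₂_u
  have hm := h.one_le_m
  have hε := h.ε_nonneg
  have hε1 : ε ≤ 1 := by nlinarith [h.ε_le, pi_gt_three]
  refine
  { smooth_u := hu
    smooth_H := hf.Hmc hu
    smooth_P := hf.fluxT hu
    smooth_R := hf.fluxTh hu
    smooth_β₁ := hf.defTT m
    smooth_β₂ := hf.defTTh m
    smooth_β₃ := hf.defThTh m
    periodic_u := h.periodic₂_u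
    periodic_H := h.periodic₂_Hmc
    periodic_R := h.periodic₂_fluxTh
    periodic_β₁ := h.periodic₂_defTT m
    periodic_β₂ := h.periodic₂_defTTh m
    periodic_β₃ := h.periodic₂_defThTh m
    m_nonneg := by linarith
    m_le := by linarith
    curl := fun t θ => ?_
    div := fun t θ => ?_
    trace := fun t θ => ?_
    C₀_nonneg := by norm_num
    pt_u := fun t ht θ => ?_
    pth_u := fun t ht θ => (h.pth_u t ht θ).trans (by linarith)
    eqn := fun t ht θ => (willmoreOp_eq hf hu t θ).symm.trans (h.willmore t ht θ)
    bound := fun t ht θ => (h.norm_sq_flux_le ht θ).trans ?_ }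
  · have h1 : pth (defTT m f) t θ = _ :=
      ((hf.dt.dt.hasDerivAt_pth t θ).add ((hf.dt.hasDerivAt_pth t θ).const_smul m)).deriv
    have h2 : pt (defTTh m f) t θ = _ :=
      ((hf.dth.dt.hasDerivAt_pt t θ).add ((hf.dth.hasDerivAt_pt t θ).const_smul m)).deriv
    have h3 : pt (pth f) = pth (pt f) := funext₂ hf.pt_pth
    rw [h1, h2, h3, hf.dt.pt_pth]
  · have h1 : pth (defTTh m f) t θ = _ :=
      ((hf.dth.dt.hasDerivAt_pth t θ).add ((hf.dth.hasDerivAt_pth t θ).const_smul m)).deriv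
    have h2 : pt (defThTh m f) t θ = _ :=
      ((hf.dth.dth.hasDerivAt_pt t θ).sub ((hf.dt.hasDerivAt_pt t θ).const_smul m)).deriv
    rw [h1, h2, hf.dth.pt_pth, defTT, defThTh]
    module
  · rw [Hmc, smul_smul, ← Real.exp_add, add_neg_cancel, Real.exp_zero, one_smul, defTT, defThTh]
    module
  · have h1 := abs_le.1 (h.pt_u t ht θ)
    rw [abs_le]
    constructor <;> linarith
  · have h1 : ε ^ 2 ≤ 1 := by nlinarith
    gcongr

end IsNearEnd

end NearEnd

section Slice

variable {n : ℕ} {f : ℝ → ℝ → EuclideanSpace ℝ (Fin n)} {u : ℝ → ℝ → ℝ} {m ε a b : ℝ}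

lemma fluxT_add (f : ℝ → ℝ → EuclideanSpace ℝ (Fin n)) (u : ℝ → ℝ → ℝ) (t θ : ℝ) :
    (2 : ℝ) • pt (Hmc f u) t θ + fluxT f u t θ = -((-2 : ℝ) • pt (Hmc f u) t θ -
      (4 : ℝ) • (Real.exp (-(2 * u t θ)) • (⟪Hmc f u t θ, Att f u t θ⟫_ℝ • pt f t θ +
        ⟪Hmc f u t θ, Atth f u t θ⟫_ℝ • pth f t θ)) + ‖Hmc f u t θ‖ ^ 2 • pt f t θ) := by
  rw [fluxT]
  module

lemma integral_flux_eq_zero (hf : Smooth₂ f) (hu : Smooth₂ u) {t : ℝ}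
    (h : ∀ c, tau1 f u c t = 0) :
    ∫ θ in (0 : ℝ)..(2 * π), ((2 : ℝ) • pt (Hmc f u) t θ + fluxT f u t θ) = 0 := by
  have c1 := (hf.Hmc hu).dt.continuous_right t
  have c2 := (hf.fluxT_main hu).continuous_right t
  have c3 := ((hf.Hmc hu).norm_sq.smul hf.dt).continuous_right t
  have h1 := h (∫ θ in (0 : ℝ)..(2 * π), -((2 : ℝ) • pt (Hmc f u) t θ + fluxT f u t θ))
  have h2 : ∫ θ in (0 : ℝ)..(2 * π), -((2 : ℝ) • pt (Hmc f u) t θ + fluxT f u t θ) =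
      (-2 : ℝ) • (∫ θ in (0 : ℝ)..(2 * π), pt (Hmc f u) t θ)
    - (4 : ℝ) • (∫ θ in (0 : ℝ)..(2 * π), Real.exp (-(2 * u t θ)) •
        (⟪Hmc f u t θ, Att f u t θ⟫_ℝ • pt f t θ + ⟪Hmc f u t θ, Atth f u t θ⟫_ℝ • pth f t θ))
    + ∫ θ in (0 : ℝ)..(2 * π), ‖Hmc f u t θ‖ ^ 2 • pt f t θ := by
    rw [← intervalIntegral.integral_smul, ← intervalIntegral.integral_smul,
      ← intervalIntegral.integral_sub (Continuous.intervalIntegrable (by fun_prop) _ _)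
        (Continuous.intervalIntegrable (by fun_prop) _ _),
      ← intervalIntegral.integral_add (Continuous.intervalIntegrable (by fun_prop) _ _)
        (Continuous.intervalIntegrable (by fun_prop) _ _)]
    simp only [fluxT_add, neg_neg]
  rw [tau1, ← h2, inner_self_eq_zero, intervalIntegral.integral_neg, neg_eq_zero] at h1
  exact h1

lemma toEuclideanLin_wedge (x y w : EuclideanSpace ℝ (Fin n)) :
    Matrix.toEuclideanLin (Matrix.vecMulVec x y - Matrix.vecMulVec y x) w = wedge x y w := by
  rw [wedge_apply]
  ext i
  simp [Matrix.toLpLin_apply, Matrix.vecMulVec_mulVec,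
    EuclideanSpace.inner_eq_star_dotProduct, dotProduct_comm]

lemma integral_torque_eq_zero (hf : Smooth₂ f) (hu : Smooth₂ u) {t : ℝ}
    (h : ∀ S : Matrix (Fin n) (Fin n) ℝ, S.transpose = -S → tau2 f u S t = 0)
    (x y : EuclideanSpace ℝ (Fin n)) :
    ∫ θ in (0 : ℝ)..(2 * π), (2 * ⟪Hmc f u t θ, wedge x y (pt f t θ)⟫_ℝ -
      ⟪(2 : ℝ) • pt (Hmc f u) t θ + fluxT f u t θ, wedge x y (f t θ)⟫_ℝ) = 0 := by
  have h1 := h (Matrix.vecMulVec x y - Matrix.vecMulVec y x) (by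
    rw [Matrix.transpose_sub, Matrix.transpose_vecMulVec, Matrix.transpose_vecMulVec, neg_sub])
  have hS : ∀ θ, pt (fun a b => wedge x y (f a b)) t θ = wedge x y (pt f t θ) := fun θ =>
    ((wedge x y).hasFDerivAt.comp_hasDerivAt t (hf.hasDerivAt_pt t θ)).deriv
  simp only [tau2, toEuclideanLin_wedge, hS] at h1
  have cH := (hf.Hmc hu).continuous_right t
  have cH' := (hf.Hmc hu).dt.continuous_right t
  have cA := (hf.Att hu).continuous_right t
  have cB := (hf.Atth hu).continuous_right t
  have cf := hf.continuous_right t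
  have cT := hf.dt.continuous_right t
  have cΘ := hf.dth.continuous_right t
  have cE := hu.exp_neg_two_mul.continuous_right t
  rw [← intervalIntegral.integral_const_mul, ← intervalIntegral.integral_const_mul,
    ← intervalIntegral.integral_sub (Continuous.intervalIntegrable (by fun_prop) _ _)
      (Continuous.intervalIntegrable (by fun_prop) _ _),
    ← intervalIntegral.integral_add (Continuous.intervalIntegrable (by fun_prop) _ _)
      (Continuous.intervalIntegrable (by fun_prop) _ _)] at h1
  rw [← h1]
  congr 1
  funext θ
  simp only [fluxT, inner_add_left, inner_sub_left, real_inner_smul_left]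
  ring

lemma IsNearEnd.abs_sub_le (h : IsNearEnd m ε f u a b) {t : ℝ} (ht : t ∈ Icc a b) {θ : ℝ}
    (hθ : θ ∈ Icc 0 (2 * π)) : |u t θ - u t 0| ≤ 1 := by
  have h1 := (convex_univ (E := ℝ) (𝕜 := ℝ)).norm_image_sub_le_of_norm_deriv_le
    (f := fun s => u t s) (C := ε) (x := 0) (y := θ)
    (fun s _ => (h.smooth₂_u.hasDerivAt_pth t s).differentiableAt)
    (fun s _ => h.pth_u t ht s) (mem_univ _) (mem_univ _)
  rw [norm_eq_abs, norm_eq_abs, sub_zero, abs_of_nonneg hθ.1] at h1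
  have h2 : ε * θ ≤ ε * (2 * π) := mul_le_mul_of_nonneg_left hθ.2 h.ε_nonneg
  linarith [h.ε_le]

lemma IsNearEnd.isResonantSlice (h : IsNearEnd m ε f u a b) {t η : ℝ} (ht : t ∈ Ioo a b)
    (h₁ : ∀ c, tau1 f u c t = 0)
    (h₂ : ∀ S : Matrix (Fin n) (Fin n) ℝ, S.transpose = -S → tau2 f u S t = 0)
    (hη : 9 * ∫ θ in (0 : ℝ)..(2 * π), betaDens u (defTT m f) (defTTh m f) (defThTh m f) t θ ≤ η)
    (hη1 : 4 * π * η ≤ 1) :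
    IsResonantSlice m η (Real.exp (u t 0)) (f t) (pt f t) (pth f t) (Hmc f u t)
      (pt (Hmc f u) t) (fluxT f u t) (defTT m f t) (defTTh m f t) (defThTh m f t) := by
  have hf := h.smooth₂_f
  have hu := h.smooth₂_u
  have ht' := Ioo_subset_Icc_self ht
  have hg0 : 0 ≤ ∫ θ in (0 : ℝ)..(2 * π),
      betaDens u (defTT m f) (defTTh m f) (defThTh m f) t θ :=
    intervalIntegral.integral_nonneg two_pi_nonneg fun _ _ => betaDens_nonneg _ _
  have c1 := (hf.defTT m).continuous_right t
  have c2 := (hf.defTTh m).continuous_right t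
  have c3 := (hf.defThTh m).continuous_right t
  refine
  { cont_h := (hf.Hmc hu).continuous_right t
    cont_h' := (hf.Hmc hu).dt.continuous_right t
    cont_P := (hf.fluxT hu).continuous_right t
    cont_β₁ := c1
    cont_β₂ := c2
    cont_β₃ := c3
    one_le_m := h.one_le_m
    η_nonneg := by linarith
    η_le := hη1
    U_pos := Real.exp_pos _
    hasDeriv_F := fun θ => hf.hasDerivAt_pth t θ
    hasDeriv_X := fun θ => ?_
    hasDeriv_Z := fun θ => ?_
    norm_X := h.norm_pt ht' 0
    norm_Z := h.norm_pth ht' 0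
    orth := h.conf_orth t ht' 0
    inner_X := fun θ => ?_
    inner_Z := fun θ => ?_
    integral_le := ?_
    flux := integral_flux_eq_zero hf hu h₁
    torque := integral_torque_eq_zero hf hu h₂ }
  · refine (hf.dt.hasDerivAt_pth t θ).congr_deriv ?_
    rw [defTTh, hf.pt_pth, add_sub_cancel_right]
  · refine (hf.dth.hasDerivAt_pth t θ).congr_deriv ?_
    rw [defThTh, sub_add_cancel]
  · rw [inner_add_left, h.inner_pt_Hmc_pt ht, real_inner_smul_left, h.inner_Hmc_pt ht, defTT,
      inner_add_right, inner_smul_right, h.inner_Hmc_pt ht]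
    ring
  · rw [inner_add_left, h.inner_pt_Hmc_pth ht, real_inner_smul_left, h.inner_Hmc_pth ht, defTTh,
      inner_add_right, inner_smul_right, h.inner_Hmc_pth ht]
    ring
  · have cg : Continuous fun θ => betaDens u (defTT m f) (defTTh m f) (defThTh m f) t θ := by
      have := h.isWillmoreSystem.smooth_betaDens.continuous_right t
      exact this
    have h3 : ∫ θ in (0 : ℝ)..(2 * π),
        (‖defTT m f t θ‖ ^ 2 + ‖defTTh m f t θ‖ ^ 2 + ‖defThTh m f t θ‖ ^ 2) ≤
        ∫ θ in (0 : ℝ)..(2 * π), 9 * Real.exp (u t 0) ^ 2 *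
          betaDens u (defTT m f) (defTTh m f) (defThTh m f) t θ := by
      refine intervalIntegral.integral_mono_on two_pi_nonneg
        (Continuous.intervalIntegrable (by fun_prop) _ _)
        (Continuous.intervalIntegrable (by fun_prop) _ _) fun θ hθ => ?_
      rw [betaDens, ← mul_assoc]
      refine le_mul_of_one_le_left (by positivity) ?_
      have h4 := (abs_le.1 (h.abs_sub_le ht' hθ)).2
      have h5 : Real.exp 2 ≤ 9 := by
        have := Real.exp_one_lt_d9
        have h6 : Real.exp 2 = Real.exp 1 ^ 2 := by rw [← Real.exp_nat_mul]; norm_num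
        rw [h6]
        nlinarith [Real.exp_pos 1]
      calc (1 : ℝ) ≤ Real.exp (2 + 2 * u t 0 - 2 * u t θ) := Real.one_le_exp (by linarith)
        _ = Real.exp 2 * Real.exp (u t 0) ^ 2 * Real.exp (-(2 * u t θ)) := by
          rw [← Real.exp_nat_mul, ← Real.exp_add, ← Real.exp_add]
          congr 1
        _ ≤ _ := by gcongr
    rw [intervalIntegral.integral_const_mul] at h3
    have h4 := mul_le_mul_of_nonneg_right hη (sq_nonneg (Real.exp (u t 0)))
    linarith

end Slice

section Assembly

variable {n : ℕ} {f : ℝ → ℝ → EuclideanSpace ℝ (Fin n)} {u : ℝ → ℝ → ℝ} {δ : ℝ}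

lemma dblInt_le_of_subset {a b c d : ℝ} {F : ℝ → ℝ → ℝ} (hF : Cont₂ F)
    (hF0 : ∀ t θ, 0 ≤ F t θ) (hca : c ≤ a) (hbd : b ≤ d) :
    dblInt a b F ≤ dblInt c d F := by
  have h1 := dblInt_nonneg hca (F := F) fun t _ θ => hF0 t θ
  have h2 := dblInt_nonneg hbd (F := F) fun t _ θ => hF0 t θ
  rw [← dblInt_add_adjacent (a := c) (b := a) (c := d) hF,
    ← dblInt_add_adjacent (a := a) (b := b) (c := d) hF]
  linarith

lemma Smooth₂.Adens (hf : Smooth₂ f) (hu : Smooth₂ u) : Smooth₂ (Adens f u) := by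
  have h1 : Smooth₂ (fun t θ => -(4 * u t θ)) := by simpa using hu.const_mul (-4)
  exact (h1.exp.mul (((hf.Att hu).norm_sq.add ((hf.Atth hu).norm_sq.const_mul 2)).add
    (hf.Athth hu).norm_sq)).mul (hu.const_mul 2).exp

lemma Smooth₂.Hdens (hf : Smooth₂ f) (hu : Smooth₂ u) : Smooth₂ (Hdens f u) :=
  (hf.Hmc hu).norm_sq.mul (hu.const_mul 2).exp

lemma Adens_nonneg (f : ℝ → ℝ → EuclideanSpace ℝ (Fin n)) (u : ℝ → ℝ → ℝ) (t θ : ℝ) :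
    0 ≤ Adens f u t θ := by
  unfold Adens Asq; positivity

lemma Hdens_nonneg (f : ℝ → ℝ → EuclideanSpace ℝ (Fin n)) (u : ℝ → ℝ → ℝ) (t θ : ℝ) :
    0 ≤ Hdens f u t θ := by
  unfold Hdens; positivity

lemma dblInt_const (a b c : ℝ) : dblInt a b (fun _ _ => c) = (b - a) * (2 * π * c) := by
  simp only [dblInt, intervalIntegral.integral_const, smul_eq_mul, sub_zero]

lemma resonanceConst_nonneg (m : ℝ) : 0 ≤ resonanceConst m := by
  unfold resonanceConst; positivity

lemma IsNearEnd.dblInt_betaDens_le {m T : ℝ} (h : IsNearEnd m δ f u 0 T)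
    (hA : dblInt 0 T (Adens f u) ≤ 3 * δ) {t : ℝ} (ht : t ∈ Icc 1 (T - 1)) :
    dblInt (t - 1) (t + 1) (betaDens u (defTT m f) (defTTh m f) (defThTh m f)) ≤ 400 * δ := by
  have hf := h.smooth₂_f
  have hu := h.smooth₂_u
  have cA := (hf.Adens hu).cont₂
  have cc := (smooth₂_const (24 * δ ^ 2)).cont₂
  have hδ := h.ε_nonneg
  have hsub : Icc (t - 1) (t + 1) ⊆ Icc 0 T :=
    Icc_subset_Icc (by linarith [ht.1]) (by linarith [ht.2])
  have h1 := dblInt_mono (by linarith : t - 1 ≤ t + 1) h.isWillmoreSystem.smooth_betaDens.cont₂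
    ((cA.const_mul 2).add cc) fun s hs θ => h.betaDens_def_le (hsub hs) θ
  rw [dblInt_add (cA.const_mul 2) cc, dblInt_const_mul, dblInt_const] at h1
  have h2 := dblInt_le_of_subset cA (Adens_nonneg f u) (by linarith [ht.1] : 0 ≤ t - 1)
    (by linarith [ht.2] : t + 1 ≤ T)
  have h3 : 2 * π * δ * δ ≤ 1 * δ := mul_le_mul_of_nonneg_right h.ε_le hδ
  nlinarith

theorem exists_weighted_le (n m : ℕ) (hm : 1 ≤ m) {κ : ℝ} (hκ0 : 0 ≤ κ) (hκ : κ < 1) :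
    ∃ C > 0, ∃ δ₀ > 0, ∀ δ, 0 < δ → δ ≤ δ₀ →
      ∀ {T : ℝ} {f : ℝ → ℝ → EuclideanSpace ℝ (Fin n)} {u : ℝ → ℝ → ℝ} {μ μ' : ℝ → ℝ},
      4 < T → IsNearEnd m δ f u 0 T →
      (∀ t ∈ Icc 0 T, ∀ c, tau1 f u c t = 0) →
      (∀ t ∈ Icc 0 T, ∀ S : Matrix (Fin n) (Fin n) ℝ, S.transpose = -S → tau2 f u S t = 0) →
      dblInt 0 T (Adens f u) ≤ 3 * δ → IsExpWeight m κ 1 (T - 1) μ μ' →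
      ContDiff ℝ (⊤ : ℕ∞) μ →
      dblInt 1 (T - 1) (fun t θ => μ t * ‖Hmc f u t θ‖ ^ 2) ≤
        C * (dblInt 1 2 (fun t θ => μ t * ‖Hmc f u t θ‖ ^ 2) +
          dblInt (T - 2) (T - 1) (fun t θ => μ t * ‖Hmc f u t θ‖ ^ 2)) := by
  obtain ⟨C₂, hC₂, κ₁, hκ₁, hreg⟩ := IsWillmoreSystem.exists_integral_le
    (E := EuclideanSpace ℝ (Fin n)) (m + 1) 2016 (by positivity) (by norm_num)
  obtain ⟨C, hC, η₀, hη₀, hred⟩ := IsReducedSystem.exists_le_ends n m hm hκ hκ0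
    (C₀ := 2016) (by norm_num) (resonanceConst_nonneg m)
  set K := 9 * (C₂ * 400 + 1) with hK
  have hK0 : 0 < K := by positivity
  refine ⟨C, hC, min (κ₁ / 400) (min (η₀ / K) (1 / (4 * π * K))), by positivity,
    fun δ hδ hδ' T f u μ μ' hT h hτ₁ hτ₂ hA hμ hμs => ?_⟩
  rw [le_min_iff, le_min_iff, le_div_iff₀ (by norm_num), le_div_iff₀ hK0,
    le_div_iff₀ (by positivity)] at hδ'
  obtain ⟨hδ₁, hδ₂, hδ₃⟩ := hδ'
  have hf := h.smooth₂_f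
  have hu := h.smooth₂_u
  have hsys := h.isWillmoreSystem
  have hsub : Icc 1 (T - 1) ⊆ Ioo 0 T := fun t ht => ⟨by linarith [ht.1], by linarith [ht.2]⟩
  set g := betaDens u (defTT m f) (defTTh m f) (defThTh m f) with hg
  have hgi : ∀ t ∈ Icc 1 (T - 1), ∫ θ in (0 : ℝ)..(2 * π), g t θ ≤ C₂ * (400 * δ) := fun t ht =>
    hreg (hsys.mono (Icc_subset_Icc (by linarith [ht.1]) (by linarith [ht.2]))) (by positivity)
      (by linarith) (h.dblInt_betaDens_le hA ht)
  have hδ2 : 2 * π * δ ^ 2 ≤ δ := by nlinarith [h.ε_le]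
  have hR : IsReducedSystem m κ 2016 (K * δ) 1 (T - 1) μ μ' (Hmc f u) (fluxT f u) (fluxTh f u)
      (fun t θ => g t θ + δ ^ 2) :=
  { weight := hμ
    smooth_weight := hμs
    smooth_H := hsys.smooth_H
    smooth_P := hsys.smooth_P
    smooth_R := hsys.smooth_R
    periodic_H := hsys.periodic_H
    periodic_R := hsys.periodic_R
    eqn := fun t ht => hsys.eqn t (by rwa [sub_self, sub_add_cancel] at ht)
    cont_G := hsys.smooth_betaDens.cont₂.add (smooth₂_const _).cont₂
    G_nonneg := fun t θ => add_nonneg (betaDens_nonneg _ _) (sq_nonneg _)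
    C₀_nonneg := by norm_num
    η_nonneg := by positivity
    bound := fun t ht θ => h.norm_sq_flux_le (Ioo_subset_Icc_self (hsub ht)) θ
    integral_le := fun t ht => by
      rw [intervalIntegral.integral_add
        ((hsys.smooth_betaDens.continuous_right t).intervalIntegrable _ _)
        (continuous_const.intervalIntegrable _ _), intervalIntegral.integral_const, smul_eq_mul,
        sub_zero, hK]
      have := hgi t ht
      nlinarith [mul_pos hC₂ hδ] }
  have hres : ResonanceBound m (resonanceConst m) (K * δ) 1 (T - 1) (Hmc f u) (fluxT f u) := by
    intro t ht
    have ht' := hsub ht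
    have hs := h.isResonantSlice (η := K * δ) ht' (hτ₁ t (Ioo_subset_Icc_self ht'))
      (hτ₂ t (Ioo_subset_Icc_self ht')) (by rw [hK]; nlinarith [hgi t ht]) (by linarith)
    refine hs.resonance_bound.trans (mul_le_mul_of_nonneg_left (add_le_add_left
      (mul_le_mul_of_nonneg_left ?_ hR.η_nonneg) _) (resonanceConst_nonneg m))
    have c1 := hsys.smooth_H.continuous_right t
    have c2 := hsys.smooth_H.dt.continuous_right t
    have c3 := hsys.smooth_H.dth.continuous_right t
    refine intervalIntegral.integral_mono_on two_pi_nonneg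
      (Continuous.intervalIntegrable (by fun_prop) _ _)
      (Continuous.intervalIntegrable (by fun_prop) _ _) fun θ _ => ?_
    linarith [sq_nonneg ‖pth (Hmc f u) t θ‖]
  have := hred hR (by linarith) (by linarith) hres
  rwa [show (1 : ℝ) + 1 = 2 by norm_num, show T - 1 - 1 = T - 2 by ring] at this

end Assembly

section ThreeCircle

variable {n : ℕ} {f : ℝ → ℝ → EuclideanSpace ℝ (Fin n)} {u : ℝ → ℝ → ℝ}

lemma cylInt_eq_dblInt {a b : ℝ} (hab : a ≤ b) {F : ℝ → ℝ → ℝ} (hF : Cont₂ F) :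
    cylInt F a b = dblInt a b F := by
  have hc : Continuous fun p : ℝ × ℝ => F p.1 p.2 := hF
  have hi : IntegrableOn (fun p : ℝ × ℝ => F p.1 p.2) (Icc a b ×ˢ Icc 0 (2 * π)) :=
    hc.continuousOn.integrableOn_compact (isCompact_Icc.prod isCompact_Icc)
  rw [cylInt, Measure.volume_eq_prod, setIntegral_prod _ hi, integral_Icc_eq_integral_Ioc, dblInt,
    intervalIntegral.integral_of_le hab]
  congr 1
  funext t
  rw [integral_Icc_eq_integral_Ioc, intervalIntegral.integral_of_le two_pi_nonneg]

lemma dblInt_mono_on {a b : ℝ} (hab : a ≤ b) {F G : ℝ → ℝ → ℝ} (hF : Cont₂ F) (hG : Cont₂ G)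
    (h : ∀ t ∈ Icc a b, ∀ θ ∈ Icc 0 (2 * π), F t θ ≤ G t θ) : dblInt a b F ≤ dblInt a b G :=
  intervalIntegral.integral_mono_on hab (hF.intervalIntegrable_integral _ _ _ _)
    (hG.intervalIntegrable_integral _ _ _ _) fun t ht =>
      intervalIntegral.integral_mono_on two_pi_nonneg ((hF.right t).intervalIntegrable _ _)
        ((hG.right t).intervalIntegrable _ _) (h t ht)

/-- A smooth approximation of the distance `|t - c|`. -/
def smoothDist (c t : ℝ) : ℝ := √(1 + (t - c) ^ 2)

lemma contDiff_smoothDist (c : ℝ) : ContDiff ℝ (⊤ : ℕ∞) (smoothDist c) :=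
  ContDiff.sqrt (by fun_prop) fun t => by positivity

lemma abs_le_smoothDist (c t : ℝ) : |t - c| ≤ smoothDist c t :=
  abs_le_sqrt (by linarith)

lemma smoothDist_le (c t : ℝ) : smoothDist c t ≤ 1 + |t - c| := by
  rw [smoothDist, sqrt_le_left (by positivity)]
  nlinarith [sq_abs (t - c), abs_nonneg (t - c)]

lemma hasDerivAt_smoothDist (c t : ℝ) :
    HasDerivAt (smoothDist c) ((t - c) / smoothDist c t) t := by
  have h1 : HasDerivAt (fun s : ℝ => 1 + (s - c) ^ 2) (2 * (t - c)) t :=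
    (((hasDerivAt_id t).sub_const c).pow 2 |>.const_add 1).congr_deriv (by simp)
  have h2 : (1 : ℝ) + (t - c) ^ 2 ≠ 0 := by positivity
  refine (h1.sqrt h2).congr_deriv ?_
  rw [smoothDist, mul_div_mul_left _ _ two_ne_zero]

lemma abs_div_smoothDist_le (c t : ℝ) : |(t - c) / smoothDist c t| ≤ 1 := by
  have h : 0 ≤ smoothDist c t := sqrt_nonneg _
  rw [abs_div, abs_of_nonneg h]
  exact div_le_one_of_le₀ (abs_le_smoothDist c t) h

/-- The conformal factor along `θ = 0`, damped exponentially away from `t = c`. -/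
def dampedWeight (u : ℝ → ℝ → ℝ) (κ c t : ℝ) : ℝ :=
  Real.exp (2 * u t 0 - 2 * κ * smoothDist c t)

lemma hasDerivAt_dampedWeight (hu : Smooth₂ u) (κ c t : ℝ) :
    HasDerivAt (dampedWeight u κ c) (dampedWeight u κ c t *
      (2 * pt u t 0 - 2 * κ * ((t - c) / smoothDist c t))) t :=
  (((hu.hasDerivAt_pt t 0).const_mul 2).sub ((hasDerivAt_smoothDist c t).const_mul (2 * κ))).exp

lemma contDiff_dampedWeight (hu : Smooth₂ u) (κ c : ℝ) :
    ContDiff ℝ (⊤ : ℕ∞) (dampedWeight u κ c) := by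
  have h1 : ContDiff ℝ (⊤ : ℕ∞) fun t => u t 0 :=
    ContDiff.comp (g := fun p : ℝ × ℝ => u p.1 p.2) hu (contDiff_id.prodMk contDiff_const)
  exact ((contDiff_const.mul h1).sub (contDiff_const.mul (contDiff_smoothDist c))).exp

lemma IsNearEnd.isExpWeight_dampedWeight {m δ T κ₀ κ a b : ℝ} (h : IsNearEnd m δ f u 0 T)
    (hκ₀ : 0 ≤ κ₀) (hκ : κ₀ + δ ≤ κ) (c : ℝ) (ha : 0 ≤ a) (hb : b ≤ T) :
    IsExpWeight m κ a b (dampedWeight u κ₀ c) (fun t => dampedWeight u κ₀ c t *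
      (2 * pt u t 0 - 2 * κ₀ * ((t - c) / smoothDist c t))) where
  hasDeriv := hasDerivAt_dampedWeight h.smooth₂_u κ₀ c
  continuous' := by
    have h1 := (contDiff_dampedWeight h.smooth₂_u κ₀ c).continuous
    have h2 := h.smooth₂_u.dt.continuous_left 0
    have h3 := (contDiff_smoothDist c).continuous
    have h4 : ∀ t, smoothDist c t ≠ 0 := fun t => (sqrt_pos.2 (by positivity)).ne'
    exact h1.mul ((continuous_const.mul h2).sub (continuous_const.mul
      ((continuous_id.sub continuous_const).div h3 h4)))
  pos t := Real.exp_pos _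
  abs_le t ht := by
    have h0 : 0 < dampedWeight u κ₀ c t := Real.exp_pos _
    have h1 := abs_le.1 (h.pt_u t ⟨ha.trans ht.1, ht.2.trans hb⟩ 0)
    have h2 := abs_le.1 (abs_div_smoothDist_le c t)
    set r := (t - c) / smoothDist c t
    rw [show dampedWeight u κ₀ c t * (2 * pt u t 0 - 2 * κ₀ * r) + 2 * m * dampedWeight u κ₀ c t =
      (2 * (pt u t 0 + m) - 2 * (κ₀ * r)) * dampedWeight u κ₀ c t by ring, abs_mul,
      abs_of_pos h0]
    refine mul_le_mul_of_nonneg_right (abs_le.2 ⟨?_, ?_⟩) h0.le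
    · nlinarith [mul_le_mul_of_nonneg_left h2.2 hκ₀]
    · nlinarith [mul_le_mul_of_nonneg_left h2.1 hκ₀]

lemma IsNearEnd.dampedWeight_le {m δ T κ : ℝ} (h : IsNearEnd m δ f u 0 T) (hκ₀ : 0 ≤ κ)
    (hκ : κ ≤ 1) {t : ℝ} (ht : t ∈ Icc 0 T) (hd : T / 2 - 2 ≤ |t - T / 2|) {θ : ℝ}
    (hθ : θ ∈ Icc 0 (2 * π)) :
    dampedWeight u κ (T / 2) t ≤ Real.exp (6 - κ * T) * Real.exp (2 * u t θ) := by
  have h1 := abs_le.1 (h.abs_sub_le ht hθ)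
  have h2 := mul_le_mul_of_nonneg_left (hd.trans (abs_le_smoothDist (T / 2) t)) hκ₀
  rw [← Real.exp_add, dampedWeight, Real.exp_le_exp]
  linarith [h1.1, h1.2]

lemma IsNearEnd.exp_le_dampedWeight {m δ T κ : ℝ} (h : IsNearEnd m δ f u 0 T) (hκ₀ : 0 ≤ κ)
    (hκ : κ ≤ 1) {t : ℝ} (ht : t ∈ Icc 0 T) (hd : |t - T / 2| ≤ T / 6) {θ : ℝ}
    (hθ : θ ∈ Icc 0 (2 * π)) :
    Real.exp (2 * u t θ) ≤ Real.exp (4 + κ * (T / 3)) * dampedWeight u κ (T / 2) t := by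
  have h1 := abs_le.1 (h.abs_sub_le ht hθ)
  have h2 := mul_le_mul_of_nonneg_left ((smoothDist_le (T / 2) t).trans (add_le_add_right hd 1)) hκ₀
  rw [dampedWeight, ← Real.exp_add, Real.exp_le_exp]
  linarith [h1.1, h1.2]

lemma IsNearEnd.dblInt_dampedWeight_le {m δ T κ a b : ℝ} (h : IsNearEnd m δ f u 0 T)
    (hκ₀ : 0 ≤ κ) (hκ : κ ≤ 1) (ha : 0 ≤ a) (hab : a ≤ b) (hb : b ≤ T)
    (hd : ∀ t ∈ Icc a b, T / 2 - 2 ≤ |t - T / 2|) :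
    dblInt a b (fun t θ => dampedWeight u κ (T / 2) t * ‖Hmc f u t θ‖ ^ 2) ≤
      Real.exp (6 - κ * T) * dblInt a b (Hdens f u) := by
  have hH := (h.smooth₂_f.Hdens h.smooth₂_u).cont₂
  have hW := ((smooth₂_fst (contDiff_dampedWeight h.smooth₂_u κ (T / 2))).mul
    (h.smooth₂_f.Hmc h.smooth₂_u).norm_sq).cont₂
  rw [← dblInt_const_mul]
  refine dblInt_mono_on hab hW (hH.const_mul _) fun t ht θ hθ => ?_
  have := mul_le_mul_of_nonneg_right
    (h.dampedWeight_le hκ₀ hκ ⟨ha.trans ht.1, ht.2.trans hb⟩ (hd t ht) hθ)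
    (sq_nonneg ‖Hmc f u t θ‖)
  rw [Hdens]
  linarith

lemma IsNearEnd.dblInt_Hdens_le {m δ T κ a b : ℝ} (h : IsNearEnd m δ f u 0 T)
    (hκ₀ : 0 ≤ κ) (hκ : κ ≤ 1) (ha : 0 ≤ a) (hab : a ≤ b) (hb : b ≤ T)
    (hd : ∀ t ∈ Icc a b, |t - T / 2| ≤ T / 6) :
    dblInt a b (Hdens f u) ≤ Real.exp (4 + κ * (T / 3)) *
      dblInt a b (fun t θ => dampedWeight u κ (T / 2) t * ‖Hmc f u t θ‖ ^ 2) := by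
  have hH := (h.smooth₂_f.Hdens h.smooth₂_u).cont₂
  have hW := ((smooth₂_fst (contDiff_dampedWeight h.smooth₂_u κ (T / 2))).mul
    (h.smooth₂_f.Hmc h.smooth₂_u).norm_sq).cont₂
  rw [← dblInt_const_mul]
  refine dblInt_mono_on hab hH (hW.const_mul _) fun t ht θ hθ => ?_
  have := mul_le_mul_of_nonneg_right
    (h.exp_le_dampedWeight hκ₀ hκ ⟨ha.trans ht.1, ht.2.trans hb⟩ (hd t ht) hθ)
    (sq_nonneg ‖Hmc f u t θ‖)
  rw [Hdens]
  linarith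

/-- The three-circle inequality with rate `2κ₀` and a multiplicative constant. -/
theorem exists_three_circle_le (n m : ℕ) (hm : 1 ≤ m) {κ₀ : ℝ} (hκ0 : 0 ≤ κ₀) (hκ : κ₀ < 1) :
    ∃ C > 0, ∃ δ > 0, ∀ {L : ℝ} {f : ℝ → ℝ → EuclideanSpace ℝ (Fin n)} {u : ℝ → ℝ → ℝ},
      4 < L → (2 * π * δ ≤ 1 → IsNearEnd m δ f u 0 (3 * L)) →
      (∀ t ∈ Icc 0 (3 * L), ∀ c, tau1 f u c t = 0) →
      (∀ t ∈ Icc 0 (3 * L), ∀ S : Matrix (Fin n) (Fin n) ℝ, S.transpose = -S →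
        tau2 f u S t = 0) →
      dblInt 0 (3 * L) (Adens f u) ≤ 3 * δ →
      dblInt L (2 * L) (Hdens f u) ≤ C * Real.exp (-(2 * κ₀ * L)) *
        (dblInt 0 L (Hdens f u) + dblInt (2 * L) (3 * L) (Hdens f u)) := by
  obtain ⟨C, hC, δ₀, hδ₀, hmain⟩ := exists_weighted_le n m hm (κ := (1 + κ₀) / 2)
    (by linarith) (by linarith)
  have hgap : 0 < (1 - κ₀) / 2 := by linarith
  set δ := min δ₀ (min ((1 - κ₀) / 2) (1 / (2 * π))) with hδ
  have hδ1 : δ ≤ δ₀ := min_le_left _ _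
  have hδ2 : δ ≤ (1 - κ₀) / 2 := (min_le_right _ _).trans (min_le_left _ _)
  have hδ3 : δ ≤ 1 / (2 * π) := (min_le_right _ _).trans (min_le_right _ _)
  have hδ0 : 0 < δ := by positivity
  refine ⟨C * Real.exp 10, by positivity, δ, hδ0, fun {L f u} hL h hτ₁ hτ₂ hA => ?_⟩
  replace h := h (by rw [le_div_iff₀ (by positivity)] at hδ3; linarith)
  have hH := (h.smooth₂_f.Hdens h.smooth₂_u).cont₂
  have hH0 := Hdens_nonneg f u
  have hμ := contDiff_dampedWeight h.smooth₂_u κ₀ (3 * L / 2)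
  have hW := ((smooth₂_fst hμ).mul (h.smooth₂_f.Hmc h.smooth₂_u).norm_sq).cont₂
  have hW0 : ∀ t θ, 0 ≤ dampedWeight u κ₀ (3 * L / 2) t * ‖Hmc f u t θ‖ ^ 2 := fun t θ =>
    mul_nonneg (Real.exp_pos _).le (sq_nonneg _)
  have h1 := hmain δ hδ0 hδ1 (by linarith) h hτ₁ hτ₂ hA
    (h.isExpWeight_dampedWeight hκ0 (by linarith) (3 * L / 2) zero_le_one (by linarith)) hμ
  have h2 := h.dblInt_Hdens_le (a := L) (b := 2 * L) hκ0 hκ.le (by linarith) (by linarith)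
    (by linarith) fun t ht => abs_le.2 ⟨by linarith [ht.1], by linarith [ht.2]⟩
  have h3 := dblInt_le_of_subset hW hW0 (by linarith : 1 ≤ L) (by linarith : 2 * L ≤ 3 * L - 1)
  have h4 := h.dblInt_dampedWeight_le (a := 1) (b := 2) hκ0 hκ.le (by linarith) (by linarith)
    (by linarith) fun t ht => le_abs.2 (Or.inr (by linarith [ht.2]))
  have h5 := h.dblInt_dampedWeight_le (a := 3 * L - 2) (b := 3 * L - 1) hκ0 hκ.le (by linarith)
    (by linarith) (by linarith) fun t ht => le_abs.2 (Or.inl (by linarith [ht.1]))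
  have h6 := dblInt_le_of_subset hH hH0 (by linarith : (0 : ℝ) ≤ 1) (by linarith : 2 ≤ L)
  have h7 := dblInt_le_of_subset hH hH0 (by linarith : 2 * L ≤ 3 * L - 2)
    (by linarith : 3 * L - 1 ≤ 3 * L)
  calc dblInt L (2 * L) (Hdens f u)
      ≤ Real.exp (4 + κ₀ * (3 * L / 3)) * (C * (Real.exp (6 - κ₀ * (3 * L)) *
        (dblInt 0 L (Hdens f u) + dblInt (2 * L) (3 * L) (Hdens f u)))) := by
        refine h2.trans (mul_le_mul_of_nonneg_left (h3.trans (h1.trans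
          (mul_le_mul_of_nonneg_left ?_ hC.le))) (Real.exp_pos _).le)
        have h8 := mul_le_mul_of_nonneg_left (add_le_add h6 h7)
          (Real.exp_pos (6 - κ₀ * (3 * L))).le
        linarith
    _ = _ := by
        have : Real.exp (4 + κ₀ * (3 * L / 3)) * Real.exp (6 - κ₀ * (3 * L)) =
            Real.exp 10 * Real.exp (-(2 * κ₀ * L)) := by
          rw [← Real.exp_add, ← Real.exp_add]; congr 1; ring
        linear_combination (C * (dblInt 0 L (Hdens f u) +
          dblInt (2 * L) (3 * L) (Hdens f u))) * this

end ThreeCircle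

section NearEnd

lemma ConfWillmore.isNearEnd_of_gradNorm_le {f : ℝ → ℝ → EuclideanSpace ℝ (Fin n)}
    {v : ℝ → ℝ → ℝ} {m δ T : ℝ} (h : ConfWillmore f (fun t θ => -m * t + v t θ) (Icc 0 T))
    (hm : 1 ≤ m) (hδ : 0 ≤ δ) (hδ' : 2 * π * δ ≤ 1)
    (hv : ∀ t ∈ Icc 0 T, ∀ θ, gradNorm v t θ ≤ δ) :
    IsNearEnd m δ f (fun t θ => -m * t + v t θ) 0 T := by
  have hu : Smooth₂ fun t θ => -m * t + v t θ := h.smooth_u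
  have hvs : Smooth₂ v := by
    have := hu.sub (smooth₂_fst (φ := fun t => -m * t) (by fun_prop))
    simpa using this
  refine { h with one_le_m := hm, ε_nonneg := hδ, ε_le := hδ', pt_u := ?_, pth_u := ?_ }
  · intro t ht θ
    have h1 : pt (fun t θ => -m * t + v t θ) t θ = -m * 1 + pt v t θ :=
      (((hasDerivAt_id t).const_mul (-m)).add (hvs.hasDerivAt_pt t θ)).deriv
    rw [h1, mul_one, neg_add_cancel_comm]
    exact (abs_le_sqrt (by linarith [sq_nonneg (pth v t θ)])).trans (hv t ht θ)
  · intro t ht θ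
    have h1 : pth (fun t θ => -m * t + v t θ) t θ = pth v t θ :=
      ((hvs.hasDerivAt_pth t θ).const_add (-m * t)).deriv
    rw [h1]
    exact (abs_le_sqrt (by linarith [sq_nonneg (pt v t θ)])).trans (hv t ht θ)

end NearEnd

/-- **Theorem 3.1** (three-circle theorem for the Willmore energy). -/
theorem three_circle_willmore_energy (n : ℕ) (m : ℕ) (hm : 0 < m)
    (q : ℝ) (hq0 : 0 < q) (hq2 : q < 2) :
    ∃ L₀ > (0 : ℝ), ∃ ε₀ > (0 : ℝ), ∀ L > L₀,
      ∀ (f : ℝ → ℝ → EuclideanSpace ℝ (Fin n)) (v : ℝ → ℝ → ℝ),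
      ConfWillmore f (fun t θ => -(m : ℝ) * t + v t θ) (Set.Icc 0 (3 * L)) →
      (∀ t ∈ Set.Icc (0 : ℝ) (3 * L), ∀ c : EuclideanSpace ℝ (Fin n),
        tau1 f (fun t θ => -(m : ℝ) * t + v t θ) c t = 0) →
      (∀ t ∈ Set.Icc (0 : ℝ) (3 * L), ∀ S : Matrix (Fin n) (Fin n) ℝ, S.transpose = -S →
        tau2 f (fun t θ => -(m : ℝ) * t + v t θ) S t = 0) →
      (∀ i : ℕ, 1 ≤ i → i ≤ 3 → ∃ b : ℝ,
        (∀ t ∈ Set.Icc (((i : ℝ) - 1) * L) ((i : ℝ) * L), ∀ θ : ℝ, gradNorm v t θ ≤ b)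
        ∧ cylInt (Adens f (fun t θ => -(m : ℝ) * t + v t θ)) (((i : ℝ) - 1) * L) ((i : ℝ) * L)
            + b < ε₀) →
      cylInt (Hdens f (fun t θ => -(m : ℝ) * t + v t θ)) L (2 * L)
        ≤ Real.exp (-q * L) *
          (cylInt (Hdens f (fun t θ => -(m : ℝ) * t + v t θ)) 0 L
            + cylInt (Hdens f (fun t θ => -(m : ℝ) * t + v t θ)) (2 * L) (3 * L)) := by
  obtain ⟨C, hC, δ, hδ, hmain⟩ := exists_three_circle_le n m hm (κ₀ := (1 + q / 2) / 2)
    (by linarith) (by linarith)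
  have hr : 0 < 1 - q / 2 := by linarith
  refine ⟨4 + C / (1 - q / 2), by positivity, δ, hδ, fun L hL f v h hτ₁ hτ₂ hE => ?_⟩
  have hC' : 0 < C / (1 - q / 2) := by positivity
  have hL4 : 4 < L := by linarith
  have hCL : C ≤ L * (1 - q / 2) := by rw [← div_le_iff₀ hr]; linarith
  have hf : Smooth₂ f := h.smooth_f
  have hu : Smooth₂ fun t θ => -(m : ℝ) * t + v t θ := h.smooth_u
  have cA := (hf.Adens hu).cont₂
  have cH := (hf.Hdens hu).cont₂
  have hA0 := Adens_nonneg f fun t θ => -(m : ℝ) * t + v t θ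
  have hH0 := Hdens_nonneg f fun t θ => -(m : ℝ) * t + v t θ
  have hpiece : ∀ i : ℕ, 1 ≤ i → i ≤ 3 →
      (∀ t ∈ Icc (((i : ℝ) - 1) * L) (i * L), ∀ θ, gradNorm v t θ ≤ δ) ∧
        dblInt (((i : ℝ) - 1) * L) (i * L) (Adens f fun t θ => -(m : ℝ) * t + v t θ) ≤ δ := by
    intro i hi hi'
    obtain ⟨b, hb, hlt⟩ := hE i hi hi'
    have hle : ((i : ℝ) - 1) * L ≤ i * L := by linarith
    rw [cylInt_eq_dblInt hle cA] at hlt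
    have h1 := dblInt_nonneg hle fun t _ θ => hA0 t θ
    have h2 : 0 ≤ b := (sqrt_nonneg _).trans (hb _ (left_mem_Icc.2 hle) 0)
    exact ⟨fun t ht θ => (hb t ht θ).trans (by linarith), by linarith⟩
  obtain ⟨g₁, A₁⟩ := hpiece 1 le_rfl (by norm_num)
  obtain ⟨g₂, A₂⟩ := hpiece 2 (by norm_num) (by norm_num)
  obtain ⟨g₃, A₃⟩ := hpiece 3 (by norm_num) le_rfl
  norm_num [-neg_mul] at g₁ g₂ g₃ A₁ A₂ A₃
  have hg : ∀ t ∈ Icc 0 (3 * L), ∀ θ, gradNorm v t θ ≤ δ := by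
    intro t ht θ
    rcases le_total t L with h1 | h1
    · exact g₁ t ht.1 h1 θ
    rcases le_total t (2 * L) with h2 | h2
    · exact g₂ t h1 h2 θ
    · exact g₃ t h2 ht.2 θ
  have hA := dblInt_add_adjacent (a := 0) (b := L) (c := 3 * L) cA
  rw [← dblInt_add_adjacent (a := L) (b := 2 * L) (c := 3 * L) cA] at hA
  have hfin := hmain hL4 (fun hδ' => h.isNearEnd_of_gradNorm_le (by exact_mod_cast hm) hδ.le hδ' hg)
    hτ₁ hτ₂ (by linarith)
  rw [cylInt_eq_dblInt (by linarith) cH, cylInt_eq_dblInt (by linarith) cH,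
    cylInt_eq_dblInt (by linarith) cH]
  refine hfin.trans (mul_le_mul_of_nonneg_right ?_ (add_nonneg
    (dblInt_nonneg (by linarith) fun t _ θ => hH0 t θ)
    (dblInt_nonneg (by linarith) fun t _ θ => hH0 t θ)))
  calc C * Real.exp (-(2 * ((1 + q / 2) / 2) * L))
      ≤ Real.exp (L * (1 - q / 2)) * Real.exp (-(2 * ((1 + q / 2) / 2) * L)) :=
        mul_le_mul_of_nonneg_right (by linarith [Real.add_one_le_exp (L * (1 - q / 2))])
          (Real.exp_pos _).le
    _ = Real.exp (-q * L) := by rw [← Real.exp_add]; congr 1; ring
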